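/- arXiv:math/0701576 — 2 statements merged into one kernel-verified Lean document; each statement's English description precedes it below -/
import Mathlib

section
/- Cartan-type uniqueness theorem for small almost complex deformations of the unit ball: There exist an integer k ≥ 2 and ε > 0 such that the following holds. Let B denote the open unit ball of ℝ^{2n} ≅ ℂ^n and let J be a smooth almost complex structure defined on a neighborhood of the closure of B with ‖J − J_st‖_{C^k(closure of B)} ≤ ε. If φ is a homeomorphism of the closure of B onto itself, of class C¹ up to the boundary, which maps B onto B, is (J,J)-holomorphic on B (dφ_x ∘ J(x) = J(φ(x)) ∘ dφ_x for all x ∈ B), and satisfies φ(0) = 0 and dφ(0) = Id, then φ is the identity map. -/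
open Complex Metric Set MeasureTheory Filter Topology Bornology ENNReal

noncomputable section

/-- We identify `ℝ^{2n}` with `ℂⁿ` (with the Euclidean norm). -/
abbrev Cn (n : ℕ) : Type := EuclideanSpace ℂ (Fin n)

/-- The standard complex structure on `ℂⁿ ≅ ℝ^{2n}`: multiplication by `i`,
viewed as an `ℝ`-linear map. -/
def Jstd (n : ℕ) : Cn n →L[ℝ] Cn n :=
  ContinuousLinearMap.restrictScalars ℝ (Complex.I • ContinuousLinearMap.id ℂ (Cn n))

/-- The standard complex structure on `ℂ ≅ ℝ²`. -/
def JstdC : ℂ →L[ℝ] ℂ :=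
  ContinuousLinearMap.restrictScalars ℝ (Complex.I • ContinuousLinearMap.id ℂ ℂ)

/-- `J` is a (smooth) almost complex structure on the set `Ω ⊆ ℂⁿ ≅ ℝ^{2n}`:
a `C^∞` field of linear automorphisms with `J(x) ∘ J(x) = -Id`. -/
def IsACS {n : ℕ} (Ω : Set (Cn n)) (J : Cn n → Cn n →L[ℝ] Cn n) : Prop :=
  ContDiffOn ℝ (⊤ : ℕ∞) J Ω ∧ ∀ x ∈ Ω, (J x).comp (J x) = -ContinuousLinearMap.id ℝ (Cn n)

/-- The open unit disc `Δ` in `ℂ`. -/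
def unitDisc : Set ℂ := Metric.ball 0 1

/-- A map between (subsets of) almost complex spaces is `(J,J')`-holomorphic on `s` if
`df_x ∘ J(x) = J'(f(x)) ∘ df_x` on `s`. -/
def PseudoHolOn {n m : ℕ} (J : Cn n → Cn n →L[ℝ] Cn n) (J' : Cn m → Cn m →L[ℝ] Cn m)
    (f : Cn n → Cn m) (s : Set (Cn n)) : Prop :=
  ∀ x ∈ s, DifferentiableAt ℝ f x ∧
    (fderiv ℝ f x).comp (J x) = (J' (f x)).comp (fderiv ℝ f x)

/-- A map from an open subset of `ℂ` is `J`-holomorphic on `s` if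
`df_ζ ∘ J_st = J(f(ζ)) ∘ df_ζ` on `s`. -/
def JHolOn {n : ℕ} (J : Cn n → Cn n →L[ℝ] Cn n) (f : ℂ → Cn n) (s : Set ℂ) : Prop :=
  ∀ ζ ∈ s, DifferentiableAt ℝ f ζ ∧
    (fderiv ℝ f ζ).comp JstdC = (J (f ζ)).comp (fderiv ℝ f ζ)

/-- A `J`-holomorphic disc in `D`. -/
def JDisc {n : ℕ} (J : Cn n → Cn n →L[ℝ] Cn n) (D : Set (Cn n)) (f : ℂ → Cn n) : Prop :=
  MapsTo f unitDisc D ∧ JHolOn J f unitDisc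

/-- The nonnegative part of an extended real number, as an element of `ℝ≥0∞`. -/
def erealPos (x : EReal) : ℝ≥0∞ := if x = ⊤ then ⊤ else ENNReal.ofReal x.toReal

/-- The integral of an `EReal`-valued function: the (unsigned) integral of the positive part
minus the integral of the negative part. -/
def erealIntegral {X : Type} [MeasurableSpace X] (μ : Measure X) (g : X → EReal) : EReal :=
  ((∫⁻ x, erealPos (g x) ∂μ : ℝ≥0∞) : EReal) - ((∫⁻ x, erealPos (-(g x)) ∂μ : ℝ≥0∞) : EReal)

/-- `h : ℂ → [-∞,∞)` is subharmonic on `s`: upper semicontinuous and satisfying the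
sub-mean-value inequality `h(a) ≤ (2π)⁻¹ ∫₀^{2π} h(a + r e^{iθ}) dθ` whenever the closed disc
of center `a` and radius `r` is contained in `s`. -/
def SubharmonicOnE (h : ℂ → EReal) (s : Set ℂ) : Prop :=
  UpperSemicontinuousOn h s ∧
  ∀ a : ℂ, ∀ r : ℝ, 0 < r → Metric.closedBall a r ⊆ s →
    h a ≤ (((2 * Real.pi)⁻¹ : ℝ) : EReal) *
      erealIntegral (volume.restrict (Set.Ioc (0 : ℝ) (2 * Real.pi)))
        (fun θ : ℝ => h (a + (r : ℂ) * Complex.exp ((θ : ℂ) * Complex.I)))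

/-- `u : Ω → [-∞,∞)` is `J`-plurisubharmonic on `Ω`: upper semicontinuous, and `u ∘ f` is
subharmonic on `Δ` for every `J`-holomorphic disc `f : Δ → Ω`. -/
def JPshOn {n : ℕ} (J : Cn n → Cn n →L[ℝ] Cn n) (Ω : Set (Cn n)) (u : Cn n → EReal) : Prop :=
  UpperSemicontinuousOn u Ω ∧
  ∀ f : ℂ → Cn n, JDisc J Ω f → SubharmonicOnE (fun ζ => u (f ζ)) unitDisc

/-- Real-valued `J`-plurisubharmonic functions. -/
def JPshOnR {n : ℕ} (J : Cn n → Cn n →L[ℝ] Cn n) (Ω : Set (Cn n)) (u : Cn n → ℝ) : Prop :=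
  JPshOn J Ω (fun x => (u x : EReal))

/-- The `1`-form `J*dr : w ↦ dr_x(J(x)w)`. -/
def JStarDr {n : ℕ} (J : Cn n → Cn n →L[ℝ] Cn n) (r : Cn n → ℝ) (x : Cn n) : Cn n →L[ℝ] ℝ :=
  (fderiv ℝ r x).comp (J x)

/-- The Levi form of a `C²` function `r`:
`L^J_r(p,v) = -d(J*dr)_p(v, J(p)v)` where `dα_p(u,w) = (∂_u α)_p(w) - (∂_w α)_p(u)`. -/
def LeviForm {n : ℕ} (J : Cn n → Cn n →L[ℝ] Cn n) (r : Cn n → ℝ) (p v : Cn n) : ℝ :=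
  -((fderiv ℝ (JStarDr J r) p v) (J p v) - (fderiv ℝ (JStarDr J r) p (J p v)) v)

/-- `r` is strictly `J`-plurisubharmonic on `S`: its Levi form is positive definite there. -/
def StrictJPshOn {n : ℕ} (J : Cn n → Cn n →L[ℝ] Cn n) (r : Cn n → ℝ) (S : Set (Cn n)) : Prop :=
  ∀ p ∈ S, ∀ v : Cn n, v ≠ 0 → 0 < LeviForm J r p v

/-- The Kobayashi–Royden infinitesimal pseudometric of `(D,J)`:
`K(p,v) = inf {α > 0 : ∃ J-holomorphic disc f : Δ → D, f(0) = p, df_0(∂/∂x) = v/α}`. -/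
def kobMetric {n : ℕ} (J : Cn n → Cn n →L[ℝ] Cn n) (D : Set (Cn n)) (p v : Cn n) : ℝ :=
  sInf {α : ℝ | 0 < α ∧ ∃ f : ℂ → Cn n, JDisc J D f ∧ f 0 = p ∧ fderiv ℝ f 0 1 = α⁻¹ • v}

/-- A piecewise `C¹` path `γ : [0,1] → ℝ^{2n}`. -/
def PiecewiseC1On {n : ℕ} (γ : ℝ → Cn n) : Prop :=
  ContinuousOn γ (Set.Icc 0 1) ∧
  ∃ (m : ℕ) (t : ℕ → ℝ), t 0 = 0 ∧ t m = 1 ∧ (∀ i < m, t i < t (i + 1)) ∧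
    ∀ i < m, ContDiffOn ℝ 1 γ (Set.Icc (t i) (t (i + 1)))

/-- The (integrated) Kobayashi pseudodistance of `(D,J)`: the infimum of the Kobayashi–Royden
lengths of piecewise `C¹` paths in `D` joining `p` to `q`. -/
def kobDist {n : ℕ} (J : Cn n → Cn n →L[ℝ] Cn n) (D : Set (Cn n)) (p q : Cn n) : ℝ :=
  sInf {L : ℝ | ∃ γ : ℝ → Cn n, PiecewiseC1On γ ∧ MapsTo γ (Set.Icc 0 1) D ∧
    γ 0 = p ∧ γ 1 = q ∧ L = ∫ t in (0 : ℝ)..1, kobMetric J D (γ t) (deriv γ t)}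

/-- The cluster set of `f` (defined on `S`) along `A ⊆ closure S`: all limits of sequences
`f(s_k)` where `s_k ∈ S` converges to a point of `A`. -/
def clusterSet {X Y : Type*} [TopologicalSpace X] [TopologicalSpace Y]
    (f : X → Y) (S A : Set X) : Set Y :=
  {y | ∃ u : ℕ → X, (∀ k, u k ∈ S) ∧ (∃ a ∈ A, Tendsto u atTop (𝓝 a)) ∧
    Tendsto (fun k => f (u k)) atTop (𝓝 y)}

/-- `N` is a `d`-dimensional `C^∞` submanifold of `ℂⁿ ≅ ℝ^{2n}`: near every point it can be
straightened, by a `C^∞` diffeomorphism onto an open subset of `ℝ^{2n}`, to the coordinate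
subspace spanned by the first `d` coordinates. -/
def IsSmoothSubmanifold {n : ℕ} (d : ℕ) (N : Set (Cn n)) : Prop :=
  ∀ p ∈ N, ∃ (U : Set (Cn n)) (V : Set (EuclideanSpace ℝ (Fin (2 * n))))
    (φ : Cn n → EuclideanSpace ℝ (Fin (2 * n))) (ψ : EuclideanSpace ℝ (Fin (2 * n)) → Cn n),
    IsOpen U ∧ p ∈ U ∧ IsOpen V ∧ ContDiffOn ℝ (⊤ : ℕ∞) φ U ∧ ContDiffOn ℝ (⊤ : ℕ∞) ψ V ∧
    (∀ x ∈ U, ψ (φ x) = x) ∧ (∀ y ∈ V, φ (ψ y) = y) ∧ MapsTo φ U V ∧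
    φ '' (N ∩ U) = V ∩ {x | ∀ i : Fin (2 * n), d ≤ (i : ℕ) → x i = 0}

/-- The tangent set of `N ⊆ ℂⁿ` at `p`: velocities at `0` of differentiable curves through `p`
staying in `N` near time `0`. For a `C^∞` submanifold this is the tangent space `T_pN`. -/
def TangentSet {n : ℕ} (N : Set (Cn n)) (p : Cn n) : Set (Cn n) :=
  {v | ∃ γ : ℝ → Cn n, γ 0 = p ∧ (∀ᶠ t in 𝓝 (0 : ℝ), γ t ∈ N) ∧
    DifferentiableAt ℝ γ 0 ∧ deriv γ 0 = v}

/-- `N` is totally real for `J`: `T_pN ∩ J(p)(T_pN) = {0}` at every `p ∈ N`. -/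
def TotallyReal {n : ℕ} (J : Cn n → Cn n →L[ℝ] Cn n) (N : Set (Cn n)) : Prop :=
  ∀ p ∈ N, ∀ v ∈ TangentSet N p, J p v ∈ TangentSet N p → v = 0

/-- `ρ` is a (global) `C^∞` defining function of `D`, defined on the neighborhood `Ω` of the
closure of `D`, with nonvanishing differential on `∂D`.  (This encodes that `D` has
`C^∞` boundary.) -/
def DefiningFunction {n : ℕ} (D Ω : Set (Cn n)) (ρ : Cn n → ℝ) : Prop :=
  IsOpen Ω ∧ closure D ⊆ Ω ∧ ContDiffOn ℝ (⊤ : ℕ∞) ρ Ω ∧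
  D = {x ∈ Ω | ρ x < 0} ∧ ∀ x ∈ frontier D, fderiv ℝ ρ x ≠ 0

/-- `D` is a bounded strictly `J`-pseudoconvex domain with `C^∞` boundary: it admits a smooth
defining function which is `J`-plurisubharmonic on `D` and strictly `J`-plurisubharmonic on a
neighborhood of `∂D`. -/
def StrictlyPseudoconvexDomain {n : ℕ} (J : Cn n → Cn n →L[ℝ] Cn n) (D : Set (Cn n)) : Prop :=
  IsOpen D ∧ IsConnected D ∧ IsBounded D ∧
  ∃ (Ω : Set (Cn n)) (ρ : Cn n → ℝ), DefiningFunction D Ω ρ ∧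
    JPshOnR J D ρ ∧ ∃ W : Set (Cn n), IsOpen W ∧ frontier D ⊆ W ∧ StrictJPshOn J ρ W

end

set_option linter.unusedSectionVars false
set_option linter.unusedSimpArgs false

section CartanAux

variable {E : Type*} [NormedAddCommGroup E] [NormedSpace ℝ E] [FiniteDimensional ℝ E]

/-- Point on the circle of radius `t` in the plane spanned by `v`, `w`. -/
noncomputable def circPt (x v w : E) (t θ : ℝ) : E := x + t • (Real.cos θ • v + Real.sin θ • w)

/-- Rotation by `-θ` for the complex structure `J`. -/
noncomputable def rotM (J : E →L[ℝ] E) (θ : ℝ) (y : E) : E := Real.cos θ • y - Real.sin θ • J y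

/-- First Fourier coefficient on the circle of radius `t`. -/
noncomputable def circCoef (f : E → E) (J : E →L[ℝ] E) (x v w : E) (t : ℝ) : E :=
  ∫ θ in (0 : ℝ)..(2 * Real.pi), rotM J θ (f (circPt x v w t θ))


theorem circPt_dist {x v w : E} (hv : ‖v‖ ≤ 1) (hw : ‖w‖ ≤ 2) (t θ : ℝ) :
    ‖circPt x v w t θ - x‖ ≤ 3 * |t| := by
  have h1 : ‖Real.cos θ • v + Real.sin θ • w‖ ≤ 3 := by
    refine (norm_add_le _ _).trans ?_
    rw [norm_smul, norm_smul, Real.norm_eq_abs, Real.norm_eq_abs]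
    nlinarith [Real.abs_cos_le_one θ, Real.abs_sin_le_one θ, norm_nonneg v, norm_nonneg w,
      abs_nonneg (Real.cos θ), abs_nonneg (Real.sin θ)]
  simp only [circPt, add_sub_cancel_left, norm_smul, Real.norm_eq_abs]
  nlinarith [abs_nonneg t]


theorem rotM_norm {J : E →L[ℝ] E} (hJ : ‖J‖ ≤ 2) (θ : ℝ) (y : E) : ‖rotM J θ y‖ ≤ 3 * ‖y‖ := by
  refine (norm_sub_le _ _).trans ?_
  rw [norm_smul, norm_smul, Real.norm_eq_abs, Real.norm_eq_abs]
  have h := (J.le_opNorm y).trans (mul_le_mul_of_nonneg_right hJ (norm_nonneg y))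
  nlinarith [Real.abs_cos_le_one θ, Real.abs_sin_le_one θ, norm_nonneg y, norm_nonneg (J y),
      abs_nonneg (Real.cos θ), abs_nonneg (Real.sin θ)]


theorem rotM_continuous (J : E →L[ℝ] E) {y : ℝ → E} (hy : Continuous y) :
    Continuous fun θ => rotM J θ (y θ) := by
  unfold rotM
  fun_prop


theorem circPt_continuous (x v w : E) (t : ℝ) : Continuous fun θ => circPt x v w t θ := by
  unfold circPt
  fun_prop


theorem rotM_hasDerivAt (J : E →L[ℝ] E) (hJJ : ∀ y, J (J y) = -y) {y : ℝ → E} {y' : E} {θ : ℝ}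
    (hy : HasDerivAt y y' θ) :
    HasDerivAt (fun s => rotM J s (y s)) (rotM J θ y' - J (rotM J θ (y θ))) θ := by
  have h1 := (Real.hasDerivAt_cos θ).smul hy
  have h2 := (Real.hasDerivAt_sin θ).smul (J.hasFDerivAt.comp_hasDerivAt θ hy)
  refine (h1.sub h2).congr_deriv ?_
  simp only [rotM, map_sub, map_smul, hJJ, Function.comp]
  module

theorem circCoef_hasDerivAt {f : E → E} {f' : E → E →L[ℝ] E} {J : E →L[ℝ] E} {x v w : E}
    {ρ Λ t : ℝ} (hf : ∀ z ∈ ball x ρ, HasFDerivAt f (f' z) z) (hc : ContinuousOn f' (ball x ρ))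
    (hΛ : ∀ z ∈ ball x ρ, ‖f' z‖ ≤ Λ) (hv : ‖v‖ ≤ 1) (hw : ‖w‖ ≤ 2) (hJ : ‖J‖ ≤ 2)
    (ht : 3 * |t| < ρ) :
    HasDerivAt (circCoef f J x v w) (∫ θ in (0 : ℝ)..(2 * Real.pi),
      rotM J θ (f' (circPt x v w t θ) (Real.cos θ • v + Real.sin θ • w))) t := by
  have hmem : ∀ s : ℝ, 3 * |s| < ρ → ∀ θ, circPt x v w s θ ∈ ball x ρ := by
    intro s hs θ
    rw [mem_ball_iff_norm]
    exact (circPt_dist hv hw s θ).trans_lt hs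
  have hfc : ContinuousOn f (ball x ρ) := fun z hz => (hf z hz).continuousAt.continuousWithinAt
  have hopen : {s : ℝ | 3 * |s| < ρ} ∈ 𝓝 t := by
    have ho : IsOpen {s : ℝ | 3 * |s| < ρ} := isOpen_lt (by fun_prop) (by fun_prop)
    exact ho.mem_nhds ht
  have hcont : ∀ s : ℝ, 3 * |s| < ρ → Continuous fun θ => rotM J θ (f (circPt x v w s θ)) := by
    intro s hs
    exact rotM_continuous J (hfc.comp_continuous (circPt_continuous x v w s) (hmem s hs))
  have hcont' : Continuous fun θ =>
      rotM J θ (f' (circPt x v w t θ) (Real.cos θ • v + Real.sin θ • w)) := by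
    apply rotM_continuous
    exact (hc.comp_continuous (circPt_continuous x v w t) (hmem t ht)).clm_apply (by fun_prop)
  refine (intervalIntegral.hasDerivAt_integral_of_dominated_loc_of_deriv_le
    (F := fun s θ => rotM J θ (f (circPt x v w s θ)))
    (F' := fun s θ => rotM J θ (f' (circPt x v w s θ) (Real.cos θ • v + Real.sin θ • w)))
    (bound := fun _ => 3 * (Λ * 3)) hopen ?_ ?_ ?_ ?_ ?_ ?_).2
  · filter_upwards [hopen] with s hs
    exact (hcont s hs).aestronglyMeasurable
  · exact (hcont t ht).intervalIntegrable _ _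
  · exact hcont'.aestronglyMeasurable
  · refine Eventually.of_forall fun θ _ s hs => ?_
    refine (rotM_norm hJ _ _).trans ?_
    have h1 : ‖Real.cos θ • v + Real.sin θ • w‖ ≤ 3 := by
      have := circPt_dist (x := x) hv hw 1 θ
      simpa [circPt] using this
    have h2 := hΛ _ (hmem s hs θ)
    have h3 := (f' (circPt x v w s θ)).le_opNorm (Real.cos θ • v + Real.sin θ • w)
    have h4 : ‖f' (circPt x v w s θ)‖ * ‖Real.cos θ • v + Real.sin θ • w‖ ≤ Λ * 3 :=
      mul_le_mul h2 h1 (norm_nonneg _) ((norm_nonneg _).trans h2)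
    linarith
  · exact intervalIntegrable_const
  · refine Eventually.of_forall fun θ _ s hs => ?_
    have h1 : HasDerivAt (fun s => circPt x v w s θ) (Real.cos θ • v + Real.sin θ • w) s := by
      have := ((hasDerivAt_id s).smul_const (Real.cos θ • v + Real.sin θ • w)).const_add x
      simpa [circPt] using this
    have h2 := (hf _ (hmem s hs θ)).comp_hasDerivAt s h1
    have h3 := (J.hasFDerivAt.comp_hasDerivAt s h2)
    exact (h2.const_smul (Real.cos θ)).sub (h3.const_smul (Real.sin θ))

/-- The basic identity `c' = c / t + error`. -/
theorem circCoef_deriv_est {f : E → E} {f' : E → E →L[ℝ] E} {J : E →L[ℝ] E} {x v w : E}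
    {ρ κ t : ℝ} (hf : ∀ z ∈ ball x ρ, HasFDerivAt f (f' z) z) (hc : ContinuousOn f' (ball x ρ))
    (hv : ‖v‖ ≤ 1) (hw : ‖w‖ ≤ 2) (hJ : ‖J‖ ≤ 2)
    (hJJ : ∀ y, J (J y) = -y) (hκ0 : 0 ≤ κ)
    (hκ : ∀ z ∈ ball x ρ, ‖f' z w - J (f' z v)‖ ≤ κ * ‖z - x‖)
    (ht0 : 0 ≤ t) (ht : 3 * t < ρ) :
    ‖t • (∫ θ in (0 : ℝ)..(2 * Real.pi),
      rotM J θ (f' (circPt x v w t θ) (Real.cos θ • v + Real.sin θ • w)))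
      - circCoef f J x v w t‖ ≤ 54 * κ * t ^ 2 * (2 * Real.pi) := by
  have hmem : ∀ θ, circPt x v w t θ ∈ ball x ρ := by
    intro θ
    rw [mem_ball_iff_norm]
    exact (circPt_dist hv hw t θ).trans_lt (by rwa [abs_of_nonneg ht0])
  have hfc : ContinuousOn f (ball x ρ) := fun z hz => (hf z hz).continuousAt.continuousWithinAt
  have hA : Continuous fun θ => f' (circPt x v w t θ) :=
    hc.comp_continuous (circPt_continuous x v w t) hmem
  have hY : Continuous fun θ => f (circPt x v w t θ) :=
    hfc.comp_continuous (circPt_continuous x v w t) hmem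
  -- the total θ-derivative
  have hder : ∀ θ, HasDerivAt (fun s => rotM J s (f (circPt x v w t s)))
      (rotM J θ (f' (circPt x v w t θ) (t • (-Real.sin θ • v + Real.cos θ • w)))
        - J (rotM J θ (f (circPt x v w t θ)))) θ := by
    intro θ
    apply rotM_hasDerivAt J hJJ
    apply (hf _ (hmem θ)).comp_hasDerivAt
    have h1 := ((Real.hasDerivAt_cos θ).smul_const v).add ((Real.hasDerivAt_sin θ).smul_const w)
    exact (h1.const_smul t).const_add x
  have hc1 : Continuous fun θ =>
      rotM J θ (f' (circPt x v w t θ) (t • (-Real.sin θ • v + Real.cos θ • w))) :=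
    rotM_continuous J (hA.clm_apply (by fun_prop))
  have hc2 : Continuous fun θ => rotM J θ (f (circPt x v w t θ)) := rotM_continuous J hY
  have hc3 : Continuous fun θ =>
      rotM J θ (f' (circPt x v w t θ) (Real.cos θ • v + Real.sin θ • w)) :=
    rotM_continuous J (hA.clm_apply (by fun_prop))
  have hint := intervalIntegral.integral_eq_sub_of_hasDerivAt (a := 0) (b := 2 * Real.pi)
    (fun θ _ => hder θ) ((hc1.sub (J.continuous.comp hc2)).intervalIntegrable _ _)
  have hzero : (∫ θ in (0 : ℝ)..(2 * Real.pi),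
      J (rotM J θ (f' (circPt x v w t θ) (t • (-Real.sin θ • v + Real.cos θ • w)))
        - J (rotM J θ (f (circPt x v w t θ))))) = 0 := by
    have hcomm := J.intervalIntegral_comp_comm
      ((hc1.sub (J.continuous.comp hc2)).intervalIntegrable (μ := volume) 0 (2 * Real.pi))
    refine hcomm.trans ?_
    refine (congrArg J hint).trans ?_
    simp [rotM, circPt]
  have hc4 : Continuous fun θ => t • rotM J θ
      (f' (circPt x v w t θ) (Real.cos θ • v + Real.sin θ • w)) := hc3.const_smul t
  have key : t • (∫ θ in (0 : ℝ)..(2 * Real.pi),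
      rotM J θ (f' (circPt x v w t θ) (Real.cos θ • v + Real.sin θ • w)))
      - circCoef f J x v w t = ∫ θ in (0 : ℝ)..(2 * Real.pi),
      t • J (rotM J θ (rotM J θ (f' (circPt x v w t θ) w - J (f' (circPt x v w t θ) v)))) := by
    refine Eq.trans (add_zero _).symm ?_
    refine Eq.trans (congrArg (HAdd.hAdd _) hzero.symm) ?_
    rw [circCoef, ← intervalIntegral.integral_smul,
      ← intervalIntegral.integral_sub (hc4.intervalIntegrable _ _)
        (hc2.intervalIntegrable _ _), ← intervalIntegral.integral_add]
    · apply intervalIntegral.integral_congr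
      intro θ _
      have hcs := Real.sin_sq_add_cos_sq θ
      have hs2 : Real.sin θ ^ 2 = 1 - Real.cos θ ^ 2 := by linarith
      simp only [rotM, map_sub, map_add, map_smul, hJJ, map_neg]
      generalize f' (circPt x v w t θ) v = a
      generalize f' (circPt x v w t θ) w = b
      match_scalars <;> first | ring1 | linear_combination t * hcs
    · exact (hc4.sub hc2).intervalIntegrable _ _
    · exact (J.continuous.comp (hc1.sub (J.continuous.comp hc2))).intervalIntegrable _ _
  rw [key]
  refine (intervalIntegral.norm_integral_le_of_norm_le_const
    (C := 54 * κ * t ^ 2) (fun θ _ => ?_)).trans ?_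
  · have h1 := hκ _ (hmem θ)
    have h2 := circPt_dist (x := x) hv hw t θ
    rw [abs_of_nonneg ht0] at h2
    set e := f' (circPt x v w t θ) w - J (f' (circPt x v w t θ) v)
    have h3 := rotM_norm hJ θ e
    have h4 := rotM_norm hJ θ (rotM J θ e)
    have h5 := (J.le_opNorm (rotM J θ (rotM J θ e))).trans
      (mul_le_mul_of_nonneg_right hJ (norm_nonneg _))
    have h6 : ‖e‖ ≤ κ * (3 * t) := h1.trans (mul_le_mul_of_nonneg_left h2 hκ0)
    rw [norm_smul, Real.norm_eq_abs, abs_of_nonneg ht0]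
    have h7 : ‖J (rotM J θ (rotM J θ e))‖ ≤ 54 * κ * t := by linarith
    calc _ ≤ t * (54 * κ * t) := mul_le_mul_of_nonneg_left h7 ht0
      _ = _ := by ring
  · rw [sub_zero, abs_of_pos Real.two_pi_pos]

theorem circCoef_main {f : E → E} {f' : E → E →L[ℝ] E} {J : E →L[ℝ] E} {x v w : E}
    {ρ κ Λ T : ℝ} (hf : ∀ z ∈ ball x ρ, HasFDerivAt f (f' z) z) (hc : ContinuousOn f' (ball x ρ))
    (hΛ : ∀ z ∈ ball x ρ, ‖f' z‖ ≤ Λ)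
    (hv : ‖v‖ ≤ 1) (hw : ‖w‖ ≤ 2) (hJ : ‖J‖ ≤ 2)
    (hJJ : ∀ y, J (J y) = -y) (hκ0 : 0 ≤ κ)
    (hκ : ∀ z ∈ ball x ρ, ‖f' z w - J (f' z v)‖ ≤ κ * ‖z - x‖)
    (hT0 : 0 < T) (hT : 3 * T < ρ) :
    ‖(2 * Real.pi * T)⁻¹ • circCoef f J x v w T - f' x v‖ ≤ 54 * κ * T := by
  have hpi := Real.two_pi_pos
  set D : ℝ → E := fun t => ∫ θ in (0 : ℝ)..(2 * Real.pi),
      rotM J θ (f' (circPt x v w t θ) (Real.cos θ • v + Real.sin θ • w)) with hD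
  have hd : ∀ t, 3 * |t| < ρ → HasDerivAt (circCoef f J x v w) (D t) t := fun t ht =>
    circCoef_hasDerivAt hf hc hΛ hv hw hJ ht
  have hxm : x ∈ ball x ρ := mem_ball_self (by linarith)
  -- behaviour at zero
  have hw0 : f' x w = J (f' x v) := by
    have := hκ x hxm
    simp only [sub_self, norm_zero, mul_zero] at this
    exact sub_eq_zero.1 (norm_le_zero_iff.1 this)
  have hD0 : D 0 = (2 * Real.pi) • f' x v := by
    have : ∀ θ : ℝ, rotM J θ (f' (circPt x v w 0 θ) (Real.cos θ • v + Real.sin θ • w))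
        = f' x v := by
      intro θ
      have hcs := Real.sin_sq_add_cos_sq θ
      have hs2 : Real.sin θ ^ 2 = 1 - Real.cos θ ^ 2 := by linarith
      have : circPt x v w 0 θ = x := by simp [circPt]
      rw [this]
      simp only [rotM, map_sub, map_add, map_smul, hw0, hJJ]
      match_scalars <;> first | ring1 | linear_combination hcs
    simp only [hD, this]
    simp
  have hc0 : circCoef f J x v w 0 = 0 := by
    have h1 : ∀ θ : ℝ, rotM J θ (f (circPt x v w 0 θ)) = Real.cos θ • f x - Real.sin θ • J (f x) := by
      intro θ; simp [rotM, circPt]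
    simp only [circCoef, h1]
    rw [intervalIntegral.integral_sub, intervalIntegral.integral_smul_const,
      intervalIntegral.integral_smul_const]
    · simp
    · exact (by fun_prop : Continuous fun θ : ℝ => Real.cos θ • f x).intervalIntegrable _ _
    · exact (by fun_prop : Continuous fun θ : ℝ => Real.sin θ • J (f x)).intervalIntegrable _ _
  have hlim : Tendsto (fun t : ℝ => t⁻¹ • circCoef f J x v w t) (𝓝[>] 0)
      (𝓝 ((2 * Real.pi) • f' x v)) := by
    have h1 := (hd 0 (by simpa using by linarith)).tendsto_slope_zero_right
    rw [hD0] at h1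
    simpa [hc0] using h1
  have hq : ∀ t, 0 < t → 3 * t < ρ →
      HasDerivAt (fun t : ℝ => t⁻¹ • circCoef f J x v w t)
        ((t ^ 2)⁻¹ • (t • D t - circCoef f J x v w t)) t := by
    intro t ht ht'
    refine ((hasDerivAt_inv ht.ne').smul (hd t (by rwa [abs_of_pos ht]))).congr_deriv ?_
    rw [smul_sub, smul_smul]
    have : (t ^ 2)⁻¹ * t = t⁻¹ := by field_simp
    rw [this]
    module
  have hbd : ∀ s, 0 < s → s ≤ T →
      ‖T⁻¹ • circCoef f J x v w T - s⁻¹ • circCoef f J x v w s‖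
        ≤ 54 * κ * (2 * Real.pi) * T := by
    intro s hs hsT
    have h1 := norm_image_sub_le_of_norm_deriv_le_segment'
      (f := fun t : ℝ => t⁻¹ • circCoef f J x v w t) (a := s) (b := T)
      (f' := fun t => (t ^ 2)⁻¹ • (t • D t - circCoef f J x v w t))
      (C := 54 * κ * (2 * Real.pi))
      (fun t ht => (hq t (hs.trans_le ht.1) (by linarith [ht.2])).hasDerivWithinAt)
      (fun t ht => ?_) T (right_mem_Icc.2 hsT)
    · refine h1.trans ?_
      apply mul_le_mul_of_nonneg_left (by linarith)
      positivity
    · have ht0 : 0 < t := hs.trans_le ht.1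
      have h2 := circCoef_deriv_est hf hc hv hw hJ hJJ hκ0 hκ ht0.le (by linarith [ht.2])
      rw [norm_smul, norm_inv, Real.norm_of_nonneg (by positivity : (0:ℝ) ≤ t ^ 2)]
      rw [inv_mul_le_iff₀ (by positivity)]
      calc _ ≤ _ := h2
        _ = _ := by ring
  have hfin : ‖T⁻¹ • circCoef f J x v w T - (2 * Real.pi) • f' x v‖
      ≤ 54 * κ * (2 * Real.pi) * T := by
    refine le_of_tendsto ((tendsto_const_nhds.sub hlim).norm) ?_
    filter_upwards [Ioc_mem_nhdsGT hT0] with s hs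
    exact hbd s hs.1 hs.2
  have heq : (2 * Real.pi * T)⁻¹ • circCoef f J x v w T - f' x v
      = (2 * Real.pi)⁻¹ • (T⁻¹ • circCoef f J x v w T - (2 * Real.pi) • f' x v) := by
    rw [smul_sub, smul_smul, smul_smul, inv_mul_cancel₀ hpi.ne', one_smul, mul_inv]
  rw [heq, norm_smul, norm_inv, Real.norm_of_nonneg hpi.le, inv_mul_le_iff₀ hpi]
  calc _ ≤ _ := hfin
    _ = _ := by ring


/-- Quantitative hypotheses on the almost complex structure on the unit ball. -/
structure GoodJ (J : E → E →L[ℝ] E) (ε : ℝ) : Prop where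
  nn : 0 ≤ ε
  le : ε ≤ 1 / 100000
  bd : ∀ x ∈ ball (0 : E) 1, ‖J x‖ ≤ 2
  sq : ∀ x ∈ ball (0 : E) 1, ∀ y, J x (J x y) = -y
  lip : ∀ x ∈ ball (0 : E) 1, ∀ y ∈ ball (0 : E) 1, ‖J x - J y‖ ≤ ε * ‖x - y‖

/-- `C¹` pseudo-holomorphic self-maps of the unit ball. -/
structure JSelf (J : E → E →L[ℝ] E) (f : E → E) : Prop where
  c1 : ContDiffOn ℝ 1 f (ball (0 : E) 1)
  maps : MapsTo f (ball (0 : E) 1) (ball (0 : E) 1)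
  hol : ∀ x ∈ ball (0 : E) 1, ∀ v, fderiv ℝ f x (J x v) = J (f x) (fderiv ℝ f x v)

theorem JSelf.hasFDerivAt {J : E → E →L[ℝ] E} {f : E → E} (h : JSelf J f) {x : E}
    (hx : x ∈ ball (0 : E) 1) : HasFDerivAt f (fderiv ℝ f x) x :=
  ((h.c1.differentiableOn (by norm_num)).differentiableAt (isOpen_ball.mem_nhds hx)).hasFDerivAt

theorem JSelf.cont {J : E → E →L[ℝ] E} {f : E → E} (h : JSelf J f) :
    ContinuousOn (fderiv ℝ f) (ball (0 : E) 1) :=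
  h.c1.continuousOn_fderiv_of_isOpen isOpen_ball le_rfl

theorem JSelf.comp {J : E → E →L[ℝ] E} {f g : E → E} (hf : JSelf J f) (hg : JSelf J g) :
    JSelf J (f ∘ g) where
  c1 := hf.c1.comp hg.c1 hg.maps
  maps := hf.maps.comp hg.maps
  hol := by
    intro x hx v
    rw [((hf.hasFDerivAt (hg.maps hx)).comp x (hg.hasFDerivAt hx)).fderiv]
    simp only [ContinuousLinearMap.comp_apply, Function.comp]
    rw [hg.hol x hx, hf.hol _ (hg.maps hx)]

theorem JSelf.lipOn {J : E → E →L[ℝ] E} {f : E → E} (hf : JSelf J f) {x : E} {ρ Λ : ℝ}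
    (hsub : ball x ρ ⊆ ball 0 1) (hΛ : ∀ z ∈ ball x ρ, ‖fderiv ℝ f z‖ ≤ Λ) {y z : E}
    (hy : y ∈ ball x ρ) (hz : z ∈ ball x ρ) : ‖f z - f y‖ ≤ Λ * ‖z - y‖ :=
  (convex_ball x ρ).norm_image_sub_le_of_norm_hasFDerivWithin_le
    (fun _ hw => (hf.hasFDerivAt (hsub hw)).hasFDerivWithinAt) hΛ hy hz

theorem JSelf.rep {J : E → E →L[ℝ] E} {ε : ℝ} (hJ : GoodJ J ε) {f : E → E} (hf : JSelf J f)
    {x v : E} {ρ Λ T : ℝ} (hsub : ball x ρ ⊆ ball 0 1)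
    (hΛ : ∀ z ∈ ball x ρ, ‖fderiv ℝ f z‖ ≤ Λ) (hv : ‖v‖ ≤ 1) (hT0 : 0 < T) (hT : 3 * T < ρ) :
    ‖(2 * Real.pi * T)⁻¹ • circCoef f (J (f x)) x v (J x v) T - fderiv ℝ f x v‖
      ≤ 54 * (ε * Λ * (1 + Λ)) * T := by
  have hxm : x ∈ ball x ρ := mem_ball_self (by linarith)
  have hx1 := hsub hxm
  have hfx1 := hf.maps hx1
  have hΛ0 : 0 ≤ Λ := (norm_nonneg _).trans (hΛ x hxm)
  have hε := hJ.nn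
  refine circCoef_main (ρ := ρ) (Λ := Λ) (fun z hz => hf.hasFDerivAt (hsub hz))
    (hf.cont.mono hsub) hΛ hv ?_ (hJ.bd _ hfx1) (hJ.sq _ hfx1) (by positivity) ?_ hT0 hT
  · have := (J x).le_opNorm v
    have := hJ.bd x hx1
    nlinarith [norm_nonneg v, norm_nonneg (J x)]
  · intro z hz
    have hz1 := hsub hz
    have hA := hΛ z hz
    have h1 : fderiv ℝ f z (J x v) - J (f x) (fderiv ℝ f z v)
        = fderiv ℝ f z ((J x - J z) v) + (J (f z) - J (f x)) (fderiv ℝ f z v) := by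
      simp only [ContinuousLinearMap.sub_apply, map_sub]
      rw [hf.hol z hz1]
      abel
    have h2 : ‖fderiv ℝ f z ((J x - J z) v)‖ ≤ Λ * (ε * ‖z - x‖) := by
      have a1 := hJ.lip x hx1 z hz1
      rw [norm_sub_rev x z] at a1
      have a2 := ((J x - J z).le_opNorm v)
      have a3 : ‖(J x - J z) v‖ ≤ ε * ‖z - x‖ := by
        nlinarith [norm_nonneg v, norm_nonneg (J x - J z)]
      exact ((fderiv ℝ f z).le_opNorm _).trans (mul_le_mul hA a3 (norm_nonneg _) hΛ0)
    have h3 : ‖(J (f z) - J (f x)) (fderiv ℝ f z v)‖ ≤ (ε * (Λ * ‖z - x‖)) * Λ := by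
      have a1 := hJ.lip _ (hf.maps hz1) _ hfx1
      have a2 := hf.lipOn hsub hΛ hxm hz
      have a3 : ‖fderiv ℝ f z v‖ ≤ Λ := by
        have := (fderiv ℝ f z).le_opNorm v
        nlinarith [norm_nonneg v, norm_nonneg (fderiv ℝ f z)]
      have a4 : ‖J (f z) - J (f x)‖ ≤ ε * (Λ * ‖z - x‖) :=
        a1.trans (mul_le_mul_of_nonneg_left a2 hε)
      exact ((J (f z) - J (f x)).le_opNorm _).trans
        (mul_le_mul a4 a3 (norm_nonneg _) (by positivity))
    rw [h1]
    refine (norm_add_le _ _).trans ?_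
    linarith

theorem circ_mem {x v w : E} {ρ T : ℝ} (hv : ‖v‖ ≤ 1) (hw : ‖w‖ ≤ 2) (hT0 : 0 < T)
    (hT : 3 * T < ρ) (θ : ℝ) : circPt x v w T θ ∈ ball x ρ := by
  rw [mem_ball_iff_norm]
  exact (circPt_dist hv hw T θ).trans_lt (by rwa [abs_of_pos hT0])

theorem GoodJ.norm_apply {J : E → E →L[ℝ] E} {ε : ℝ} (hJ : GoodJ J ε) {x v : E}
    (hx : x ∈ ball (0 : E) 1) (hv : ‖v‖ ≤ 1) : ‖J x v‖ ≤ 2 := by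
  have := (J x).le_opNorm v
  have := hJ.bd x hx
  nlinarith [norm_nonneg v, norm_nonneg (J x)]

/-- Interior gradient bound. -/
theorem JSelf.grad {J : E → E →L[ℝ] E} {ε : ℝ} (hJ : GoodJ J ε) {f : E → E} (hf : JSelf J f)
    {p : E} {R : ℝ} (hR0 : 0 < R) (hR1 : R ≤ 1) (hsub : closedBall p R ⊆ ball 0 1) :
    ∀ x ∈ ball p (R / 2), ‖fderiv ℝ f x‖ ≤ 144 / R := by
  have hgc : ContinuousOn (fun x => (R - ‖x - p‖) * ‖fderiv ℝ f x‖) (closedBall p R) :=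
    ContinuousOn.mul (by fun_prop) ((hf.cont.mono hsub).norm)
  obtain ⟨x₀, hx₀, hmax⟩ := (isCompact_closedBall p R).exists_isMaxOn
    ⟨p, mem_closedBall_self hR0.le⟩ hgc
  have hM : (R - ‖x₀ - p‖) * ‖fderiv ℝ f x₀‖ ≤ 72 := by
    by_contra! hlt
    set d := R - ‖x₀ - p‖ with hd
    set l := ‖fderiv ℝ f x₀‖ with hl
    have hl0 : 0 ≤ l := norm_nonneg _
    have hd1 : d ≤ 1 := by linarith [norm_nonneg (x₀ - p)]
    have hd0 : 0 < d := by
      by_contra! h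
      nlinarith
    have hl72 : 72 < l := by nlinarith
    have hb : ball x₀ (d / 2) ⊆ closedBall p R := by
      intro z hz
      rw [mem_ball_iff_norm] at hz
      rw [mem_closedBall_iff_norm]
      have : ‖z - p‖ ≤ ‖z - x₀‖ + ‖x₀ - p‖ := norm_sub_le_norm_sub_add_norm_sub z x₀ p
      linarith
    have hΛ : ∀ z ∈ ball x₀ (d / 2), ‖fderiv ℝ f z‖ ≤ 2 * l := by
      intro z hz
      have h1 : (R - ‖z - p‖) * ‖fderiv ℝ f z‖ ≤ d * l := hmax (hb hz)
      rw [mem_ball_iff_norm] at hz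
      have h2 : ‖z - p‖ ≤ ‖z - x₀‖ + ‖x₀ - p‖ := norm_sub_le_norm_sub_add_norm_sub z x₀ p
      have h3 : d / 2 ≤ R - ‖z - p‖ := by linarith
      have h4 := mul_le_mul_of_nonneg_right h3 (norm_nonneg (fderiv ℝ f z))
      have h5 : d * ‖fderiv ℝ f z‖ ≤ d * (2 * l) := by linarith
      exact le_of_mul_le_mul_left h5 hd0
    have hT0 : (0 : ℝ) < 12 / l := by positivity
    have hT : 3 * (12 / l) < d / 2 := by
      have : 3 * (12 / l) = 36 / l := by ring
      rw [this, div_lt_iff₀ (by linarith)]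
      linarith
    have hx1 := hsub hx₀
    have hbound : l ≤ l / 2 := by
      refine ContinuousLinearMap.opNorm_le_of_unit_norm (by positivity) ?_
      intro v hv
      have h1 := hf.rep hJ (hb.trans hsub) hΛ hv.le hT0 hT
      have h2 : ‖circCoef f (J (f x₀)) x₀ v (J x₀ v) (12 / l)‖ ≤ 3 * (2 * Real.pi) := by
        refine (intervalIntegral.norm_integral_le_of_norm_le_const (C := 3) fun θ _ => ?_).trans ?_
        · refine (rotM_norm (hJ.bd _ (hf.maps hx1)) _ _).trans ?_
          have := hf.maps (hsub (hb (circ_mem (x := x₀) hv.le (hJ.norm_apply hx1 hv.le) hT0 hT θ)))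
          rw [mem_ball_zero_iff] at this
          linarith
        · rw [sub_zero, abs_of_pos Real.two_pi_pos]
      have h3 : ‖(2 * Real.pi * (12 / l))⁻¹ • circCoef f (J (f x₀)) x₀ v (J x₀ v) (12 / l)‖
          ≤ l / 4 := by
        rw [norm_smul, norm_inv, Real.norm_of_nonneg (by positivity),
          inv_mul_le_iff₀ (by positivity)]
        calc _ ≤ _ := h2
          _ = _ := by field_simp; norm_num
      have h4 : 54 * (ε * (2 * l) * (1 + 2 * l)) * (12 / l) = 1296 * ε * (1 + 2 * l) := by
        field_simp; ring
      have h5 : 1296 * ε * (1 + 2 * l) ≤ l / 4 := by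
        have := mul_le_mul_of_nonneg_right hJ.le (by linarith : 0 ≤ 1 + 2 * l)
        nlinarith
      have h6 := norm_sub_norm_le (fderiv ℝ f x₀ v)
        ((2 * Real.pi * (12 / l))⁻¹ • circCoef f (J (f x₀)) x₀ v (J x₀ v) (12 / l))
      rw [norm_sub_rev] at h6
      linarith
    linarith
  intro x hx
  rw [mem_ball_iff_norm] at hx
  have hxc : x ∈ closedBall p R := by rw [mem_closedBall_iff_norm]; linarith
  have h1 : (R - ‖x - p‖) * ‖fderiv ℝ f x‖ ≤ 72 := (hmax hxc).trans hM
  rw [le_div_iff₀ hR0]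
  nlinarith [norm_nonneg (fderiv ℝ f x)]

/-- Uniform equicontinuity of the differentials. -/
theorem JSelf.equi {J : E → E →L[ℝ] E} {ε : ℝ} (hJ : GoodJ J ε)
    {p : E} (hp : p ∈ ball (0 : E) 1) :
    ∃ r > 0, ball p r ⊆ ball 0 1 ∧ ∀ f, JSelf J f →
      ∀ x ∈ ball p r, ‖fderiv ℝ f x - fderiv ℝ f p‖ ≤ 1 / 2 := by
  obtain ⟨R₁, hR₁, hsub₁⟩ := Metric.nhds_basis_closedBall.mem_iff.1 (isOpen_ball.mem_nhds hp)
  obtain ⟨R, hR0, hR1, hsub⟩ : ∃ R : ℝ, 0 < R ∧ R ≤ 1 ∧ closedBall p R ⊆ ball 0 1 :=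
    ⟨min R₁ 1, by positivity, min_le_right _ _,
      (closedBall_subset_closedBall (min_le_left _ _)).trans hsub₁⟩
  set Λ := 144 / R with hΛdef
  have hΛ0 : 0 < Λ := by positivity
  obtain ⟨T, hT0, hT1, hTR, hTs⟩ : ∃ T : ℝ, 0 < T ∧ T ≤ 1 ∧ 3 * T < R / 4 ∧
      108 * (Λ * (1 + Λ)) * T ≤ 1 / 4 := by
    refine ⟨min (R / 16) (1 / (432 * (Λ * (1 + Λ)))), by positivity, ?_, ?_, ?_⟩
    · exact (min_le_left _ _).trans (by linarith)
    · have := min_le_left (R / 16) (1 / (432 * (Λ * (1 + Λ))))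
      linarith
    · have h := min_le_right (R / 16) (1 / (432 * (Λ * (1 + Λ))))
      have h' := mul_le_mul_of_nonneg_left h (by positivity : 0 ≤ 108 * (Λ * (1 + Λ)))
      refine h'.trans (le_of_eq ?_)
      field_simp
      norm_num
  refine ⟨min (R / 4) (T / (28 * Λ)), by positivity, ?_, ?_⟩
  · exact (ball_subset_ball ((min_le_left _ _).trans (by linarith))).trans
      (ball_subset_closedBall.trans hsub)
  intro f hf x hx
  rw [mem_ball_iff_norm, lt_min_iff] at hx
  have hgrad := hf.grad hJ hR0 hR1 hsub
  have hsub2 : ball p (R / 2) ⊆ ball 0 1 :=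
    (ball_subset_ball (by linarith)).trans (ball_subset_closedBall.trans hsub)
  have hxb : ball x (R / 4) ⊆ ball p (R / 2) := by
    intro z hz
    rw [mem_ball_iff_norm] at hz ⊢
    have : ‖z - p‖ ≤ ‖z - x‖ + ‖x - p‖ := norm_sub_le_norm_sub_add_norm_sub z x p
    linarith [hx.1]
  have hpb : ball p (R / 4) ⊆ ball p (R / 2) := ball_subset_ball (by linarith)
  have hxm : x ∈ ball p (R / 2) := hxb (mem_ball_self (by linarith))
  have hpm : p ∈ ball p (R / 2) := hpb (mem_ball_self (by linarith))
  have hx1 := hsub2 hxm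
  have hfc : ContinuousOn f (ball 0 1) := hf.c1.continuousOn
  refine ContinuousLinearMap.opNorm_le_of_unit_norm (by positivity) ?_
  intro v hv
  have e1 := hf.rep hJ (hxb.trans hsub2) (fun z hz => hgrad z (hxb hz)) hv.le hT0 hTR
  have e2 := hf.rep hJ (hpb.trans hsub2) (fun z hz => hgrad z (hpb hz)) hv.le hT0 hTR
  have hε1 : ε ≤ 1 := hJ.le.trans (by norm_num)
  have hεs : 54 * (ε * Λ * (1 + Λ)) * T ≤ 1 / 8 := by
    have h1 : ε * (108 * (Λ * (1 + Λ)) * T) ≤ 1 * (1 / 4) :=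
      mul_le_mul hε1 hTs (by positivity) (by norm_num)
    linarith
  have mx := circ_mem (x := x) hv.le (hJ.norm_apply hx1 hv.le) hT0 hTR
  have mp := circ_mem (x := p) hv.le (hJ.norm_apply hp hv.le) hT0 hTR
  have hlipJ := hJ.lip x hx1 p hp
  have hlipf := hf.lipOn hsub2 hgrad hpm hxm
  have hlipJf := hJ.lip _ (hf.maps hx1) _ (hf.maps hp)
  have hN := norm_nonneg (x - p)
  have hdiff : ‖circCoef f (J (f x)) x v (J x v) T - circCoef f (J (f p)) p v (J p v) T‖
      ≤ 7 * Λ * ‖x - p‖ * (2 * Real.pi) := by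
    have c1 : Continuous fun θ => rotM (J (f x)) θ (f (circPt x v (J x v) T θ)) :=
      rotM_continuous _ (hfc.comp_continuous (circPt_continuous _ _ _ _)
        (fun θ => hsub2 (hxb (mx θ))))
    have c2 : Continuous fun θ => rotM (J (f p)) θ (f (circPt p v (J p v) T θ)) :=
      rotM_continuous _ (hfc.comp_continuous (circPt_continuous _ _ _ _)
        (fun θ => hsub2 (hpb (mp θ))))
    unfold circCoef
    rw [← intervalIntegral.integral_sub (c1.intervalIntegrable _ _) (c2.intervalIntegrable _ _)]
    refine (intervalIntegral.norm_integral_le_of_norm_le_const (C := 7 * Λ * ‖x - p‖)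
      fun θ _ => ?_).trans ?_
    · set y₁ := f (circPt x v (J x v) T θ) with hy₁
      set y₂ := f (circPt p v (J p v) T θ) with hy₂
      have a1 : rotM (J (f x)) θ y₁ - rotM (J (f p)) θ y₂
          = rotM (J (f x)) θ (y₁ - y₂) - Real.sin θ • ((J (f x) - J (f p)) y₂) := by
        simp only [rotM, map_sub, ContinuousLinearMap.sub_apply]
        module
      have a2 := rotM_norm (hJ.bd _ (hf.maps hx1)) θ (y₁ - y₂)
      have a3 : ‖y₁ - y₂‖ ≤ Λ * (2 * ‖x - p‖) := by
        refine (hf.lipOn hsub2 hgrad (hpb (mp θ)) (hxb (mx θ))).trans ?_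
        refine mul_le_mul_of_nonneg_left ?_ hΛ0.le
        have b1 : circPt x v (J x v) T θ - circPt p v (J p v) T θ
            = (x - p) + T • (Real.sin θ • ((J x - J p) v)) := by
          simp only [circPt, ContinuousLinearMap.sub_apply]
          module
        have b2 : ‖(J x - J p) v‖ ≤ ‖x - p‖ := by
          have := (J x - J p).le_opNorm v
          rw [hv, mul_one] at this
          nlinarith
        have b3 : ‖T • (Real.sin θ • ((J x - J p) v))‖ ≤ ‖x - p‖ := by
          rw [norm_smul, norm_smul, Real.norm_of_nonneg hT0.le, Real.norm_eq_abs]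
          have := mul_le_mul (Real.abs_sin_le_one θ) b2 (norm_nonneg _) zero_le_one
          have h' := mul_le_mul hT1 this (by positivity) zero_le_one
          linarith
        rw [b1]
        exact (norm_add_le _ _).trans (by linarith)
      have a4 : ‖Real.sin θ • ((J (f x) - J (f p)) y₂)‖ ≤ Λ * ‖x - p‖ := by
        rw [norm_smul, Real.norm_eq_abs]
        have hy1 : ‖y₂‖ ≤ 1 := (mem_ball_zero_iff.1 (hf.maps (hsub2 (hpb (mp θ))))).le
        have b1 : ‖J (f x) - J (f p)‖ ≤ Λ * ‖x - p‖ := by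
          nlinarith [norm_nonneg (f x - f p), hJ.nn]
        have b2 := ((J (f x) - J (f p)).le_opNorm y₂).trans
          (mul_le_mul b1 hy1 (norm_nonneg _) (by positivity))
        have := mul_le_mul (Real.abs_sin_le_one θ) b2 (norm_nonneg _) zero_le_one
        linarith
      rw [a1]
      refine (norm_sub_le _ _).trans ?_
      linarith
    · rw [sub_zero, abs_of_pos Real.two_pi_pos]
  have hdiff2 : ‖(2 * Real.pi * T)⁻¹ • circCoef f (J (f x)) x v (J x v) T
      - (2 * Real.pi * T)⁻¹ • circCoef f (J (f p)) p v (J p v) T‖ ≤ 1 / 4 := by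
    have hpi := Real.two_pi_pos
    rw [← smul_sub, norm_smul, norm_inv, Real.norm_of_nonneg (by positivity),
      inv_mul_le_iff₀ (by positivity)]
    have h1 := (lt_div_iff₀ (by positivity)).1 hx.2
    have h2 : 7 * Λ * ‖x - p‖ ≤ T * (1 / 4) := by linarith
    calc _ ≤ _ := hdiff
      _ ≤ _ := mul_le_mul_of_nonneg_right h2 hpi.le
      _ = _ := by ring
  rw [ContinuousLinearMap.sub_apply]
  set c₁ := (2 * Real.pi * T)⁻¹ • circCoef f (J (f x)) x v (J x v) T
  set c₂ := (2 * Real.pi * T)⁻¹ • circCoef f (J (f p)) p v (J p v) T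
  have hfinal : fderiv ℝ f x v - fderiv ℝ f p v
      = -(c₁ - fderiv ℝ f x v) + (c₁ - c₂) + (c₂ - fderiv ℝ f p v) := by abel
  rw [hfinal]
  refine (norm_add₃_le).trans ?_
  rw [norm_neg]
  linarith

/-- Local uniqueness near a fixed point with trivial differential. -/
theorem JSelf.local_id {J : E → E →L[ℝ] E} {ε : ℝ} (hJ : GoodJ J ε) {φ : E → E}
    (hφ : JSelf J φ) {p : E} (hp : p ∈ ball (0 : E) 1) (hpp : φ p = p)
    (hdp : fderiv ℝ φ p = ContinuousLinearMap.id ℝ E) :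
    ∃ r > 0, ball p r ⊆ ball 0 1 ∧ ∀ x ∈ ball p r, φ x = x := by
  obtain ⟨r, hr, hsub, hequi⟩ := JSelf.equi hJ hp
  refine ⟨r / 3, by positivity, (ball_subset_ball (by linarith)).trans hsub, ?_⟩
  intro x hx
  -- the family of iterates
  have hdouble : ∀ f, JSelf J f → f p = p → fderiv ℝ f p = ContinuousLinearMap.id ℝ E →
      3 / 2 * ‖f x - x‖ ≤ ‖f (f x) - x‖ := by
    intro f hf hfp hdf
    have hlip : ∀ y ∈ ball p r, ∀ z ∈ ball p r,
        ‖(f z - z) - (f y - y)‖ ≤ 1 / 2 * ‖z - y‖ := by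
      intro y hy z hz
      refine (convex_ball p r).norm_image_sub_le_of_norm_hasFDerivWithin_le
        (f := fun z => f z - z) (f' := fun z => fderiv ℝ f z - ContinuousLinearMap.id ℝ E)
        (fun w hw => ((hf.hasFDerivAt (hsub hw)).sub (hasFDerivAt_id w)).hasFDerivWithinAt)
        (fun w hw => ?_) hy hz
      rw [← hdf]
      exact hequi f hf w hw
    have hxr : x ∈ ball p r := ball_subset_ball (by linarith) hx
    have h1 := hlip p (mem_ball_self hr) x hxr
    rw [hfp, sub_self, sub_zero] at h1
    rw [mem_ball_iff_norm] at hx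
    have hfx : f x ∈ ball p r := by
      rw [mem_ball_iff_norm]
      have : f x - p = (f x - x) + (x - p) := by abel
      rw [this]
      refine (norm_add_le _ _).trans_lt ?_
      linarith [norm_nonneg (x - p)]
    have h2 := hlip x hxr (f x) hfx
    have h3 : (2 : ℝ) • (f x - x) = (f (f x) - x) - ((f (f x) - f x) - (f x - x)) := by
      rw [two_smul]; abel
    have h4 : ‖(2 : ℝ) • (f x - x)‖ = 2 * ‖f x - x‖ := by
      rw [norm_smul, Real.norm_of_nonneg (by norm_num)]
    rw [h3] at h4
    have h5 := norm_sub_le (f (f x) - x) ((f (f x) - f x) - (f x - x))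
    linarith
  have hiter : ∀ j : ℕ, ∃ f, JSelf J f ∧ f p = p ∧
      fderiv ℝ f p = ContinuousLinearMap.id ℝ E ∧ (3 / 2 : ℝ) ^ j * ‖φ x - x‖ ≤ ‖f x - x‖ := by
    intro j
    induction j with
    | zero => exact ⟨φ, hφ, hpp, hdp, by simp⟩
    | succ j ih =>
      obtain ⟨f, hf, hfp, hdf, hfx⟩ := ih
      refine ⟨f ∘ f, hf.comp hf, by simp [hfp], ?_, ?_⟩
      · have h1 := (hf.hasFDerivAt hp)
        have h2 : HasFDerivAt f (fderiv ℝ f p) (f p) := by rw [hfp]; exact h1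
        rw [(h2.comp p h1).fderiv, hdf]
        ext; simp
      · have := hdouble f hf hfp hdf
        rw [pow_succ, Function.comp]
        linarith
  by_contra hne
  have hpos : 0 < ‖φ x - x‖ := norm_pos_iff.2 (sub_ne_zero.2 hne)
  obtain ⟨j, hj⟩ := pow_unbounded_of_one_lt (2 / ‖φ x - x‖) (by norm_num : (1 : ℝ) < 3 / 2)
  obtain ⟨f, hf, -, -, hfx⟩ := hiter j
  rw [div_lt_iff₀ hpos] at hj
  have hx1 : x ∈ ball (0 : E) 1 := hsub (ball_subset_ball (by linarith) hx)
  have h1 := mem_ball_zero_iff.1 hx1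
  have h2 := mem_ball_zero_iff.1 (hf.maps hx1)
  have h3 := norm_sub_le (f x) x
  linarith

theorem JSelf.eq_id {J : E → E →L[ℝ] E} {ε : ℝ} (hJ : GoodJ J ε) {φ : E → E}
    (hφ : JSelf J φ) (h0 : φ 0 = 0) (hd0 : fderiv ℝ φ 0 = ContinuousLinearMap.id ℝ E) :
    ∀ x ∈ ball (0 : E) 1, φ x = x := by
  set A : Set E := {x | x ∈ ball (0 : E) 1 ∧ φ x = x ∧
    fderiv ℝ φ x = ContinuousLinearMap.id ℝ E} with hA
  have hopen : IsOpen A := by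
    rw [Metric.isOpen_iff]
    rintro p ⟨hp, hpp, hdp⟩
    obtain ⟨r, hr, hsub, hid⟩ := hφ.local_id hJ hp hpp hdp
    refine ⟨r, hr, fun x hx => ⟨hsub hx, hid x hx, ?_⟩⟩
    have : φ =ᶠ[𝓝 x] id := by
      filter_upwards [isOpen_ball.mem_nhds hx] with y hy
      exact hid y hy
    rw [this.fderiv_eq, fderiv_id]
  have hsubA : ball (0 : E) 1 ⊆ A := by
    refine (convex_ball (0 : E) 1).isPreconnected.subset_of_closure_inter_subset hopen
      ⟨0, mem_ball_self one_pos, mem_ball_self one_pos, h0, hd0⟩ ?_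
    rintro x ⟨hxc, hx⟩
    obtain ⟨u, hu, hlim⟩ := mem_closure_iff_seq_limit.1 hxc
    have hcφ : ContinuousAt φ x := (hφ.hasFDerivAt hx).continuousAt
    have hcd : ContinuousAt (fderiv ℝ φ) x := hφ.cont.continuousAt (isOpen_ball.mem_nhds hx)
    refine ⟨hx, ?_, ?_⟩
    · refine tendsto_nhds_unique (hcφ.tendsto.comp hlim) ?_
      refine hlim.congr fun k => ?_
      exact (hu k).2.1.symm
    · refine tendsto_nhds_unique (hcd.tendsto.comp hlim) ?_
      refine tendsto_const_nhds.congr fun k => ?_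
      exact (hu k).2.2.symm
  exact fun x hx => (hsubA hx).2.1

end CartanAux

/-- **Cartan-type uniqueness theorem** (Corollary 2.3.12): for almost complex structures `J`
sufficiently `C^k`-close to the standard one on the closed unit ball, every `(J,J)`-biholomorphic
`C¹`-homeomorphism `φ` of the closed ball fixing `0` with `dφ(0) = Id` is the identity. -/
theorem cartan_uniqueness {n : ℕ} :
    ∃ k : ℕ, 2 ≤ k ∧ ∃ ε : ℝ, 0 < ε ∧
      ∀ (Ω : Set (Cn n)) (J : Cn n → Cn n →L[ℝ] Cn n),
        IsOpen Ω → Metric.closedBall (0 : Cn n) 1 ⊆ Ω → IsACS Ω J →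
        (∀ i : ℕ, i ≤ k → ∀ x ∈ Metric.closedBall (0 : Cn n) 1,
          ‖iteratedFDerivWithin ℝ i (fun y => J y - Jstd n)
              (Metric.closedBall (0 : Cn n) 1) x‖ ≤ ε) →
        ∀ φ : Cn n → Cn n,
          ContinuousOn φ (Metric.closedBall (0 : Cn n) 1) →
          ContDiffOn ℝ 1 φ (Metric.closedBall (0 : Cn n) 1) →
          BijOn φ (Metric.closedBall (0 : Cn n) 1) (Metric.closedBall (0 : Cn n) 1) →
          φ '' Metric.ball (0 : Cn n) 1 = Metric.ball (0 : Cn n) 1 →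
          (∀ x ∈ Metric.ball (0 : Cn n) 1,
            (fderiv ℝ φ x).comp (J x) = (J (φ x)).comp (fderiv ℝ φ x)) →
          φ 0 = 0 → fderiv ℝ φ 0 = ContinuousLinearMap.id ℝ (Cn n) →
          ∀ x ∈ Metric.closedBall (0 : Cn n) 1, φ x = x := by
  refine ⟨2, le_rfl, 1 / 100000, by norm_num, ?_⟩
  intro Ω J hΩ hsub hACS hC φ hcont hC1 hbij himg hhol h0 hd0
  haveI : FiniteDimensional ℝ (Cn n) := FiniteDimensional.complexToReal (Cn n)
  have hbc : ball (0 : Cn n) 1 ⊆ closedBall 0 1 := ball_subset_closedBall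
  have hconv : Convex ℝ (closedBall (0 : Cn n) 1) := convex_closedBall 0 1
  have hud : UniqueDiffOn ℝ (closedBall (0 : Cn n) 1) := by
    refine uniqueDiffOn_convex hconv ?_
    exact ⟨0, interior_mono hbc (by rw [isOpen_ball.interior_eq]; exact mem_ball_self one_pos)⟩
  have hstd : ‖Jstd n‖ ≤ 1 := by
    refine ContinuousLinearMap.opNorm_le_bound _ zero_le_one fun v => ?_
    have : Jstd n v = Complex.I • v := rfl
    rw [this, norm_smul, Complex.norm_I]
  have hdJ : DifferentiableOn ℝ J (closedBall (0 : Cn n) 1) :=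
    (hACS.1.mono hsub).differentiableOn (by simp)
  have hlip : ∀ x ∈ closedBall (0 : Cn n) 1, ∀ y ∈ closedBall (0 : Cn n) 1,
      ‖J x - J y‖ ≤ 1 / 100000 * ‖x - y‖ := by
    intro x hx y hy
    have h := hconv.norm_image_sub_le_of_norm_fderivWithin_le (𝕜 := ℝ)
      (f := fun y => J y - Jstd n) (C := 1 / 100000) (hdJ.sub_const _) (fun z hz => by
        have := hC 1 (by norm_num) z hz
        rwa [norm_iteratedFDerivWithin_one _ (hud z hz)] at this) hy hx
    simpa using h
  have hJ : GoodJ J (1 / 100000) :=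
    { nn := by norm_num
      le := le_rfl
      bd := fun x hx => by
        have h1 := hC 0 (by norm_num) x (hbc hx)
        rw [norm_iteratedFDerivWithin_zero] at h1
        have h2 : J x = (J x - Jstd n) + Jstd n := by abel
        rw [h2]
        refine (norm_add_le _ _).trans ?_
        linarith
      sq := fun x hx y => by
        have := congrArg (fun A : Cn n →L[ℝ] Cn n => A y) (hACS.2 x (hsub (hbc hx)))
        simpa using this
      lip := fun x hx y hy => hlip x (hbc hx) y (hbc hy) }
  have hφ : JSelf J φ :=
    { c1 := hC1.mono hbc
      maps := fun x hx => himg ▸ mem_image_of_mem φ hx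
      hol := fun x hx v => congrArg (fun A : Cn n →L[ℝ] Cn n => A v) (hhol x hx) }
  have hid := JSelf.eq_id hJ hφ h0 hd0
  have hcl : closure (ball (0 : Cn n) 1) = closedBall 0 1 := closure_ball 0 one_ne_zero
  have heq : EqOn φ id (closedBall (0 : Cn n) 1) :=
    EqOn.of_subset_closure (s := ball (0 : Cn n) 1) (fun x hx => hid x hx) hcont
      continuousOn_id hbc hcl.ge
  exact fun x hx => heq hx
end

section
/- Existence of pseudoholomorphic discs with prescribed small jets (Nijenhuis–Woolf / Ivashkovich–Rosay): Let k ≥ 1 be an integer and 0 < α < 1. Let J be an almost complex structure of class C^{k,α} on an open set Ω ⊆ ℝ^{2n} and let p ∈ Ω. Then there exists ε > 0 such that for every k-tuple V = (v₁,…,v_k) of vectors in ℝ^{2n} with ‖v_l‖ ≤ ε for l = 1,…,k, there exists a J-holomorphic disc u : Δ → Ω, of class C^{k+1,α} on the closed unit disc, satisfying u(0) = p and (∂^l u/∂x^l)(0) = v_l for l = 1,…,k, where x = Re ζ; that is, the k-th jet of u at the origin equals (p,V). -/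
open Complex Metric Set MeasureTheory Filter Topology Bornology ENNReal

/-- Quantitative `C^{m,α}` bounds on a set, defined by recursion on `m`. -/
def CHOn (α : ℝ) : (m : ℕ) → {X E : Type} → [NormedAddCommGroup X] → [NormedSpace ℝ X] →
    [NormedAddCommGroup E] → [NormedSpace ℝ E] → Set X → ℝ → (X → E) → Prop
  | 0, _, _, _, _, _, _, s, C, f =>
      (∀ x ∈ s, ‖f x‖ ≤ C) ∧ ∀ x ∈ s, ∀ y ∈ s, ‖f x - f y‖ ≤ C * ‖x - y‖ ^ α
  | m + 1, _, _, _, _, _, _, s, C, f =>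
      (∀ x ∈ s, ‖f x‖ ≤ C) ∧ (∀ x ∈ s, DifferentiableAt ℝ f x) ∧ CHOn α m s C (fderiv ℝ f)

/-- Global `C^{m,α}` bounds. -/
def CH (α : ℝ) (m : ℕ) {X E : Type} [NormedAddCommGroup X] [NormedSpace ℝ X]
    [NormedAddCommGroup E] [NormedSpace ℝ E] (C : ℝ) (f : X → E) : Prop :=
  CHOn α m univ C f

section CHcalc

variable {α : ℝ} {X E F G : Type} [NormedAddCommGroup X] [NormedSpace ℝ X]
    [NormedAddCommGroup E] [NormedSpace ℝ E] [NormedAddCommGroup F] [NormedSpace ℝ F]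
    [NormedAddCommGroup G] [NormedSpace ℝ G]

theorem CH_zero_iff {C : ℝ} {f : X → E} :
    CH α 0 C f ↔ (∀ x, ‖f x‖ ≤ C) ∧ ∀ x y, ‖f x - f y‖ ≤ C * ‖x - y‖ ^ α := by
  simp [CH, CHOn]

theorem CH_succ_iff {m : ℕ} {C : ℝ} {f : X → E} :
    CH α (m + 1) C f ↔ (∀ x, ‖f x‖ ≤ C) ∧ Differentiable ℝ f ∧ CH α m C (fderiv ℝ f) := by
  simp [CH, CHOn, Differentiable]

theorem CH.bound {m : ℕ} {C : ℝ} {f : X → E} (h : CH α m C f) (x : X) : ‖f x‖ ≤ C := by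
  cases m with
  | zero => exact (CH_zero_iff.1 h).1 x
  | succ m => exact (CH_succ_iff.1 h).1 x

theorem CH.nonneg {m : ℕ} {C : ℝ} {f : X → E} (h : CH α m C f) : 0 ≤ C :=
  (norm_nonneg _).trans (h.bound 0)

theorem CH.mono {m : ℕ} {C C' : ℝ} {f : X → E} (h : CH α m C f) (hC : C ≤ C') :
    CH α m C' f := by
  induction m generalizing E with
  | zero =>
    rw [CH_zero_iff] at h ⊢
    exact ⟨fun x => (h.1 x).trans hC, fun x y => (h.2 x y).trans (by gcongr)⟩
  | succ m ih =>
    rw [CH_succ_iff] at h ⊢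
    exact ⟨fun x => (h.1 x).trans hC, h.2.1, ih h.2.2⟩

theorem CH.diff {m : ℕ} {C : ℝ} {f : X → E} (h : CH α (m + 1) C f) : Differentiable ℝ f :=
  (CH_succ_iff.1 h).2.1

theorem CH.fd {m : ℕ} {C : ℝ} {f : X → E} (h : CH α (m + 1) C f) : CH α m C (fderiv ℝ f) :=
  (CH_succ_iff.1 h).2.2

theorem CH.lip {m : ℕ} {C : ℝ} {f : X → E} (h : CH α (m + 1) C f) (x y : X) :
    ‖f x - f y‖ ≤ C * ‖x - y‖ :=
  Convex.norm_image_sub_le_of_norm_fderiv_le (𝕜 := ℝ) (s := univ) (fun z _ => h.diff z)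
    (fun z _ => h.fd.bound z) convex_univ (mem_univ y) (mem_univ x)

theorem CH.holder (h0 : 0 < α) (h1 : α < 1) {m : ℕ} {C : ℝ} {f : X → E} (h : CH α m C f) (x y : X) :
    ‖f x - f y‖ ≤ 2 * C * ‖x - y‖ ^ α := by
  have hC := h.nonneg
  cases m with
  | zero =>
    have := (CH_zero_iff.1 h).2 x y
    have h3 : 0 ≤ C * ‖x - y‖ ^ α := mul_nonneg h.nonneg (by positivity)
    linarith
  | succ m =>
    rcases le_total ‖x - y‖ 1 with hx | hx
    · have : ‖x - y‖ ≤ ‖x - y‖ ^ α := Real.self_le_rpow_of_le_one (norm_nonneg _) hx h1.le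
      have h2 := h.lip x y
      have h3 : C * ‖x - y‖ ≤ C * ‖x - y‖ ^ α := by gcongr
      have : 0 ≤ C * ‖x - y‖ ^ α := by positivity
      linarith
    · have : 1 ≤ ‖x - y‖ ^ α := Real.one_le_rpow hx h0.le
      have h2 : ‖f x - f y‖ ≤ 2 * C := (norm_sub_le _ _).trans (by linarith [h.bound x, h.bound y])
      nlinarith

theorem CH.continuous (h0 : 0 < α) (h1 : α < 1) {m : ℕ} {C : ℝ} {f : X → E} (h : CH α m C f) :
    Continuous f := by
  rw [continuous_iff_continuousAt]
  intro y
  rw [ContinuousAt, tendsto_iff_norm_sub_tendsto_zero]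
  have h2 : Tendsto (fun x => 2 * C * ‖x - y‖ ^ α) (𝓝 y) (𝓝 (2 * C * ‖y - y‖ ^ α)) := by
    apply Continuous.tendsto
    exact continuous_const.mul ((by fun_prop : Continuous fun x => ‖x - y‖).rpow_const
      (fun _ => Or.inr h0.le))
  simp only [sub_self, norm_zero, Real.zero_rpow h0.ne', mul_zero] at h2
  exact squeeze_zero (fun _ => norm_nonneg _) (fun x => h.holder h0 h1 x y) h2

theorem CH.lower (h0 : 0 < α) (h1 : α < 1) {m : ℕ} {C : ℝ} {f : X → E} (h : CH α (m + 1) C f) :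
    CH α m (2 * C) f := by
  have hC := h.nonneg
  induction m generalizing E with
  | zero =>
    rw [CH_zero_iff]
    exact ⟨fun x => (h.bound x).trans (by linarith), fun x y => h.holder h0 h1 x y⟩
  | succ m ih =>
    rw [CH_succ_iff]
    exact ⟨fun x => (h.bound x).trans (by linarith), h.diff, ih h.fd⟩

theorem CH.contDiff (h0 : 0 < α) (h1 : α < 1) {m : ℕ} {C : ℝ} {f : X → E} (h : CH α m C f) :
    ContDiff ℝ m f := by
  induction m generalizing E with
  | zero => exact contDiff_zero.2 (h.continuous h0 h1)
  | succ m ih =>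
    push_cast
    rw [contDiff_succ_iff_fderiv]
    exact ⟨h.diff, by simp, ih h.fd⟩

theorem CH.const {m : ℕ} (c : E) : CH α m ‖c‖ (fun _ : X => c) := by
  induction m generalizing E with
  | zero =>
    rw [CH_zero_iff]
    exact ⟨fun x => le_rfl, fun x y => by simp; positivity⟩
  | succ m ih =>
    rw [CH_succ_iff]
    refine ⟨fun x => le_rfl, differentiable_const _, ?_⟩
    have : fderiv ℝ (fun _ : X => c) = fun _ => 0 := by ext; simp
    rw [this]
    exact (ih (0 : X →L[ℝ] E)).mono (by simp)

theorem CH.add {m : ℕ} {C C' : ℝ} {f g : X → E} (h : CH α m C f) (h' : CH α m C' g) :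
    CH α m (C + C') (fun x => f x + g x) := by
  induction m generalizing E with
  | zero =>
    rw [CH_zero_iff] at *
    refine ⟨fun x => (norm_add_le _ _).trans (add_le_add (h.1 x) (h'.1 x)), fun x y => ?_⟩
    rw [add_sub_add_comm, add_mul]
    exact (norm_add_le _ _).trans (add_le_add (h.2 x y) (h'.2 x y))
  | succ m ih =>
    rw [CH_succ_iff]
    refine ⟨fun x => (norm_add_le _ _).trans (add_le_add (h.bound x) (h'.bound x)),
      h.diff.add h'.diff, ?_⟩
    have : fderiv ℝ (fun x => f x + g x) = fun x => fderiv ℝ f x + fderiv ℝ g x := by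
      ext1 x; exact fderiv_add (h.diff x) (h'.diff x)
    rw [this]
    exact ih h.fd h'.fd

theorem CH.clm {m : ℕ} {C : ℝ} {f : X → E} (h : CH α m C f) (L : E →L[ℝ] F) :
    CH α m (‖L‖ * C) (fun x => L (f x)) := by
  induction m generalizing E F with
  | zero =>
    rw [CH_zero_iff] at *
    refine ⟨fun x => (L.le_opNorm _).trans (by gcongr; exact h.1 x), fun x y => ?_⟩
    rw [← map_sub, mul_assoc]
    exact (L.le_opNorm _).trans (by gcongr; exact h.2 x y)
  | succ m ih =>
    rw [CH_succ_iff]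
    refine ⟨fun x => (L.le_opNorm _).trans (by gcongr; exact h.bound x),
      L.differentiable.comp h.diff, ?_⟩
    have : fderiv ℝ (fun x => L (f x)) = fun x => ContinuousLinearMap.compL ℝ X E F L (fderiv ℝ f x) := by
      ext1 x; exact (L.hasFDerivAt.comp x (h.diff x).hasFDerivAt).fderiv
    rw [this]
    refine (ih h.fd _).mono ?_
    have h3 := h.nonneg
    gcongr
    exact ContinuousLinearMap.opNorm_le_bound _ (norm_nonneg _) fun g => L.opNorm_comp_le g

theorem CH.neg {m : ℕ} {C : ℝ} {f : X → E} (h : CH α m C f) : CH α m C (fun x => - f x) := by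
  induction m generalizing E with
  | zero =>
    rw [CH_zero_iff] at *
    refine ⟨fun x => by simpa using h.1 x, fun x y => ?_⟩
    rw [← neg_sub', norm_neg]
    exact h.2 x y
  | succ m ih =>
    rw [CH_succ_iff]
    refine ⟨fun x => by simpa using h.bound x, h.diff.neg, ?_⟩
    have : fderiv ℝ (fun x => - f x) = fun x => - fderiv ℝ f x := by
      ext1 x; exact fderiv_neg
    rw [this]
    exact ih h.fd

theorem CH.sub {m : ℕ} {C C' : ℝ} {f g : X → E} (h : CH α m C f) (h' : CH α m C' g) :
    CH α m (C + C') (fun x => f x - g x) := by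
  simpa [sub_eq_add_neg] using h.add h'.neg

theorem CH.sum {m : ℕ} {ι : Type} (s : Finset ι) {C : ι → ℝ} {f : ι → X → E}
    (h : ∀ i ∈ s, CH α m (C i) (f i)) :
    CH α m (∑ i ∈ s, C i) (fun x => ∑ i ∈ s, f i x) := by
  classical
  induction s using Finset.induction_on with
  | empty => simpa using CH.const (α := α) (X := X) (m := m) (0 : E)
  | insert a s ha ih =>
    simp only [Finset.sum_insert ha]
    exact (h a (by simp)).add (ih fun i hi => h i (by simp [hi]))

theorem CH.bilin (h0 : 0 < α) (h1 : α < 1) {m : ℕ} {C C' : ℝ} {f : X → E} {g : X → F}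
    (B : E →L[ℝ] F →L[ℝ] G)
    (h : CH α m C f) (h' : CH α m C' g) :
    CH α m (2 * 4 ^ m * ‖B‖ * C * C') (fun x => B (f x) (g x)) := by
  have hC := h.nonneg
  have hC' := h'.nonneg
  induction m generalizing E F G C C' with
  | zero =>
    have hb : ∀ x, ‖B (f x) (g x)‖ ≤ ‖B‖ * C * C' := fun x =>
      (B.le_opNorm₂ _ _).trans (by gcongr; exacts [h.bound x, h'.bound x])
    rw [CH_zero_iff] at h h' ⊢
    have : 0 ≤ ‖B‖ * C * C' := by positivity
    refine ⟨fun x => (hb x).trans (by simp; linarith), fun x y => ?_⟩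
    have e : B (f x) (g x) - B (f y) (g y) = B (f x - f y) (g x) + B (f y) (g x - g y) := by
      simp
    rw [e]
    have e1 : ‖B (f x - f y) (g x)‖ ≤ ‖B‖ * (C * ‖x - y‖ ^ α) * C' :=
      (B.le_opNorm₂ _ _).trans (by gcongr; exacts [h.2 x y, h'.1 x])
    have e2 : ‖B (f y) (g x - g y)‖ ≤ ‖B‖ * C * (C' * ‖x - y‖ ^ α) :=
      (B.le_opNorm₂ _ _).trans (by gcongr; exacts [h.1 y, h'.2 x y])
    refine (norm_add_le _ _).trans ((add_le_add e1 e2).trans (le_of_eq ?_))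
    ring
  | succ m ih =>
    rw [CH_succ_iff]
    have hp : (1 : ℝ) ≤ 2 * 4 ^ (m + 1) := by
      have : (1 : ℝ) ≤ 4 ^ (m + 1) := one_le_pow₀ (by norm_num)
      linarith
    refine ⟨fun x => ((B.le_opNorm₂ _ _).trans (by gcongr; exacts [h.bound x, h'.bound x] :
      _ ≤ ‖B‖ * C * C')).trans ?_, fun x => ?_, ?_⟩
    · have : 0 ≤ ‖B‖ * C * C' := by positivity
      nlinarith
    · exact (B.hasFDerivAt_of_bilinear (h.diff x).hasFDerivAt
        (h'.diff x).hasFDerivAt).differentiableAt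
    · have : fderiv ℝ (fun x => B (f x) (g x)) = fun x =>
          B.precompR X (f x) (fderiv ℝ g x) + B.precompL X (fderiv ℝ f x) (g x) := by
        ext1 x
        exact (B.hasFDerivAt_of_bilinear (h.diff x).hasFDerivAt (h'.diff x).hasFDerivAt).fderiv
      rw [this]
      have a1 := ih (B.precompR X) (h.lower h0 h1) h'.fd (by positivity) hC'
      have a2 := ih (B.precompL X) h.fd (h'.lower h0 h1) hC (by positivity)
      refine (a1.add a2).mono ?_
      have n1 := B.norm_precompR_le X
      have n2 := B.norm_precompL_le X
      calc _ ≤ 2 * 4 ^ m * ‖B‖ * (2 * C) * C' + 2 * 4 ^ m * ‖B‖ * C * (2 * C') := by gcongr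
        _ = _ := by ring

theorem CHOn.comp (h0 : 0 < α) (h1 : α < 1) (m : ℕ) : ∀ D : ℝ, ∃ K : ℝ, 0 ≤ K ∧
    ∀ {X E F : Type} [NormedAddCommGroup X] [NormedSpace ℝ X]
    [NormedAddCommGroup E] [NormedSpace ℝ E] [NormedAddCommGroup F] [NormedSpace ℝ F]
    {s : Set E} {M : ℝ} {A : E → F} {u : X → E}, CHOn α m s M A → (∀ x, u x ∈ s) →
    CH α (m + 1) D u → CH α m (K * M) (fun x => A (u x)) := by
  induction m with
  | zero =>
    intro D
    refine ⟨1 + |D| ^ α, by positivity, ?_⟩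
    intro X E F _ _ _ _ _ _ s M A u hA hu hD
    have hM : 0 ≤ M := (norm_nonneg _).trans (hA.1 _ (hu 0))
    have hDn := hD.nonneg
    have hD' : 0 ≤ |D| ^ α := by positivity
    rw [CH_zero_iff]
    refine ⟨fun x => (hA.1 _ (hu x)).trans (by nlinarith), fun x y => ?_⟩
    refine (hA.2 _ (hu x) _ (hu y)).trans ?_
    have : ‖u x - u y‖ ^ α ≤ (|D| * ‖x - y‖) ^ α := by
      rw [abs_of_nonneg hDn]
      exact Real.rpow_le_rpow (norm_nonneg _) (hD.lip x y) h0.le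
    rw [Real.mul_rpow (abs_nonneg _) (norm_nonneg _)] at this
    have h3 : 0 ≤ ‖x - y‖ ^ α := by positivity
    calc M * ‖u x - u y‖ ^ α ≤ M * (|D| ^ α * ‖x - y‖ ^ α) := by gcongr
      _ ≤ _ := by nlinarith [mul_nonneg hM h3]
  | succ m ih =>
    intro D
    obtain ⟨K, hK, hKK⟩ := ih (2 * D)
    refine ⟨1 + 2 * 4 ^ m * K * (2 * |D|), by positivity, ?_⟩
    intro X E F _ _ _ _ _ _ s M A u hA hu hD
    obtain ⟨hA1, hA2, hA3⟩ := hA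
    have hM : 0 ≤ M := (norm_nonneg _).trans (hA1 _ (hu 0))
    have hDn := hD.nonneg
    rw [abs_of_nonneg hDn]
    have hd : ∀ x, HasFDerivAt (fun x => A (u x)) ((fderiv ℝ A (u x)).comp (fderiv ℝ u x)) x :=
      fun x => (hA2 _ (hu x)).hasFDerivAt.comp x (hD.diff x).hasFDerivAt
    rw [CH_succ_iff]
    refine ⟨fun x => (hA1 _ (hu x)).trans ?_, fun x => (hd x).differentiableAt, ?_⟩
    · have : 0 ≤ 2 * 4 ^ m * K * (2 * D) := by positivity
      nlinarith
    · have : fderiv ℝ (fun x => A (u x)) = fun x =>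
          ContinuousLinearMap.compL ℝ X E F (fderiv ℝ A (u x)) (fderiv ℝ u x) := by
        ext1 x; exact (hd x).fderiv
      rw [this]
      have a1 := hKK hA3 hu (hD.lower h0 h1)
      have a2 := (a1.bilin h0 h1 (ContinuousLinearMap.compL ℝ X E F) (hD.fd.lower h0 h1))
      refine a2.mono ?_
      have n1 := ContinuousLinearMap.norm_compL_le ℝ X E F
      calc _ ≤ 2 * 4 ^ m * 1 * (K * M) * (2 * D) := by gcongr
        _ ≤ _ := by nlinarith

theorem CH.comp_small (h0 : 0 < α) (h1 : α < 1) (m : ℕ) : ∃ K : ℝ, 0 ≤ K ∧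
    ∀ {X E F : Type} [NormedAddCommGroup X] [NormedSpace ℝ X]
    [NormedAddCommGroup E] [NormedSpace ℝ E] [NormedAddCommGroup F] [NormedSpace ℝ F]
    {M δ : ℝ} {A : E → F} {u : X → E}, CH α (m + 1) M A → A 0 = 0 → δ ≤ 1 →
    CH α (m + 2) δ u → CH α (m + 1) (K * M * δ) (fun x => A (u x)) := by
  obtain ⟨K, hK, hKK⟩ := CHOn.comp h0 h1 m 2
  refine ⟨1 + 2 * 4 ^ m * K * 2, by positivity, ?_⟩
  intro X E F _ _ _ _ _ _ M δ A u hA hA0 hδ hu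
  have hM := hA.nonneg
  have hδ0 := hu.nonneg
  have hd : ∀ x, HasFDerivAt (fun x => A (u x)) ((fderiv ℝ A (u x)).comp (fderiv ℝ u x)) x :=
    fun x => (hA.diff _).hasFDerivAt.comp x (hu.diff x).hasFDerivAt
  rw [CH_succ_iff]
  refine ⟨fun x => ?_, fun x => (hd x).differentiableAt, ?_⟩
  · have h2 := hA.lip (u x) 0
    rw [hA0, sub_zero, sub_zero] at h2
    have h3 := hu.bound x
    calc _ ≤ M * ‖u x‖ := h2
      _ ≤ 1 * M * δ := by rw [one_mul]; gcongr
      _ ≤ _ := by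
        gcongr
        have : 0 ≤ 2 * 4 ^ m * K * 2 := by positivity
        linarith
  · have : fderiv ℝ (fun x => A (u x)) = fun x =>
        ContinuousLinearMap.compL ℝ X E F (fderiv ℝ A (u x)) (fderiv ℝ u x) := by
      ext1 x; exact (hd x).fderiv
    rw [this]
    have a1 := hKK hA.fd (fun x => mem_univ (u x)) ((hu.lower h0 h1).mono (by linarith))
    have a2 := (a1.bilin h0 h1 (ContinuousLinearMap.compL ℝ X E F) (hu.fd.lower h0 h1))
    refine a2.mono ?_
    have n1 := ContinuousLinearMap.norm_compL_le ℝ X E F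
    calc _ ≤ 2 * 4 ^ m * 1 * (K * M) * (2 * δ) := by gcongr
      _ ≤ _ := by nlinarith [mul_nonneg hM hδ0]

theorem CH.comp_lip (h0 : 0 < α) (h1 : α < 1) (m : ℕ) : ∀ D : ℝ, ∃ K : ℝ, 0 ≤ K ∧
    ∀ {X E F : Type} [NormedAddCommGroup X] [NormedSpace ℝ X]
    [NormedAddCommGroup E] [NormedSpace ℝ E] [NormedAddCommGroup F] [NormedSpace ℝ F]
    {M η : ℝ} {A : E → F} {u v : X → E}, CH α (m + 1) M A → CH α (m + 1) D u →
    CH α (m + 1) D v → CH α (m + 1) η (fun x => u x - v x) →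
    CH α m (K * M * η) (fun x => A (u x) - A (v x)) := by
  induction m with
  | zero =>
    intro D
    refine ⟨2 + |D| ^ α, by positivity, ?_⟩
    intro X E F _ _ _ _ _ _ M η A u v hA hu hv hw
    have hM := hA.nonneg
    have hD := hu.nonneg
    have hη := hw.nonneg
    rw [abs_of_nonneg hD]
    have hD' : 0 ≤ D ^ α := by positivity
    rw [CH_zero_iff]
    refine ⟨fun x => ?_, fun x y => ?_⟩
    · calc _ ≤ M * ‖u x - v x‖ := hA.lip _ _
        _ ≤ 1 * M * η := by rw [one_mul]; gcongr; exact hw.bound x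
        _ ≤ _ := by gcongr; linarith
    · set w := fun x => u x - v x with hwdef
      have huv : ∀ x, u x = v x + w x := fun x => by simp [hwdef]
      have e1 : ‖A (v y + w x) - A (v y + w y)‖ ≤ M * (2 * η * ‖x - y‖ ^ α) := by
        refine (hA.lip _ _).trans ?_
        gcongr
        rw [add_sub_add_left_eq_sub]
        exact hw.holder h0 h1 x y
      have e2 : ‖(A (v x + w x) - A (v y + w x)) - (A (v x + 0) - A (v y + 0))‖
          ≤ M * (D * ‖x - y‖) ^ α * ‖w x - 0‖ := by
        have hder : ∀ h, HasFDerivAt (fun h => A (v x + h) - A (v y + h))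
            (fderiv ℝ A (v x + h) - fderiv ℝ A (v y + h)) h := by
          intro h
          refine HasFDerivAt.fun_sub ?_ ?_
          · exact (hasFDerivAt_comp_add_left (v x)).2 (hA.diff (v x + h)).hasFDerivAt
          · exact (hasFDerivAt_comp_add_left (v y)).2 (hA.diff (v y + h)).hasFDerivAt
        refine Convex.norm_image_sub_le_of_norm_hasFDerivWithin_le (s := univ)
          (f := fun h => A (v x + h) - A (v y + h)) (𝕜 := ℝ)
          (fun h _ => (hder h).hasFDerivWithinAt) (fun h _ => ?_) convex_univ
          (mem_univ _) (mem_univ _)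
        refine ((CH_zero_iff.1 hA.fd).2 _ _).trans ?_
        gcongr
        rw [add_sub_add_right_eq_sub]
        exact hv.lip x y
      have e : A (u x) - A (v x) - (A (u y) - A (v y)) =
          ((A (v x + w x) - A (v y + w x)) - (A (v x + 0) - A (v y + 0))) +
          (A (v y + w x) - A (v y + w y)) := by
        rw [huv, huv y]; simp only [add_zero]; abel
      rw [e]
      refine (norm_add_le _ _).trans ((add_le_add e2 e1).trans ?_)
      rw [sub_zero, Real.mul_rpow hD (norm_nonneg _)]
      have := hw.bound x
      calc _ ≤ M * (D ^ α * ‖x - y‖ ^ α) * η + M * (2 * η * ‖x - y‖ ^ α) := by gcongr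
        _ = _ := by ring
  | succ m ih =>
    intro D
    obtain ⟨K, hK, hKK⟩ := ih (2 * D)
    obtain ⟨K2, hK2, hKK2⟩ := CHOn.comp h0 h1 m (2 * D)
    refine ⟨1 + 2 * 4 ^ m * (K * 2) * (2 * |D|) + 2 * 4 ^ m * (K2 * 2) * 2, by positivity, ?_⟩
    intro X E F _ _ _ _ _ _ M η A u v hA hu hv hw
    have hM := hA.nonneg
    have hD := hu.nonneg
    have hη := hw.nonneg
    rw [abs_of_nonneg hD]
    have hd : ∀ {u : X → E}, CH α (m + 1 + 1) D u → ∀ x, HasFDerivAt (fun x => A (u x))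
        ((fderiv ℝ A (u x)).comp (fderiv ℝ u x)) x :=
      fun hu x => (hA.diff _).hasFDerivAt.comp x (hu.diff x).hasFDerivAt
    rw [CH_succ_iff]
    refine ⟨fun x => ?_, fun x => ((hd hu x).sub (hd hv x)).differentiableAt, ?_⟩
    · calc _ ≤ M * ‖u x - v x‖ := hA.lip _ _
        _ ≤ 1 * M * η := by rw [one_mul]; gcongr; exact hw.bound x
        _ ≤ _ := by
          gcongr
          have : 0 ≤ 2 * 4 ^ m * (K * 2) * (2 * D) + 2 * 4 ^ m * (K2 * 2) * 2 := by positivity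
          linarith
    · have : fderiv ℝ (fun x => A (u x) - A (v x)) = fun x =>
          ContinuousLinearMap.compL ℝ X E F (fderiv ℝ A (u x) - fderiv ℝ A (v x)) (fderiv ℝ u x)
          + ContinuousLinearMap.compL ℝ X E F (fderiv ℝ A (v x))
            (fderiv ℝ (fun x => u x - v x) x) := by
        ext1 x
        rw [((hd hu x).fun_sub (hd hv x)).fderiv, fderiv_fun_sub (hu.diff x) (hv.diff x)]
        ext1 y
        simp
      rw [this]
      have a1 := (hKK hA.fd (hu.lower h0 h1) (hv.lower h0 h1) (hw.lower h0 h1)).bilin h0 h1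
        (ContinuousLinearMap.compL ℝ X E F) (hu.fd.lower h0 h1)
      have a2 := (hKK2 (hA.fd.lower h0 h1) (fun x => mem_univ (v x)) (hv.lower h0 h1)).bilin h0 h1
        (ContinuousLinearMap.compL ℝ X E F) (hw.fd.lower h0 h1)
      refine (a1.add a2).mono ?_
      have n1 := ContinuousLinearMap.norm_compL_le ℝ X E F
      calc _ ≤ 2 * 4 ^ m * 1 * (K * M * (2 * η)) * (2 * D) +
            2 * 4 ^ m * 1 * (K2 * (2 * M)) * (2 * η) := by gcongr
        _ ≤ _ := by nlinarith [mul_nonneg hM hη]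

end CHcalc

section convo

variable {W E G : Type} [NormedAddCommGroup W] [NormedSpace ℝ W]
    [NormedAddCommGroup E] [NormedSpace ℝ E] [NormedAddCommGroup G] [NormedSpace ℝ G]

theorem hcs_of_zero {κ : ℂ → W} {R : ℝ} (h : ∀ t, R < ‖t‖ → κ t = 0) : HasCompactSupport κ := by
  refine HasCompactSupport.intro (isCompact_closedBall (0 : ℂ) R) fun x hx => h x ?_
  simpa using hx

theorem conv_bound (L : W →L[ℝ] E →L[ℝ] G) {κ : ℂ → W} (hκ : Continuous κ) {R : ℝ}
    (hR : ∀ t, R < ‖t‖ → κ t = 0) (j : ℕ) (c : ℝ) {g : ℂ → E} (z : ℂ) {B : ℝ}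
    (hB : ∀ t : ℂ, ‖t‖ ≤ (2 ^ j)⁻¹ * R → ‖g (z - t)‖ ≤ B) :
    ‖(convolution (fun t => c • κ ((2 ^ j : ℝ) • t)) g L volume) z‖ ≤
      ‖L‖ * |c| * (4 ^ j)⁻¹ * (∫ t, ‖κ t‖) * B := by
  have hIntg : Integrable (fun t => ‖κ ((2 ^ j : ℝ) • t)‖) := by
    have h1 : Integrable (fun t => ‖κ t‖) :=
      (hκ.integrable_of_hasCompactSupport (hcs_of_zero hR)).norm
    exact h1.comp_smul (by positivity)
  have h2 : ∫ t, ‖L‖ * |c| * B * ‖κ ((2 ^ j : ℝ) • t)‖ =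
      ‖L‖ * |c| * (4 ^ j)⁻¹ * (∫ t, ‖κ t‖) * B := by
    rw [integral_const_mul, Measure.integral_comp_smul volume (fun t => ‖κ t‖)]
    rw [Complex.finrank_real_complex, ← pow_mul, mul_comm j 2, pow_mul, 
      abs_of_pos (by positivity : (0 : ℝ) < ((2 ^ 2) ^ j)⁻¹), smul_eq_mul]
    norm_num
    ring
  rw [← h2, convolution_def]
  refine norm_integral_le_of_norm_le (hIntg.const_mul _) (Eventually.of_forall fun t => ?_)
  by_cases ht : R < ‖(2 ^ j : ℝ) • t‖
  · rw [hR _ ht]; simp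
  · have ht' : ‖t‖ ≤ (2 ^ j)⁻¹ * R := by
      rw [norm_smul, Real.norm_of_nonneg (by positivity)] at ht
      rw [le_inv_mul_iff₀ (by positivity)]
      linarith
    have hb := hB t ht'
    calc _ ≤ ‖L‖ * ‖c • κ ((2 ^ j : ℝ) • t)‖ * ‖g (z - t)‖ := L.le_opNorm₂ _ _
      _ ≤ ‖L‖ * ‖c • κ ((2 ^ j : ℝ) • t)‖ * B := by gcongr
      _ = _ := by rw [norm_smul, Real.norm_eq_abs]; ring

theorem conv_deriv [CompleteSpace G] (L : W →L[ℝ] E →L[ℝ] G) {κ : ℂ → W} (hκ : ContDiff ℝ 1 κ)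
    (hcs : HasCompactSupport κ) {g : ℂ → E} (hg : Continuous g) (c : E) (z : ℂ) :
    HasFDerivAt (convolution κ g L volume)
      ((convolution (fderiv ℝ κ) (fun w => g w - c) (L.precompL ℂ) volume) z) z := by
  have h1 : convolution κ g L volume = fun x =>
      convolution κ (fun w => g w - c) L volume x + ∫ t, L (κ t) c := by
    ext x
    rw [convolution_def, convolution_def, ← integral_add]
    · congr 1; ext t; simp
    · refine Continuous.integrable_of_hasCompactSupport (by fun_prop) ?_
      exact hcs.mono fun t ht h => ht (by simp [h])
    · refine Continuous.integrable_of_hasCompactSupport (by fun_prop) ?_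
      exact hcs.mono fun t ht h => ht (by simp [h])
  rw [h1]
  exact (hcs.hasFDerivAt_convolution_left L hκ
    (by fun_prop : Continuous fun w => g w - c).locallyIntegrable z).add_const _

theorem fderiv_scaled {κ : ℂ → W} (hκ : Differentiable ℝ κ) (c r : ℝ) :
    fderiv ℝ (fun t => c • κ (r • t)) = fun t => (c * r) • fderiv ℝ κ (r • t) := by
  ext1 t
  have h : HasFDerivAt (fun t : ℂ => r • t) (r • ContinuousLinearMap.id ℝ ℂ) t :=
    (hasFDerivAt_id t).const_smul r
  have h2 := ((hκ (r • t)).hasFDerivAt.comp t h).const_smul c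
  rw [show (fun t => c • κ (r • t)) = c • (κ ∘ fun t => r • t) from rfl, h2.fderiv]
  ext1 v
  simp [mul_smul]

theorem dyadic_sum {α : ℝ} (h0 : 0 < α) (h1 : α < 1) : ∃ K : ℝ, 0 ≤ K ∧ ∀ (a : ℕ → ℝ) (A d : ℝ),
    0 ≤ A → 0 ≤ d → (∀ j, 0 ≤ a j) → (∀ j, a j ≤ A * ((2 : ℝ) ^ (-α)) ^ j) →
    (∀ j, a j ≤ A * (2 * (2 : ℝ) ^ (-α)) ^ j * d) → ∑' j, a j ≤ K * A * d ^ α := by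
  set q : ℝ := (2 : ℝ) ^ (-α) with hq
  have hq0 : 0 < q := by positivity
  have hq1 : q < 1 := Real.rpow_lt_one_of_one_lt_of_neg (by norm_num) (by linarith)
  have hq2 : 1 < 2 * q := by
    have : (2 : ℝ) ^ (-1 : ℝ) < q := Real.rpow_lt_rpow_of_exponent_lt (by norm_num) (by linarith)
    rw [Real.rpow_neg_one] at this
    linarith
  have p1 : 0 < 1 - q := by linarith
  have p2 : 0 < 2 * q - 1 := by linarith
  have hqinv : 1 ≤ q⁻¹ := one_le_inv₀ hq0 |>.2 hq1.le
  refine ⟨q⁻¹ * ((2 * q - 1)⁻¹ + (1 - q)⁻¹), by positivity, ?_⟩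
  intro a A d hA hd ha h3 h4
  have hsg : Summable (fun j => A * q ^ j) := (summable_geometric_of_lt_one hq0.le hq1).mul_left A
  have hs : Summable a := Summable.of_nonneg_of_le ha h3 hsg
  have tail : ∀ N, ∑' j, a (j + N) ≤ A * q ^ N * (1 - q)⁻¹ := by
    intro N
    calc ∑' j, a (j + N) ≤ ∑' j, A * q ^ N * q ^ j := by
          refine Summable.tsum_le_tsum (fun j => ?_) ((summable_nat_add_iff N).2 hs)
            ((summable_geometric_of_lt_one hq0.le hq1).mul_left _)
          exact (h3 _).trans (le_of_eq (by ring))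
      _ = _ := by rw [tsum_mul_left, tsum_geometric_of_lt_one hq0.le hq1]
  rcases hd.eq_or_lt with hd0 | hd0
  · have : ∀ j, a j = 0 := fun j => le_antisymm (by simpa [← hd0] using h4 j) (ha j)
    simp [this, ← hd0, Real.zero_rpow h0.ne']
  rcases le_total 1 d with hd1 | hd1
  · have h5 := tail 0
    simp only [add_zero, pow_zero, mul_one] at h5
    have h6 : 1 ≤ d ^ α := Real.one_le_rpow hd1 h0.le
    calc _ ≤ A * (1 - q)⁻¹ := h5
      _ = 1 * (0 + (1 - q)⁻¹) * A * 1 := by ring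
      _ ≤ _ := by gcongr; positivity
  · obtain ⟨N, hN1, hN2⟩ := exists_nat_pow_near (one_le_inv₀ hd0 |>.2 hd1) (by norm_num : (1 : ℝ) < 2)
    have hN1' : 2 ^ N * d ≤ 1 := by
      have := mul_le_mul_of_nonneg_right hN1 hd
      rwa [inv_mul_cancel₀ hd0.ne'] at this
    have hqN : q ^ N ≤ q⁻¹ * d ^ α := by
      rw [le_inv_mul_iff₀ hq0, ← pow_succ', hq, ← Real.rpow_natCast, ← Real.rpow_mul (by norm_num),
        mul_comm, Real.rpow_mul (by norm_num), Real.rpow_natCast, Real.rpow_neg (by positivity),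
        ← Real.inv_rpow (by positivity)]
      refine Real.rpow_le_rpow (by positivity) ?_ h0.le
      rw [inv_le_comm₀ (by positivity) hd0]
      exact hN2.le
    have head : ∑ j ∈ Finset.range N, a j ≤ A * q ^ N * (2 * q - 1)⁻¹ := by
      calc ∑ j ∈ Finset.range N, a j ≤ ∑ j ∈ Finset.range N, A * (2 * q) ^ j * d :=
            Finset.sum_le_sum fun j _ => h4 j
        _ = A * d * ∑ j ∈ Finset.range N, (2 * q) ^ j := by
            rw [Finset.mul_sum]; exact Finset.sum_congr rfl fun j _ => by ring
        _ = A * d * (((2 * q) ^ N - 1) * (2 * q - 1)⁻¹) := by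
            rw [geom_sum_eq hq2.ne']; rfl
        _ ≤ A * d * ((2 * q) ^ N * (2 * q - 1)⁻¹) := by gcongr; linarith
        _ = (2 ^ N * d) * (A * q ^ N * (2 * q - 1)⁻¹) := by rw [mul_pow]; ring
        _ ≤ 1 * (A * q ^ N * (2 * q - 1)⁻¹) := by gcongr
        _ = _ := one_mul _
    rw [← hs.sum_add_tsum_nat_add N]
    calc _ ≤ A * q ^ N * (2 * q - 1)⁻¹ + A * q ^ N * (1 - q)⁻¹ := add_le_add head (tail N)
      _ = A * ((2 * q - 1)⁻¹ + (1 - q)⁻¹) * q ^ N := by ring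
      _ ≤ A * ((2 * q - 1)⁻¹ + (1 - q)⁻¹) * (q⁻¹ * d ^ α) := by gcongr
      _ = _ := by ring

end convo

noncomputable section

/-- dyadic dilations of a kernel -/
def kerJ (φ : ℂ → ℝ) (j : ℕ) (t : ℂ) : ℝ := (2 ^ j : ℝ) • φ ((2 ^ j : ℝ) • t)

/-- pieces of the potential -/
def FJ {E : Type} [NormedAddCommGroup E] [NormedSpace ℝ E] (φ : ℂ → ℝ) (f : ℂ → E) (j : ℕ) : ℂ → E :=
  convolution (kerJ φ j) f (ContinuousLinearMap.lsmul ℝ ℝ) volume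

/-- The sum of the dyadic pieces. -/
def TT {E : Type} [NormedAddCommGroup E] [NormedSpace ℝ E] (φ : ℂ → ℝ) (f : ℂ → E) (z : ℂ) : E :=
  ∑' j, FJ φ f j z

/-- derivative of the pieces -/
def GJ {E : Type} [NormedAddCommGroup E] [NormedSpace ℝ E] (φ : ℂ → ℝ) (f : ℂ → E) (j : ℕ) (z : ℂ) :
    ℂ →L[ℝ] E :=
  convolution (fderiv ℝ (kerJ φ j)) f ((ContinuousLinearMap.lsmul ℝ ℝ).precompL ℂ) volume z

end

section potential

variable {E : Type} [NormedAddCommGroup E] [NormedSpace ℝ E]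
variable {φ : ℂ → ℝ} {R : ℝ} {α : ℝ}

theorem kerJ_contDiff (hφ : ContDiff ℝ 3 φ) (j : ℕ) : ContDiff ℝ 3 (kerJ φ j) := by
  unfold kerJ
  fun_prop

theorem kerJ_hcs (hR : ∀ t, R < ‖t‖ → φ t = 0) (j : ℕ) : HasCompactSupport (kerJ φ j) := by
  refine hcs_of_zero (R := (2 ^ j)⁻¹ * R) fun t ht => ?_
  unfold kerJ
  rw [hR, smul_zero]
  rw [inv_mul_lt_iff₀ (by positivity)] at ht
  rwa [norm_smul, Real.norm_of_nonneg (by positivity)]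

theorem fderiv_zero_out {W : Type} [NormedAddCommGroup W] [NormedSpace ℝ W] {κ : ℂ → W}
    (hR : ∀ t, R < ‖t‖ → κ t = 0) : ∀ t, R < ‖t‖ → fderiv ℝ κ t = 0 := by
  intro t ht
  have : κ =ᶠ[𝓝 t] fun _ => 0 := by
    filter_upwards [(isOpen_lt continuous_const continuous_norm).mem_nhds ht] with s hs
    exact hR s hs
  rw [this.fderiv_eq]; simp

theorem fderiv_kerJ (hφ : ContDiff ℝ 3 φ) (j : ℕ) :
    fderiv ℝ (kerJ φ j) = fun t => (4 ^ j : ℝ) • fderiv ℝ φ ((2 ^ j : ℝ) • t) := by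
  have := fderiv_scaled (hφ.differentiable (by norm_num)) (2 ^ j) (2 ^ j)
  have e : (2 ^ j : ℝ) * 2 ^ j = 4 ^ j := by rw [← mul_pow]; norm_num
  rw [e] at this
  exact this

theorem fderiv2_kerJ (hφ : ContDiff ℝ 3 φ) (j : ℕ) :
    fderiv ℝ (fderiv ℝ (kerJ φ j)) =
      fun t => (8 ^ j : ℝ) • fderiv ℝ (fderiv ℝ φ) ((2 ^ j : ℝ) • t) := by
  rw [fderiv_kerJ hφ]
  have h2 : ContDiff ℝ 2 (fderiv ℝ φ) := hφ.fderiv_right (by norm_num)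
  have := fderiv_scaled (h2.differentiable (by norm_num)) (4 ^ j) (2 ^ j)
  have e : (4 ^ j : ℝ) * 2 ^ j = 8 ^ j := by rw [← mul_pow]; norm_num
  rw [e] at this
  exact this

theorem lsmul_norm_le : ‖(ContinuousLinearMap.lsmul ℝ ℝ : ℝ →L[ℝ] E →L[ℝ] E)‖ ≤ 1 :=
  ContinuousLinearMap.opNorm_lsmul_le

variable [CompleteSpace E]

theorem FJ_bound (hφ : ContDiff ℝ 3 φ) (hR : ∀ t, R < ‖t‖ → φ t = 0) {f : ℂ → E} {C : ℝ}
    (hf : ∀ z, ‖f z‖ ≤ C) (j : ℕ) (z : ℂ) : ‖FJ φ f j z‖ ≤ (∫ t, ‖φ t‖) * C * (2⁻¹) ^ j := by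
  have hC : 0 ≤ C := (norm_nonneg _).trans (hf 0)
  have := conv_bound (ContinuousLinearMap.lsmul ℝ ℝ : ℝ →L[ℝ] E →L[ℝ] E) hφ.continuous hR j (2 ^ j)
    (g := f) z (B := C) (fun t _ => hf _)
  refine this.trans ?_
  have h1 := lsmul_norm_le (E := E)
  have h3 : (0 : ℝ) ≤ ∫ t, ‖φ t‖ := integral_nonneg fun _ => norm_nonneg _
  have h4 : (4 : ℝ) ^ j = 2 ^ j * 2 ^ j := by rw [← mul_pow]; norm_num
  calc _ ≤ 1 * |2 ^ j| * (4 ^ j)⁻¹ * (∫ t, ‖φ t‖) * C := by gcongr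
    _ = _ := by
      rw [abs_of_pos (by positivity), h4, inv_pow]
      field_simp

theorem FJ_deriv (hφ : ContDiff ℝ 3 φ) (hR : ∀ t, R < ‖t‖ → φ t = 0) {f : ℂ → E}
    (hf : Continuous f) (j : ℕ) (z : ℂ) : HasFDerivAt (FJ φ f j) (GJ φ f j z) z := by
  have := conv_deriv (ContinuousLinearMap.lsmul ℝ ℝ : ℝ →L[ℝ] E →L[ℝ] E)
    ((kerJ_contDiff hφ j).of_le (by norm_num)) (kerJ_hcs hR j) hf 0 z
  simp only [sub_zero] at this
  exact this

theorem rpow_aux {R α : ℝ} (hR0 : 0 ≤ R) (j : ℕ) :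
    (((2 : ℝ) ^ j)⁻¹ * R) ^ α = R ^ α * ((2 : ℝ) ^ (-α)) ^ j := by
  rw [Real.mul_rpow (by positivity) hR0, Real.inv_rpow (by positivity), mul_comm]
  congr 1
  rw [← Real.rpow_natCast, ← Real.rpow_mul (by norm_num), mul_comm (j : ℝ) α,
        Real.rpow_mul (by norm_num), Real.rpow_natCast, Real.rpow_neg (by norm_num), inv_pow]

theorem GJ_bound (h0 : 0 < α) (hR0 : 0 ≤ R) (hφ : ContDiff ℝ 3 φ) (hR : ∀ t, R < ‖t‖ → φ t = 0)
    {f : ℂ → E} {C : ℝ} (hC : 0 ≤ C) (hfc : Continuous f)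
    (hf : ∀ z w, ‖f z - f w‖ ≤ C * ‖z - w‖ ^ α) (j : ℕ) (z : ℂ) :
    ‖GJ φ f j z‖ ≤ R ^ α * (∫ t, ‖fderiv ℝ φ t‖) * C * ((2 : ℝ) ^ (-α)) ^ j := by
  have e : GJ φ f j z = (convolution (fderiv ℝ (kerJ φ j)) (fun w => f w - f z)
      ((ContinuousLinearMap.lsmul ℝ ℝ).precompL ℂ) volume) z :=
    (FJ_deriv hφ hR hfc j z).unique (conv_deriv (ContinuousLinearMap.lsmul ℝ ℝ : ℝ →L[ℝ] E →L[ℝ] E)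
    ((kerJ_contDiff hφ j).of_le (by norm_num)) (kerJ_hcs hR j) hfc (f z) z)
  rw [e, fderiv_kerJ hφ]
  have := conv_bound ((ContinuousLinearMap.lsmul ℝ ℝ : ℝ →L[ℝ] E →L[ℝ] E).precompL ℂ)
    (hφ.continuous_fderiv (by norm_num)) (fderiv_zero_out hR) j (4 ^ j)
    (g := fun w => f w - f z) z (B := C * ((2 ^ j)⁻¹ * R) ^ α) (fun t ht => by
      refine (hf _ _).trans ?_
      gcongr
      simpa using ht)
  refine this.trans ?_
  have h1 := (ContinuousLinearMap.norm_precompL_le ℂ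
    (ContinuousLinearMap.lsmul ℝ ℝ : ℝ →L[ℝ] E →L[ℝ] E)).trans lsmul_norm_le
  have h3 : (0 : ℝ) ≤ ∫ t, ‖fderiv ℝ φ t‖ := integral_nonneg fun _ => norm_nonneg _
  calc _ ≤ 1 * |4 ^ j| * (4 ^ j)⁻¹ * (∫ t, ‖fderiv ℝ φ t‖) * (C * ((2 ^ j)⁻¹ * R) ^ α) := by gcongr
    _ = _ := by
      rw [abs_of_pos (by positivity), rpow_aux hR0]
      field_simp

theorem GJ_lip (h0 : 0 < α) (hR0 : 0 ≤ R) (hφ : ContDiff ℝ 3 φ) (hR : ∀ t, R < ‖t‖ → φ t = 0)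
    {f : ℂ → E} {C : ℝ} (hC : 0 ≤ C) (hfc : Continuous f)
    (hf : ∀ z w, ‖f z - f w‖ ≤ C * ‖z - w‖ ^ α) (j : ℕ) (z w : ℂ) :
    ‖GJ φ f j z - GJ φ f j w‖ ≤
      R ^ α * (∫ t, ‖fderiv ℝ (fderiv ℝ φ) t‖) * C * (2 * (2 : ℝ) ^ (-α)) ^ j * ‖z - w‖ := by
  have h2 : ContDiff ℝ 2 (fderiv ℝ φ) := hφ.fderiv_right (by norm_num)
  have hG : GJ φ f j = convolution (fderiv ℝ (kerJ φ j)) f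
    ((ContinuousLinearMap.lsmul ℝ ℝ : ℝ →L[ℝ] E →L[ℝ] E).precompL ℂ) volume := rfl
  rw [hG]
  have e := fun z : ℂ =>
    conv_deriv ((ContinuousLinearMap.lsmul ℝ ℝ : ℝ →L[ℝ] E →L[ℝ] E).precompL ℂ)
    (((kerJ_contDiff hφ j)).fderiv_right (m := 1) (by norm_num)) ((kerJ_hcs hR j).fderiv ℝ) hfc (f z) z
  clear hG
  refine Convex.norm_image_sub_le_of_norm_hasFDerivWithin_le (s := univ) (𝕜 := ℝ)
    (fun z _ => (e z).hasFDerivWithinAt) (fun z _ => ?_) convex_univ (mem_univ _) (mem_univ _)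
  rw [fderiv2_kerJ hφ]
  have := conv_bound (W := ℂ →L[ℝ] ℂ →L[ℝ] ℝ) (G := ℂ →L[ℝ] ℂ →L[ℝ] E) (((ContinuousLinearMap.lsmul ℝ ℝ : ℝ →L[ℝ] E →L[ℝ] E).precompL ℂ).precompL ℂ)
    (h2.continuous_fderiv (by norm_num)) (fderiv_zero_out (fderiv_zero_out hR)) j (8 ^ j)
    (g := fun w => f w - f z) z (B := C * ((2 ^ j)⁻¹ * R) ^ α) (fun t ht => by
      refine (hf _ _).trans ?_
      gcongr
      simpa using ht)
  refine this.trans ?_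
  have h1 := (ContinuousLinearMap.norm_precompL_le ℂ ((ContinuousLinearMap.lsmul ℝ ℝ :
    ℝ →L[ℝ] E →L[ℝ] E).precompL ℂ)).trans ((ContinuousLinearMap.norm_precompL_le ℂ
    (ContinuousLinearMap.lsmul ℝ ℝ : ℝ →L[ℝ] E →L[ℝ] E)).trans lsmul_norm_le)
  have h3 : (0 : ℝ) ≤ ∫ t, ‖fderiv ℝ (fderiv ℝ φ) t‖ :=
    integral_nonneg fun t => norm_nonneg (fderiv ℝ (fderiv ℝ φ) t)
  calc _ ≤ 1 * |8 ^ j| * (4 ^ j)⁻¹ * (∫ t, ‖fderiv ℝ (fderiv ℝ φ) t‖) *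
        (C * ((2 ^ j)⁻¹ * R) ^ α) := by gcongr
    _ = _ := by
      have h8 : (8 : ℝ) ^ j = 4 ^ j * 2 ^ j := by rw [← mul_pow]; norm_num
      rw [abs_of_pos (by positivity), rpow_aux hR0, h8, mul_pow]
      field_simp

theorem qlt {α : ℝ} (h0 : 0 < α) : (2 : ℝ) ^ (-α) < 1 :=
  Real.rpow_lt_one_of_one_lt_of_neg (by norm_num) (by linarith)

theorem TT_hasSum (hφ : ContDiff ℝ 3 φ) (hR : ∀ t, R < ‖t‖ → φ t = 0) {f : ℂ → E} {C : ℝ}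
    (hf : ∀ z, ‖f z‖ ≤ C) (z : ℂ) : Summable (fun j => FJ φ f j z) :=
  Summable.of_norm_bounded ((summable_geometric_of_lt_one (by norm_num) (by norm_num)).mul_left _)
    fun j => FJ_bound hφ hR hf j z

theorem TT_norm (hφ : ContDiff ℝ 3 φ) (hR : ∀ t, R < ‖t‖ → φ t = 0) {f : ℂ → E} {C : ℝ}
    (hf : ∀ z, ‖f z‖ ≤ C) (z : ℂ) : ‖TT φ f z‖ ≤ 2 * (∫ t, ‖φ t‖) * C := by
  have h := tsum_of_norm_bounded (f := fun j => FJ φ f j z) ((hasSum_geometric_of_lt_one (r := (2⁻¹ : ℝ))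
    (by norm_num) (by norm_num)).mul_left _) fun j => FJ_bound hφ hR hf j z
  refine h.trans (le_of_eq ?_)
  norm_num; ring

theorem TT_deriv (h0 : 0 < α) (h1 : α < 1) (hR0 : 0 ≤ R) (hφ : ContDiff ℝ 3 φ)
    (hR : ∀ t, R < ‖t‖ → φ t = 0) {f : ℂ → E} {C : ℝ} (hf : CH α 0 C f) (z : ℂ) :
    HasFDerivAt (TT φ f) (∑' j, GJ φ f j z) z ∧ Summable (fun j => GJ φ f j z) := by
  have hs := ((summable_geometric_of_lt_one (r := (2 : ℝ) ^ (-α)) (by positivity) (qlt h0)).mul_left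
    (R ^ α * (∫ t, ‖fderiv ℝ φ t‖) * C))
  have hb := GJ_bound h0 hR0 hφ hR hf.nonneg (hf.continuous h0 h1) (CH_zero_iff.1 hf).2
  exact ⟨hasFDerivAt_tsum hs (fun j z => FJ_deriv hφ hR (hf.continuous h0 h1) j z) hb
    (TT_hasSum hφ hR hf.bound 0) z, Summable.of_norm_bounded hs fun j => hb j z⟩

theorem TT_CH (h0 : 0 < α) (h1 : α < 1) (hR0 : 0 ≤ R) (hφ : ContDiff ℝ 3 φ)
    (hR : ∀ t, R < ‖t‖ → φ t = 0) : ∃ K : ℝ, 0 ≤ K ∧ ∀ (m : ℕ) {E : Type} [NormedAddCommGroup E]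
    [NormedSpace ℝ E] [CompleteSpace E] {f : ℂ → E} {C : ℝ}, HasCompactSupport f → CH α m C f →
    CH α (m + 1) (K * C) (TT φ f) := by
  obtain ⟨K0, hK0, hK⟩ := dyadic_sum h0 h1
  set I0 := ∫ t, ‖φ t‖
  set I1 := ∫ t, ‖fderiv ℝ φ t‖
  set I2 := ∫ t, ‖fderiv ℝ (fderiv ℝ φ) t‖
  have hI0 : 0 ≤ I0 := integral_nonneg fun _ => norm_nonneg _
  have hI1 : 0 ≤ I1 := integral_nonneg fun _ => norm_nonneg _
  have hI2 : 0 ≤ I2 := integral_nonneg fun t => norm_nonneg (fderiv ℝ (fderiv ℝ φ) t)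
  have q1 : 0 < 1 - (2 : ℝ) ^ (-α) := by linarith [qlt h0]
  set A := R ^ α * (2 * I1 + I2) with hA
  have hA0 : 0 ≤ A := by positivity
  set K := 2 * I0 + R ^ α * I1 * (1 - (2 : ℝ) ^ (-α))⁻¹ + K0 * A with hKd
  have k1 : 0 ≤ R ^ α * I1 * (1 - (2 : ℝ) ^ (-α))⁻¹ := by positivity
  have k2 : 0 ≤ K0 * A := by positivity
  refine ⟨K, by positivity, fun m => ?_⟩
  induction m with
  | zero =>
    intro E _ _ _ f C hcs hf
    have hC := hf.nonneg
    have hb := GJ_bound h0 hR0 hφ hR hf.nonneg (hf.continuous h0 h1) (CH_zero_iff.1 hf).2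
    have hl := GJ_lip h0 hR0 hφ hR hf.nonneg (hf.continuous h0 h1) (CH_zero_iff.1 hf).2
    rw [CH_succ_iff]
    refine ⟨fun z => (TT_norm hφ hR hf.bound z).trans ?_,
      fun z => (TT_deriv h0 h1 hR0 hφ hR hf z).1.differentiableAt, ?_⟩
    · gcongr; linarith
    · rw [show fderiv ℝ (TT φ f) = fun z => ∑' j, GJ φ f j z from
        funext fun z => (TT_deriv h0 h1 hR0 hφ hR hf z).1.fderiv, CH_zero_iff]
      constructor
      · intro z
        refine (tsum_of_norm_bounded ((hasSum_geometric_of_lt_one (r := (2 : ℝ) ^ (-α))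
          (by positivity) (qlt h0)).mul_left _) fun j => hb j z).trans ?_
        calc _ = R ^ α * I1 * (1 - (2 : ℝ) ^ (-α))⁻¹ * C := by ring
          _ ≤ _ := by gcongr; linarith
      · intro z w
        have sz := (TT_deriv h0 h1 hR0 hφ hR hf z).2
        have sw := (TT_deriv h0 h1 hR0 hφ hR hf w).2
        rw [← sz.tsum_sub sw]
        have hq : (0 : ℝ) ≤ (2 : ℝ) ^ (-α) := by positivity
        have b1 : ∀ j, ‖GJ φ f j z - GJ φ f j w‖ ≤ A * C * ((2 : ℝ) ^ (-α)) ^ j := by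
          intro j
          refine (norm_sub_le _ _).trans ((add_le_add (hb j z) (hb j w)).trans ?_)
          have : 0 ≤ R ^ α * I2 * C * ((2 : ℝ) ^ (-α)) ^ j := by positivity
          rw [hA]; linarith
        have b2 : ∀ j, ‖GJ φ f j z - GJ φ f j w‖ ≤ A * C * (2 * (2 : ℝ) ^ (-α)) ^ j * ‖z - w‖ := by
          intro j
          refine (hl j z w).trans ?_
          gcongr
          rw [hA]; gcongr; linarith
        have sn : Summable (fun j => ‖GJ φ f j z - GJ φ f j w‖) :=
          Summable.of_nonneg_of_le (fun _ => norm_nonneg _) b1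
            ((summable_geometric_of_lt_one hq (qlt h0)).mul_left _)
        refine (norm_tsum_le_tsum_norm sn).trans ?_
        refine (hK _ (A * C) ‖z - w‖ (by positivity) (norm_nonneg _) (fun _ => norm_nonneg _) b1
          b2).trans ?_
        rw [← mul_assoc]
        gcongr
        linarith
  | succ m ih =>
    intro E _ _ _ f C hcs hf
    have hC := hf.nonneg
    have hder : ∀ z, HasFDerivAt (TT φ f) (TT φ (fderiv ℝ f) z) z := by
      intro z
      refine hasFDerivAt_tsum (u := fun j => I0 * C * (2⁻¹) ^ j)
        ((summable_geometric_of_lt_one (by norm_num) (by norm_num)).mul_left _) (fun j z => ?_)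
        (fun j z => FJ_bound hφ hR hf.fd.bound j z) (TT_hasSum hφ hR hf.bound 0) z
      have hc1 : ContDiff ℝ 1 f := (hf.contDiff h0 h1).of_le (by exact_mod_cast Nat.le_add_left 1 m)
      exact hcs.hasFDerivAt_convolution_right (ContinuousLinearMap.lsmul ℝ ℝ : ℝ →L[ℝ] E →L[ℝ] E)
        (kerJ_contDiff hφ j).continuous.locallyIntegrable hc1 z
    rw [CH_succ_iff]
    refine ⟨fun z => (TT_norm hφ hR hf.bound z).trans ?_, fun z => (hder z).differentiableAt, ?_⟩
    · gcongr; linarith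
    · rw [show fderiv ℝ (TT φ f) = TT φ (fderiv ℝ f) from funext fun z => (hder z).fderiv]
      exact ih (hcs.fderiv ℝ) hf.fd

end potential

noncomputable section

/-- radial cutoff -/
def gcut (t : ℝ) : ℝ := 1 - Real.smoothTransition (t / 16 - 1)

def bcut (t : ℝ) : ℝ := (gcut t - gcut (4 * t)) / t

def ker1 (z : ℂ) : ℝ := bcut (Complex.normSq z) * z.im
def ker2 (z : ℂ) : ℝ := bcut (Complex.normSq z) * z.re
def thet (z : ℂ) : ℝ := 2 * deriv gcut (Complex.normSq z)

end

section kernels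

theorem gcut_contDiff {n : ℕ∞} : ContDiff ℝ n gcut := by
  unfold gcut
  exact contDiff_const.sub (Real.smoothTransition.contDiff.comp (by fun_prop))

theorem gcut_one {t : ℝ} (h : t ≤ 16) : gcut t = 1 := by
  unfold gcut
  rw [Real.smoothTransition.zero_of_nonpos (by linarith)]; ring

theorem gcut_zero {t : ℝ} (h : 32 ≤ t) : gcut t = 0 := by
  unfold gcut
  rw [Real.smoothTransition.one_of_one_le (by linarith)]; ring

theorem bcut_zero_left {t : ℝ} (h : t ≤ 4) : bcut t = 0 := by
  unfold bcut
  rw [gcut_one (by linarith), gcut_one (by linarith)]; simp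

theorem bcut_zero_right {t : ℝ} (h : 32 ≤ t) : bcut t = 0 := by
  unfold bcut
  rw [gcut_zero (by linarith), gcut_zero (by linarith)]; simp

theorem bcut_contDiff {n : ℕ∞} : ContDiff ℝ n bcut := by
  rw [contDiff_iff_contDiffAt]
  intro t
  by_cases h : t < 4
  · have : bcut =ᶠ[𝓝 t] fun _ => 0 := by
      filter_upwards [gt_mem_nhds h] with s hs
      exact bcut_zero_left hs.le
    exact contDiffAt_const.congr_of_eventuallyEq this
  · unfold bcut
    have : ContDiff ℝ n (fun t => gcut t - gcut (4 * t)) :=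
      gcut_contDiff.sub (gcut_contDiff.comp (by fun_prop))
    exact this.contDiffAt.div contDiffAt_id (by linarith)

theorem tb_eq (t : ℝ) : t * bcut t = gcut t - gcut (4 * t) := by
  unfold bcut
  by_cases h : t = 0
  · simp [h]
  · field_simp

theorem tb_deriv (t : ℝ) : bcut t + t * deriv bcut t = deriv gcut t - 4 * deriv gcut (4 * t) := by
  have hb : HasDerivAt bcut (deriv bcut t) t :=
    ((bcut_contDiff (n := 1)).differentiable (by norm_num) t).hasDerivAt
  have hg : ∀ s, HasDerivAt gcut (deriv gcut s) s := fun s =>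
    ((gcut_contDiff (n := 1)).differentiable (by norm_num) s).hasDerivAt
  have h1 := (hasDerivAt_id t).mul hb
  have h2 := (hg t).sub ((hg (4 * t)).comp t ((hasDerivAt_id t).const_mul 4))
  have e : (id * bcut : ℝ → ℝ) = (gcut - gcut ∘ fun y => 4 * id y) := funext tb_eq
  rw [e] at h1
  have := h1.unique h2
  simp only [id] at this
  linarith

theorem normSq_contDiff {n : ℕ∞} : ContDiff ℝ n (fun z : ℂ => Complex.normSq z) := by
  simp only [Complex.normSq_apply]
  exact (Complex.reCLM.contDiff.mul Complex.reCLM.contDiff).add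
    (Complex.imCLM.contDiff.mul Complex.imCLM.contDiff)

theorem ker1_contDiff {n : ℕ∞} : ContDiff ℝ n ker1 :=
  (bcut_contDiff.comp normSq_contDiff).mul Complex.imCLM.contDiff

theorem ker2_contDiff {n : ℕ∞} : ContDiff ℝ n ker2 :=
  (bcut_contDiff.comp normSq_contDiff).mul Complex.reCLM.contDiff

theorem normSq_big {t : ℂ} (h : 6 < ‖t‖) : 32 ≤ Complex.normSq t := by
  rw [Complex.normSq_eq_norm_sq]; nlinarith

theorem ker1_zero (t : ℂ) (h : 6 < ‖t‖) : ker1 t = 0 := by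
  unfold ker1; rw [bcut_zero_right (normSq_big h)]; simp

theorem ker2_zero (t : ℂ) (h : 6 < ‖t‖) : ker2 t = 0 := by
  unfold ker2; rw [bcut_zero_right (normSq_big h)]; simp

theorem normSq_hasFDerivAt (z : ℂ) : HasFDerivAt (fun z : ℂ => Complex.normSq z)
    ((2 * z.re) • Complex.reCLM + (2 * z.im) • Complex.imCLM) z := by
  have e : (fun z : ℂ => Complex.normSq z) = fun z => z.re * z.re + z.im * z.im := by
    ext z; exact Complex.normSq_apply z
  rw [e]
  have h1 : HasFDerivAt (fun z : ℂ => z.re) Complex.reCLM z := Complex.reCLM.hasFDerivAt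
  have h2 : HasFDerivAt (fun z : ℂ => z.im) Complex.imCLM z := Complex.imCLM.hasFDerivAt
  refine ((h1.mul h1).add (h2.mul h2)).congr_fderiv ?_
  ext v; simp; ring

theorem bN_hasFDerivAt (z : ℂ) : HasFDerivAt (fun z : ℂ => bcut (Complex.normSq z))
    (deriv bcut (Complex.normSq z) • ((2 * z.re) • Complex.reCLM + (2 * z.im) • Complex.imCLM)) z :=
  HasDerivAt.comp_hasFDerivAt z
    ((bcut_contDiff (n := 1)).differentiable (by norm_num) _).hasDerivAt (normSq_hasFDerivAt z)

theorem ker1_fderiv (z v : ℂ) : fderiv ℝ ker1 z v =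
    bcut (Complex.normSq z) * v.im +
      z.im * (deriv bcut (Complex.normSq z) * (2 * z.re * v.re + 2 * z.im * v.im)) := by
  have h2 : HasFDerivAt (fun z : ℂ => z.im) Complex.imCLM z := Complex.imCLM.hasFDerivAt
  have : HasFDerivAt ker1 _ z := (bN_hasFDerivAt z).mul h2
  rw [this.fderiv]
  simp
  ring

theorem ker2_fderiv (z v : ℂ) : fderiv ℝ ker2 z v =
    bcut (Complex.normSq z) * v.re +
      z.re * (deriv bcut (Complex.normSq z) * (2 * z.re * v.re + 2 * z.im * v.im)) := by
  have h2 : HasFDerivAt (fun z : ℂ => z.re) Complex.reCLM z := Complex.reCLM.hasFDerivAt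
  have : HasFDerivAt ker2 _ z := (bN_hasFDerivAt z).mul h2
  rw [this.fderiv]
  simp
  ring

theorem ker_id1 (z : ℂ) : fderiv ℝ ker1 z I + fderiv ℝ ker2 z 1 =
    thet z - 4 * thet ((2 : ℝ) • z) := by
  have h := tb_deriv (Complex.normSq z)
  rw [ker1_fderiv, ker2_fderiv]
  unfold thet
  have e : Complex.normSq ((2 : ℝ) • z) = 4 * Complex.normSq z := by
    simp [Complex.normSq_apply]; ring
  rw [e]
  have e2 : Complex.normSq z = z.re * z.re + z.im * z.im := Complex.normSq_apply z
  have : z.im * (deriv bcut (Complex.normSq z) * (2 * z.im)) + z.re * (deriv bcut (Complex.normSq z) * (2 * z.re))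
     = 2 * (Complex.normSq z * deriv bcut (Complex.normSq z)) := by rw [e2]; ring
  simp
  linarith

theorem ker_id2 (z : ℂ) : fderiv ℝ ker2 z I - fderiv ℝ ker1 z 1 = 0 := by
  rw [ker1_fderiv, ker2_fderiv]
  simp; ring

theorem thet_cont : Continuous thet := by
  unfold thet
  exact continuous_const.mul (((gcut_contDiff (n := 1)).continuous_deriv (by norm_num)).comp
    (normSq_contDiff (n := 0)).continuous)

theorem thet_zero_in {t : ℂ} (h : ‖t‖ < 4) : thet t = 0 := by
  unfold thet
  have : gcut =ᶠ[𝓝 (Complex.normSq t)] fun _ => 1 := by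
    have : Complex.normSq t < 16 := by
      rw [Complex.normSq_eq_norm_sq]; nlinarith [norm_nonneg t]
    filter_upwards [gt_mem_nhds this] with s hs
    exact gcut_one hs.le
  rw [this.deriv_eq]; simp

theorem thet_zero (t : ℂ) (h : 6 < ‖t‖) : thet t = 0 := by
  unfold thet
  have : gcut =ᶠ[𝓝 (Complex.normSq t)] fun _ => 0 := by
    have : 32 < Complex.normSq t := by
      rw [Complex.normSq_eq_norm_sq]; nlinarith [norm_nonneg t]
    filter_upwards [lt_mem_nhds this] with s hs
    exact gcut_zero hs.le
  rw [this.deriv_eq]; simp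

theorem gcut_antitone : Antitone gcut := by
  intro s t h
  unfold gcut
  have := Real.smoothTransition.monotone (show s / 16 - 1 ≤ t / 16 - 1 by linarith)
  linarith

theorem thet_int : 0 < -∫ t, thet t := by
  rw [← integral_neg]
  have hn : ∃ z, thet z ≠ 0 := by
    by_contra! hc
    have : ∀ t, deriv gcut t = 0 := by
      intro t
      by_cases ht : 0 ≤ t
      · have := hc (Real.sqrt t : ℂ)
        unfold thet at this
        rw [Complex.normSq_ofReal, Real.mul_self_sqrt ht] at this
        linarith
      · have e : gcut =ᶠ[𝓝 t] fun _ => 1 := by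
          filter_upwards [gt_mem_nhds (show t < 16 by linarith)] with s hs
          exact gcut_one hs.le
        rw [e.deriv_eq]; simp
    have := is_const_of_deriv_eq_zero ((gcut_contDiff (n := 1)).differentiable (by norm_num)) this 0 40
    rw [gcut_one (by norm_num), gcut_zero (by norm_num)] at this
    norm_num at this
  obtain ⟨z, hz⟩ := hn
  refine thet_cont.neg.integral_pos_of_hasCompactSupport_nonneg_nonzero ?_ ?_ (x := z) ?_
  · exact hcs_of_zero (R := 6) fun t h => by simp [thet_zero t h]
  · intro z
    have := gcut_antitone.deriv_nonpos (x := Complex.normSq z)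
    simp [thet]; linarith
  · simpa using hz

end kernels

noncomputable section

/-- normalising constant -/
def cth : ℝ := -∫ t, thet t

/-- right inverse of the constant coefficient operator on the unit disc -/
def Tpo {E : Type} [NormedAddCommGroup E] [NormedSpace ℝ E] (J0 : E →L[ℝ] E) (f : ℂ → E) (z : ℂ) : E :=
  cth⁻¹ • (TT ker1 f z + J0 (TT ker2 f z))

def HH {E : Type} [NormedAddCommGroup E] [NormedSpace ℝ E] (f : ℂ → E) (j : ℕ) (z : ℂ) : E :=
  convolution (fun t => (4 ^ j : ℝ) • thet ((2 ^ j : ℝ) • t)) f (ContinuousLinearMap.lsmul ℝ ℝ) volume z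

end

section operator

set_option linter.unusedSectionVars false

variable {E : Type} [NormedAddCommGroup E] [NormedSpace ℝ E] [CompleteSpace E]
variable {φ : ℂ → ℝ} {R : ℝ} {α : ℝ}

theorem ker_int (κ : ℂ → ℝ) (hκ : Continuous κ) (hcs : HasCompactSupport κ) {f : ℂ → E}
    (hf : Continuous f) (z : ℂ) : Integrable (fun t => κ t • f (z - t)) := by
  refine Continuous.integrable_of_hasCompactSupport (by fun_prop) ?_
  exact hcs.mono fun t ht h => ht (by simp [h])

theorem GJ_apply (hφ : ContDiff ℝ 3 φ) (hR : ∀ t, R < ‖t‖ → φ t = 0) {f : ℂ → E}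
    (hf : Continuous f) (j : ℕ) (z v : ℂ) :
    GJ φ f j z v = ∫ t, (fderiv ℝ (kerJ φ j) t v) • f (z - t) := by
  unfold GJ
  rw [convolution_def, ContinuousLinearMap.integral_apply]
  · rfl
  · have hc : Continuous (fderiv ℝ (kerJ φ j)) := (kerJ_contDiff hφ j).continuous_fderiv (by norm_num)
    refine Continuous.integrable_of_hasCompactSupport (by fun_prop) ?_
    exact ((kerJ_hcs hR j).fderiv ℝ).mono fun t ht h => ht (by simp [h])

theorem fderiv_kerJ_hcs (hφ : ContDiff ℝ 3 φ) (hR : ∀ t, R < ‖t‖ → φ t = 0) (j : ℕ) (v : ℂ) :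
    Continuous (fun t => fderiv ℝ (kerJ φ j) t v) ∧
    HasCompactSupport (fun t => fderiv ℝ (kerJ φ j) t v) := by
  constructor
  · have hc : Continuous (fderiv ℝ (kerJ φ j)) := (kerJ_contDiff hφ j).continuous_fderiv (by norm_num)
    fun_prop
  · exact ((kerJ_hcs hR j).fderiv ℝ).mono fun t ht h => ht (by simp [h])

theorem thet_scaled_hcs (j : ℕ) : HasCompactSupport (fun t => (4 ^ j : ℝ) • thet ((2 ^ j : ℝ) • t)) := by
  refine hcs_of_zero (R := (2 ^ j)⁻¹ * 6) fun t ht => ?_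
  rw [thet_zero, smul_zero]
  rw [inv_mul_lt_iff₀ (by positivity)] at ht
  rwa [norm_smul, Real.norm_of_nonneg (by positivity)]

theorem thet_scaled_cont (j : ℕ) : Continuous (fun t => (4 ^ j : ℝ) • thet ((2 ^ j : ℝ) • t)) := by
  have := thet_cont
  fun_prop

theorem GJ_tel {f : ℂ → E} (hf : Continuous f) (j : ℕ) (z : ℂ) :
    GJ ker1 f j z I + GJ ker2 f j z 1 = HH f j z - HH f (j + 1) z := by
  have i1 := fderiv_kerJ_hcs ker1_contDiff ker1_zero j I
  have i2 := fderiv_kerJ_hcs ker2_contDiff ker2_zero j 1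
  rw [GJ_apply ker1_contDiff ker1_zero hf, GJ_apply ker2_contDiff ker2_zero hf, HH, HH,
    convolution_def, convolution_def, ← integral_add (ker_int _ i1.1 i1.2 hf z) (ker_int _ i2.1 i2.2 hf z)]
  simp only [ContinuousLinearMap.lsmul_apply]
  rw [← integral_sub (ker_int _ (thet_scaled_cont j) (thet_scaled_hcs j) hf z)
    (ker_int _ (thet_scaled_cont (j + 1)) (thet_scaled_hcs (j + 1)) hf z)]
  congr 1
  ext t
  rw [← add_smul, ← sub_smul, fderiv_kerJ ker1_contDiff, fderiv_kerJ ker2_contDiff]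
  congr 1
  have := ker_id1 ((2 ^ j : ℝ) • t)
  simp only [smul_apply, smul_eq_mul]
  rw [← mul_add, this, smul_smul, pow_succ, pow_succ, mul_comm (2 : ℝ) (2 ^ j)]
  ring

theorem GJ_anti {f : ℂ → E} (hf : Continuous f) (j : ℕ) (z : ℂ) :
    GJ ker2 f j z I - GJ ker1 f j z 1 = 0 := by
  have i1 := fderiv_kerJ_hcs ker1_contDiff ker1_zero j 1
  have i2 := fderiv_kerJ_hcs ker2_contDiff ker2_zero j I
  rw [GJ_apply ker1_contDiff ker1_zero hf, GJ_apply ker2_contDiff ker2_zero hf,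
    ← integral_sub (ker_int _ i2.1 i2.2 hf z) (ker_int _ i1.1 i1.2 hf z)]
  rw [← integral_zero ℂ E]
  congr 1
  ext t
  rw [← sub_smul, fderiv_kerJ ker1_contDiff, fderiv_kerJ ker2_contDiff]
  have := ker_id2 ((2 ^ j : ℝ) • t)
  simp only [smul_apply, smul_eq_mul]
  rw [← mul_sub, this]
  simp

theorem HH_zero {f : ℂ → E} (hs : ∀ z, 2 < ‖z‖ → f z = 0) {z : ℂ} (hz : ‖z‖ ≤ 1) : HH f 0 z = 0 := by
  unfold HH
  rw [convolution_def, ← integral_zero ℂ E]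
  congr 1
  ext t
  by_cases h : ‖t‖ < 4
  · simp [thet_zero_in h]
  · rw [hs (z - t)]
    · simp
    · have := norm_sub_norm_le t z
      rw [norm_sub_rev] at this
      linarith

theorem HH_tendsto (h0 : 0 < α) {f : ℂ → E} {C : ℝ} (hC : 0 ≤ C) (hfc : Continuous f)
    (hf : ∀ z w, ‖f z - f w‖ ≤ C * ‖z - w‖ ^ α) (z : ℂ) :
    Tendsto (fun j => HH f j z) atTop (𝓝 ((-cth) • f z)) := by
  have hb : ∀ j, ‖HH f j z - (-cth) • f z‖ ≤
      6 ^ α * (∫ t, ‖thet t‖) * C * ((2 : ℝ) ^ (-α)) ^ j := by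
    intro j
    have e : HH f j z - (-cth) • f z = (convolution (fun t => (4 ^ j : ℝ) • thet ((2 ^ j : ℝ) • t))
        (fun w => f w - f z) (ContinuousLinearMap.lsmul ℝ ℝ : ℝ →L[ℝ] E →L[ℝ] E) volume) z := by
      have e2 : (-cth) • f z = ∫ t, ((4 ^ j : ℝ) • thet ((2 ^ j : ℝ) • t)) • f z := by
        rw [integral_smul_const, integral_smul, Measure.integral_comp_smul volume thet,
          Complex.finrank_real_complex]
        congr 1
        have : ((2 : ℝ) ^ j) ^ 2 = 4 ^ j := by rw [← pow_mul, mul_comm, pow_mul]; norm_num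
        rw [this, abs_of_pos (by positivity), smul_smul, mul_inv_cancel₀ (by positivity)]
        simp [cth]
      rw [e2, HH, convolution_def, convolution_def]
      simp only [ContinuousLinearMap.lsmul_apply]
      rw [← integral_sub (ker_int _ (thet_scaled_cont j) (thet_scaled_hcs j) hfc z)
        (ker_int _ (thet_scaled_cont j) (thet_scaled_hcs j) continuous_const z)]
      simp only [smul_sub]
    rw [e]
    have := conv_bound (ContinuousLinearMap.lsmul ℝ ℝ : ℝ →L[ℝ] E →L[ℝ] E)
      thet_cont thet_zero j (4 ^ j)
      (g := fun w => f w - f z) z (B := C * ((2 ^ j)⁻¹ * 6) ^ α) (fun t ht => by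
        refine (hf _ _).trans ?_
        gcongr
        simpa using ht)
    refine this.trans ?_
    have h1 := lsmul_norm_le (E := E)
    have h3 : (0 : ℝ) ≤ ∫ t, ‖thet t‖ := integral_nonneg fun _ => norm_nonneg _
    calc _ ≤ 1 * |4 ^ j| * (4 ^ j)⁻¹ * (∫ t, ‖thet t‖) * (C * ((2 ^ j)⁻¹ * 6) ^ α) := by gcongr
      _ = _ := by
        rw [abs_of_pos (by positivity), rpow_aux (by norm_num)]
        field_simp
  rw [tendsto_iff_norm_sub_tendsto_zero]
  refine squeeze_zero (fun _ => norm_nonneg _) hb ?_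
  have := (tendsto_pow_atTop_nhds_zero_of_lt_one (r := (2 : ℝ) ^ (-α)) (by positivity) (qlt h0)).const_mul
    (6 ^ α * (∫ t, ‖thet t‖) * C)
  simpa using this

theorem Tpo_D0 (h0 : 0 < α) (h1 : α < 1) {f : ℂ → E} {C : ℝ} (hf : CH α 0 C f)
    (hs : ∀ z, 2 < ‖z‖ → f z = 0) {J0 : E →L[ℝ] E} (hJ : ∀ x, J0 (J0 x) = - x) {z : ℂ} (hz : ‖z‖ ≤ 1) :
    fderiv ℝ (Tpo J0 f) z I - J0 (fderiv ℝ (Tpo J0 f) z 1) = f z := by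
  have hfc := hf.continuous h0 h1
  obtain ⟨d1, s1⟩ := TT_deriv h0 h1 (R := 6) (by norm_num) ker1_contDiff ker1_zero hf z
  obtain ⟨d2, s2⟩ := TT_deriv h0 h1 (R := 6) (by norm_num) ker2_contDiff ker2_zero hf z
  have hT : HasFDerivAt (Tpo J0 f) _ z := (d1.add (J0.hasFDerivAt.comp z d2)).const_smul cth⁻¹
  rw [hT.fderiv]
  set A := ∑' j, GJ ker1 f j z
  set B := ∑' j, GJ ker2 f j z
  have hA : ∀ v, HasSum (fun j => GJ ker1 f j z v) (A v) := fun v =>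
    (ContinuousLinearMap.apply ℝ E v).hasSum s1.hasSum
  have hB : ∀ v, HasSum (fun j => GJ ker2 f j z v) (B v) := fun v =>
    (ContinuousLinearMap.apply ℝ E v).hasSum s2.hasSum
  have k1 : A I + B 1 = cth • f z := by
    have t1 := ((hA I).add (hB 1)).tendsto_sum_nat
    simp only [GJ_tel hfc] at t1
    simp only [Finset.sum_range_sub', HH_zero hs hz] at t1
    have t2 := (HH_tendsto h0 hf.nonneg hfc (CH_zero_iff.1 hf).2 z).const_sub 0
    rw [tendsto_nhds_unique t1 t2]
    simp
  have k2 : B I - A 1 = 0 := by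
    have t1 := (hB I).sub (hA 1)
    simp only [GJ_anti hfc] at t1
    exact t1.unique hasSum_zero
  have hc : cth ≠ 0 := (show 0 < cth from thet_int).ne'
  have : B I = A 1 := sub_eq_zero.1 k2
  simp only [smul_apply, add_apply,
    ContinuousLinearMap.comp_apply, map_smul, map_add, hJ, this]
  rw [← smul_sub, show A I + J0 (A 1) - (J0 (A 1) + -B 1) = A I + B 1 by abel, k1, smul_smul,
    inv_mul_cancel₀ hc, one_smul]

theorem Tpo_CH (h0 : 0 < α) (h1 : α < 1) (J0 : E →L[ℝ] E) : ∃ K : ℝ, 0 ≤ K ∧ ∀ (m : ℕ)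
    {f : ℂ → E} {C : ℝ}, HasCompactSupport f → CH α m C f → CH α (m + 1) (K * C) (Tpo J0 f) := by
  obtain ⟨K1, hK1, h11⟩ := TT_CH h0 h1 (R := 6) (by norm_num) ker1_contDiff ker1_zero
  obtain ⟨K2, hK2, h22⟩ := TT_CH h0 h1 (R := 6) (by norm_num) ker2_contDiff ker2_zero
  refine ⟨‖(cth⁻¹ • ContinuousLinearMap.id ℝ E)‖ * (K1 + ‖J0‖ * K2), by positivity, ?_⟩
  intro m f C hcs hf
  have := ((h11 m hcs hf).add ((h22 m hcs hf).clm J0)).clm (cth⁻¹ • ContinuousLinearMap.id ℝ E)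
  have e : ‖(cth⁻¹ • ContinuousLinearMap.id ℝ E)‖ * (K1 + ‖J0‖ * K2) * C =
    ‖(cth⁻¹ • ContinuousLinearMap.id ℝ E)‖ * (K1 * C + ‖J0‖ * (K2 * C)) := by ring
  rw [e]
  exact this

theorem TT_sub (hφ : ContDiff ℝ 3 φ) (hR : ∀ t, R < ‖t‖ → φ t = 0) {f g : ℂ → E} {C C' : ℝ}
    (hf : ∀ z, ‖f z‖ ≤ C) (hfc : Continuous f) (hg : ∀ z, ‖g z‖ ≤ C') (hgc : Continuous g) (z : ℂ) :
    TT φ (fun z => f z - g z) z = TT φ f z - TT φ g z := by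
  unfold TT
  rw [← (TT_hasSum hφ hR hf z).tsum_sub (TT_hasSum hφ hR hg z)]
  congr 1
  ext j
  unfold FJ
  simp only [convolution_def, ContinuousLinearMap.lsmul_apply]
  rw [← integral_sub (ker_int _ (kerJ_contDiff hφ j).continuous (kerJ_hcs hR j) hfc z)
        (ker_int _ (kerJ_contDiff hφ j).continuous (kerJ_hcs hR j) hgc z)]
  simp only [smul_sub]

theorem Tpo_sub (h0 : 0 < α) (h1 : α < 1) {m m' : ℕ} {f g : ℂ → E} {C C' : ℝ} (hf : CH α m C f) (hg : CH α m' C' g)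
    (J0 : E →L[ℝ] E) :
    Tpo J0 (fun z => f z - g z) = fun z => Tpo J0 f z - Tpo J0 g z := by
  ext z
  unfold Tpo
  rw [TT_sub ker1_contDiff ker1_zero hf.bound (hf.continuous h0 h1) hg.bound (hg.continuous h0 h1),
    TT_sub ker2_contDiff ker2_zero hf.bound (hf.continuous h0 h1) hg.bound (hg.continuous h0 h1),
    ← smul_sub, map_sub]
  congr 1
  abel

end operator

section limits

variable {α : ℝ} {X E : Type} [NormedAddCommGroup X] [NormedSpace ℝ X]
    [NormedAddCommGroup E] [NormedSpace ℝ E]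

theorem interp {g : X → E} (hg : Differentiable ℝ g) {η H : ℝ} (hα : 0 < α)
    (hb : ∀ x, ‖g x‖ ≤ η) (hH0 : 0 ≤ H)
    (hH : ∀ x y, ‖fderiv ℝ g x - fderiv ℝ g y‖ ≤ H * ‖x - y‖ ^ α) {t : ℝ} (ht : 0 < t) (x : X) :
    ‖fderiv ℝ g x‖ ≤ 2 * η / t + H * t ^ α := by
  have hη : 0 ≤ η := (norm_nonneg _).trans (hb x)
  refine ContinuousLinearMap.opNorm_le_of_unit_norm (by positivity) fun v hv => ?_
  have key : ‖g (x + t • v) - g x - fderiv ℝ g x (x + t • v - x)‖ ≤ H * t ^ α * ‖x + t • v - x‖ := by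
    refine Convex.norm_image_sub_le_of_norm_fderiv_le' (𝕜 := ℝ) (s := closedBall x t)
      (fun z _ => hg z) (fun z hz => ?_) (convex_closedBall x t) (mem_closedBall_self ht.le) ?_
    · refine (hH z x).trans ?_
      rw [mem_closedBall, dist_eq_norm] at hz
      gcongr
    · simp [norm_smul, hv, abs_of_pos ht]
  rw [add_sub_cancel_left, norm_smul, hv, Real.norm_of_nonneg ht.le, mul_one, map_smul] at key
  have h2 : ‖t • fderiv ℝ g x v‖ ≤ H * t ^ α * t + 2 * η := by
    have : t • fderiv ℝ g x v = (g (x + t • v) - g x) - (g (x + t • v) - g x - t • fderiv ℝ g x v) := by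
      abel
    rw [this]
    refine (norm_sub_le _ _).trans ?_
    have := (norm_sub_le (g (x + t • v)) (g x)).trans (add_le_add (hb _) (hb _))
    linarith
  rw [norm_smul, Real.norm_of_nonneg ht.le] at h2
  have h3 : t * ‖fderiv ℝ g x v‖ ≤ t * (2 * η / t + H * t ^ α) := by
    refine h2.trans (le_of_eq ?_)
    field_simp
    ring
  exact le_of_mul_le_mul_left h3 ht

theorem CH_limit_fderiv (h0 : 0 < α) (h1 : α < 1) [CompleteSpace E] {m : ℕ} {C : ℝ} {f : ℕ → X → E}
    {g : X → E} (hf : ∀ j, CH α (m + 1) C (f j)) (hl : TendstoUniformly f g atTop) :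
    Differentiable ℝ g ∧ TendstoUniformly (fun j => fderiv ℝ (f j)) (fderiv ℝ g) atTop := by
  have hC : 0 ≤ C := (hf 0).nonneg
  have hcau : UniformCauchySeqOn (fun j => fderiv ℝ (f j)) atTop univ := by
    rw [Metric.uniformCauchySeqOn_iff]
    intro ε hε
    obtain ⟨t, ht, htε⟩ : ∃ t : ℝ, 0 < t ∧ 2 * (2 * C) * t ^ α < ε / 2 := by
      have h2 : Tendsto (fun t : ℝ => 2 * (2 * C) * t ^ α) (𝓝 0) (𝓝 (2 * (2 * C) * 0 ^ α)) := by
        apply Continuous.tendsto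
        exact continuous_const.mul (continuous_id.rpow_const (fun _ => Or.inr h0.le))
      simp only [Real.zero_rpow h0.ne', mul_zero] at h2
      have h3 := (h2.eventually (gt_mem_nhds (half_pos hε)))
      obtain ⟨d, hd, hd2⟩ := Metric.eventually_nhds_iff.1 h3
      refine ⟨d / 2, by positivity, hd2 ?_⟩
      simp [abs_of_pos hd]; linarith
    have hl2 := Metric.tendstoUniformly_iff.1 hl (ε * t / 16) (by positivity)
    obtain ⟨N, hN⟩ := eventually_atTop.1 hl2
    refine ⟨N, fun i hi j hj x _ => ?_⟩
    have hs := (hf i).sub (hf j)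
    have hb : ∀ x, ‖f i x - f j x‖ ≤ ε * t / 8 := by
      intro x
      have a1 := hN i hi x
      have a2 := hN j hj x
      rw [← dist_eq_norm]
      have := dist_triangle_left (f i x) (f j x) (g x)
      linarith
    have := interp hs.diff h0 hb (by positivity : 0 ≤ 2 * (2 * C))
      (fun x y => (hs.fd.holder h0 h1 x y).trans (by rw [two_mul C])) ht x
    have e : fderiv ℝ (fun x => f i x - f j x) x = fderiv ℝ (f i) x - fderiv ℝ (f j) x :=
      fderiv_fun_sub ((hf i).diff x) ((hf j).diff x)
    rw [e] at this
    rw [dist_eq_norm]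
    have e2 : 2 * (ε * t / 8) / t = ε / 4 := by field_simp; ring
    linarith
  have hlim : ∀ x, ∃ G, Tendsto (fun j => fderiv ℝ (f j) x) atTop (𝓝 G) := fun x =>
    cauchySeq_tendsto_of_complete (hcau.cauchySeq (mem_univ x))
  choose G hG using hlim
  have hu : TendstoUniformly (fun j => fderiv ℝ (f j)) G atTop := by
    rw [← tendstoUniformlyOn_univ]
    exact hcau.tendstoUniformlyOn_of_tendsto fun x _ => hG x
  have hd : ∀ x, HasFDerivAt g (G x) x := fun x =>
    hasFDerivAt_of_tendstoUniformly hu (fun j x => ((hf j).diff x).hasFDerivAt)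
      (fun x => hl.tendsto_at x) x
  refine ⟨fun x => (hd x).differentiableAt, ?_⟩
  rwa [show fderiv ℝ g = G from funext fun x => (hd x).fderiv]

theorem CH_limit (h0 : 0 < α) (h1 : α < 1) (m : ℕ) : ∀ {E : Type} [NormedAddCommGroup E]
    [NormedSpace ℝ E] [CompleteSpace E] {C : ℝ} {f : ℕ → X → E}
    {g : X → E} (_ : ∀ j, CH α m C (f j)) (_ : TendstoUniformly f g atTop), CH α m C g := by
  induction m with
  | zero =>
    intro E _ _ _ C f g hf hl
    rw [CH_zero_iff]
    refine ⟨fun x => ?_, fun x y => ?_⟩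
    · exact le_of_tendsto (hl.tendsto_at x).norm (Eventually.of_forall fun j => (hf j).bound x)
    · exact le_of_tendsto ((hl.tendsto_at x).sub (hl.tendsto_at y)).norm
        (Eventually.of_forall fun j => (CH_zero_iff.1 (hf j)).2 x y)
  | succ m ih =>
    intro E _ _ _ C f g hf hl
    obtain ⟨hd, hl2⟩ := CH_limit_fderiv h0 h1 hf hl
    rw [CH_succ_iff]
    refine ⟨fun x => ?_, hd, ih (fun j => (hf j).fd) hl2⟩
    exact le_of_tendsto (hl.tendsto_at x).norm (Eventually.of_forall fun j => (hf j).bound x)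

theorem CH_of_bounds (h0 : 0 < α) (h1 : α < 1) {f : X → E} {C : ℝ} (hd : Differentiable ℝ f)
    (hb : ∀ x, ‖f x‖ ≤ C) (hb' : ∀ x, ‖fderiv ℝ f x‖ ≤ C) : CH α 0 (2 * C) f := by
  have hC : 0 ≤ C := (norm_nonneg _).trans (hb 0)
  rw [CH_zero_iff]
  refine ⟨fun x => (hb x).trans (by linarith), fun x y => ?_⟩
  have hlip : ‖f x - f y‖ ≤ C * ‖x - y‖ :=
    Convex.norm_image_sub_le_of_norm_fderiv_le (𝕜 := ℝ) (s := univ) (fun z _ => hd z)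
    (fun z _ => hb' z) convex_univ (mem_univ y) (mem_univ x)
  rcases le_total ‖x - y‖ 1 with hx | hx
  · have : ‖x - y‖ ≤ ‖x - y‖ ^ α := Real.self_le_rpow_of_le_one (norm_nonneg _) hx h1.le
    have h3 : C * ‖x - y‖ ≤ C * ‖x - y‖ ^ α := by gcongr
    have : 0 ≤ C * ‖x - y‖ ^ α := by positivity
    linarith
  · have : 1 ≤ ‖x - y‖ ^ α := Real.one_le_rpow hx h0.le
    have h2 : ‖f x - f y‖ ≤ 2 * C := (norm_sub_le _ _).trans (by linarith [hb x, hb y])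
    nlinarith

theorem CH_of_smooth (h0 : 0 < α) (h1 : α < 1) (m : ℕ) : ∀ {E : Type} [NormedAddCommGroup E]
    [NormedSpace ℝ E] {f : X → E}, ContDiff ℝ (⊤ : ℕ∞) f → HasCompactSupport f →
    ∃ M, CH α m M f := by
  induction m with
  | zero =>
    intro E _ _ f hf hcs
    obtain ⟨C1, hC1⟩ := hcs.exists_bound_of_continuous hf.continuous
    obtain ⟨C2, hC2⟩ := (hcs.fderiv ℝ).exists_bound_of_continuous (hf.continuous_fderiv (by simp))
    exact ⟨_, CH_of_bounds h0 h1 (C := max C1 C2) (hf.differentiable (by simp))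
      (fun x => (hC1 x).trans (le_max_left _ _)) (fun x => (hC2 x).trans (le_max_right _ _))⟩
  | succ m ih =>
    intro E _ _ f hf hcs
    obtain ⟨C1, hC1⟩ := hcs.exists_bound_of_continuous hf.continuous
    obtain ⟨C2, hC2⟩ := ih (f := fderiv ℝ f) (hf.fderiv_right (by simp)) (hcs.fderiv ℝ)
    refine ⟨max C1 C2, ?_⟩
    rw [CH_succ_iff]
    exact ⟨fun x => (hC1 x).trans (le_max_left _ _), hf.differentiable (by simp),
      hC2.mono (le_max_right _ _)⟩

theorem itF_succ (f : X → E) (m : ℕ) (x y : X) :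
    ‖iteratedFDeriv ℝ (m + 1) f x - iteratedFDeriv ℝ (m + 1) f y‖ =
    ‖iteratedFDeriv ℝ m (fderiv ℝ f) x - iteratedFDeriv ℝ m (fderiv ℝ f) y‖ := by
  have h := (continuousMultilinearCurryRightEquiv' ℝ m X E).symm.isometry.dist_eq
    (iteratedFDeriv ℝ m (fderiv ℝ f) x) (iteratedFDeriv ℝ m (fderiv ℝ f) y)
  rw [← dist_eq_norm, ← dist_eq_norm, iteratedFDeriv_succ_eq_comp_right,
    iteratedFDeriv_succ_eq_comp_right]
  exact h

theorem itF_zero (f : X → E) (x y : X) :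
    ‖iteratedFDeriv ℝ 0 f x - iteratedFDeriv ℝ 0 f y‖ = ‖f x - f y‖ := by
  rw [iteratedFDeriv_zero_eq_comp]
  simp only [Function.comp_apply]
  rw [← map_sub, LinearIsometryEquiv.norm_map]

theorem CH.itF {m : ℕ} {C : ℝ} {f : X → E} (h : CH α m C f) (x y : X) :
    ‖iteratedFDeriv ℝ m f x - iteratedFDeriv ℝ m f y‖ ≤ C * ‖x - y‖ ^ α := by
  induction m generalizing E with
  | zero => rw [itF_zero]; exact (CH_zero_iff.1 h).2 x y
  | succ m ih => rw [itF_succ]; exact ih h.fd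

theorem CHOn.mono' {m : ℕ} {C C' : ℝ} {s : Set X} {f : X → E} (h : CHOn α m s C f) (hC : C ≤ C') :
    CHOn α m s C' f := by
  induction m generalizing E with
  | zero =>
    exact ⟨fun x hx => (h.1 x hx).trans hC, fun x hx y hy => (h.2 x hx y hy).trans (by gcongr)⟩
  | succ m ih =>
    exact ⟨fun x hx => (h.1 x hx).trans hC, h.2.1, ih h.2.2⟩

theorem CHOn_of_contDiffOn {Ω K : Set X} (hΩ : IsOpen Ω) (hK : IsCompact K) (hKΩ : K ⊆ Ω) (m : ℕ) :
    ∀ {E : Type} [NormedAddCommGroup E] [NormedSpace ℝ E] {f : X → E} {C : ℝ}, ContDiffOn ℝ m f Ω →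
    (∀ x ∈ K, ∀ y ∈ K, ‖iteratedFDeriv ℝ m f x - iteratedFDeriv ℝ m f y‖ ≤ C * ‖x - y‖ ^ α) →
    ∃ M, CHOn α m K M f := by
  induction m with
  | zero =>
    intro E _ _ f C hf hH
    obtain ⟨M, hM⟩ := hK.exists_bound_of_continuousOn (hf.continuousOn.mono hKΩ)
    refine ⟨max M C, fun x hx => (hM x hx).trans (le_max_left _ _), fun x hx y hy => ?_⟩
    have := hH x hx y hy
    rw [itF_zero] at this
    exact this.trans (by gcongr; exact le_max_right _ _)
  | succ m ih =>
    intro E _ _ f C hf hH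
    obtain ⟨M, hM⟩ := hK.exists_bound_of_continuousOn (hf.continuousOn.mono hKΩ)
    have h2 : ContDiffOn ℝ m (fderiv ℝ f) Ω := hf.fderiv_of_isOpen hΩ (by simp)
    obtain ⟨M', hM'⟩ := ih h2 (C := C) (fun x hx y hy => by rw [← itF_succ]; exact hH x hx y hy)
    refine ⟨max M M', fun x hx => (hM x hx).trans (le_max_left _ _), fun x hx => ?_,
      hM'.mono' (le_max_right _ _)⟩
    exact (hf.contDiffAt (hΩ.mem_nhds (hKΩ hx))).differentiableAt (by simp)

end limits

noncomputable section

variable {E : Type} [NormedAddCommGroup E] [NormedSpace ℝ E]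

/-- derivative in the real direction -/
def DX (g : ℂ → E) : ℂ → E := fun ζ => fderiv ℝ g ζ 1

/-- the cutoff on the plane -/
def chiB : ContDiffBump (0 : ℂ) := ⟨3 / 2, 2, by norm_num, by norm_num⟩

/-- complex multiplication induced by `J0` -/
def psiJ (J0 : E →L[ℝ] E) (hJ : J0 * J0 = -1) : ℂ →L[ℝ] (E →L[ℝ] E) :=
  LinearMap.toContinuousLinearMap (Complex.lift ⟨J0, hJ⟩).toLinearMap

def PP (J0 : E →L[ℝ] E) (hJ : J0 * J0 = -1) (N : ℕ) (c : ℕ → E) (z : ℂ) : E :=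
  ∑ l ∈ Finset.range N, psiJ J0 hJ (z ^ l / (l.factorial : ℂ)) (c l)

def QQ (J0 : E →L[ℝ] E) (hJ : J0 * J0 = -1) (N : ℕ) (c : ℕ → E) (z : ℂ) : E :=
  ∑ l ∈ Finset.range N, (chiB z • psiJ J0 hJ (z ^ l / (l.factorial : ℂ))) (c l)

end

section jets

variable {α : ℝ} {E : Type} [NormedAddCommGroup E] [NormedSpace ℝ E]

theorem apply_one_norm : ‖(ContinuousLinearMap.apply ℝ E (1 : ℂ))‖ ≤ 1 := by
  refine ContinuousLinearMap.opNorm_le_bound _ zero_le_one fun f => ?_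
  simpa using f.le_opNorm 1

theorem CH.DX {m : ℕ} {C : ℝ} {f : ℂ → E} (h : CH α (m + 1) C f) : CH α m C (DX f) := by
  have := h.fd.clm (ContinuousLinearMap.apply ℝ E (1 : ℂ))
  have hC := h.nonneg
  refine CH.mono this ?_
  calc _ ≤ 1 * C := by gcongr; exact apply_one_norm
    _ = C := one_mul C

theorem CH.DXit {m : ℕ} {C : ℝ} (l : ℕ) : ∀ {f : ℂ → E} (_ : CH α (m + l) C f),
    CH α m C (_root_.DX^[l] f) := by
  induction l with
  | zero => intro f h; exact h
  | succ l ih => intro f h; rw [Function.iterate_succ_apply]; exact ih (CH.DX (m := m + l) h)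

theorem CH.jet {m : ℕ} {C : ℝ} {f : ℂ → E} (h : CH α m C f) {l : ℕ} (hl : l ≤ m) (z : ℂ) :
    ‖_root_.DX^[l] f z‖ ≤ C := by
  obtain ⟨m', rfl⟩ := Nat.exists_eq_add_of_le hl
  rw [add_comm] at h
  exact (h.DXit l).bound z

theorem DXit_add {C C' : ℝ} (l : ℕ) : ∀ {m : ℕ} {f g : ℂ → E} (_ : CH α m C f)
    (_ : CH α m C' g) (_ : l ≤ m), DX^[l] (fun z => f z + g z) = fun z => DX^[l] f z + DX^[l] g z := by
  induction l with
  | zero => intro m f g hf hg h; rfl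
  | succ l ih =>
    intro m f g hf hg h
    obtain ⟨m, rfl⟩ : ∃ m', m = m' + 1 := ⟨m - 1, by omega⟩
    simp only [Function.iterate_succ_apply]
    rw [← ih hf.DX hg.DX (by omega)]
    congr 1
    ext z
    simp [DX, fderiv_fun_add (hf.diff z) (hg.diff z)]

theorem DXit_sub {C C' : ℝ} (l : ℕ) : ∀ {m : ℕ} {f g : ℂ → E} (_ : CH α m C f)
    (_ : CH α m C' g) (_ : l ≤ m), DX^[l] (fun z => f z - g z) = fun z => DX^[l] f z - DX^[l] g z := by
  induction l with
  | zero => intro m f g hf hg h; rfl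
  | succ l ih =>
    intro m f g hf hg h
    obtain ⟨m, rfl⟩ : ∃ m', m = m' + 1 := ⟨m - 1, by omega⟩
    simp only [Function.iterate_succ_apply]
    rw [← ih hf.DX hg.DX (by omega)]
    congr 1
    ext z
    simp [DX, fderiv_fun_sub (hf.diff z) (hg.diff z)]

theorem DXit_lim [CompleteSpace E] (h0 : 0 < α) (h1 : α < 1) {C : ℝ} (l : ℕ) : ∀ {m : ℕ} {f : ℕ → ℂ → E} {g : ℂ → E}
    (_ : ∀ j, CH α m C (f j)) (_ : TendstoUniformly f g atTop) (_ : l ≤ m),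
    TendstoUniformly (fun j => DX^[l] (f j)) (DX^[l] g) atTop := by
  induction l with
  | zero => intro m f g hf hg h; exact hg
  | succ l ih =>
    intro m f g hf hg h
    obtain ⟨m, rfl⟩ : ∃ m', m = m' + 1 := ⟨m - 1, by omega⟩
    simp only [Function.iterate_succ_apply]
    refine ih (fun j => (hf j).DX) ?_ (by omega : l ≤ m)
    exact (ContinuousLinearMap.apply ℝ E (1 : ℂ)).uniformContinuous.comp_tendstoUniformly
      (CH_limit_fderiv h0 h1 hf hg).2

theorem DXit_congr (l : ℕ) : ∀ {f g : ℂ → E} {z : ℂ} (_ : f =ᶠ[𝓝 z] g),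
    DX^[l] f =ᶠ[𝓝 z] DX^[l] g := by
  induction l with
  | zero => intro f g z h; exact h
  | succ l ih =>
    intro f g z h
    simp only [Function.iterate_succ_apply]
    refine ih ?_
    filter_upwards [h.fderiv (𝕜 := ℝ)] with w hw
    simp [DX, hw]

variable {J0 : E →L[ℝ] E} {hJ : J0 * J0 = -1}

theorem psiJ_mul (a b : ℂ) (x : E) : psiJ J0 hJ (a * b) x = psiJ J0 hJ a (psiJ J0 hJ b x) := by
  simp only [psiJ, LinearMap.coe_toContinuousLinearMap', AlgHom.toLinearMap_apply, map_mul]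
  rfl

theorem psiJ_one (x : E) : psiJ J0 hJ 1 x = x := by
  simp only [psiJ, LinearMap.coe_toContinuousLinearMap', AlgHom.toLinearMap_apply, map_one]
  rfl

theorem psiJ_I (x : E) : psiJ J0 hJ I x = J0 x := by
  simp [psiJ, LinearMap.coe_toContinuousLinearMap', AlgHom.toLinearMap_apply]

theorem psi_deriv {h : ℂ → ℂ} {h' z : ℂ} (hh : HasDerivAt h h' z) (c : E) :
    ∃ L : ℂ →L[ℝ] E, HasFDerivAt (fun z => psiJ J0 hJ (h z) c) L z ∧ ∀ v, L v = psiJ J0 hJ (v * h') c := by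
  have h1 : HasFDerivAt h _ z := hh.hasFDerivAt.restrictScalars ℝ
  have h2 := (((psiJ J0 hJ).flip c).hasFDerivAt (x := h z)).comp z h1
  refine ⟨_, h2, fun v => ?_⟩
  simp

theorem PP_deriv (N : ℕ) (c : ℕ → E) (z : ℂ) : ∃ L : ℂ →L[ℝ] E,
    HasFDerivAt (PP J0 hJ (N + 1) c) L z ∧
      ∀ v, L v = psiJ J0 hJ v (PP J0 hJ N (fun l => c (l + 1)) z) := by
  have hd : ∀ l, HasDerivAt (fun z : ℂ => z ^ (l + 1) / ((l + 1).factorial : ℂ)) (z ^ l / (l.factorial : ℂ)) z := by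
    intro l
    have := (hasDerivAt_pow (l + 1) z).div_const ((l + 1).factorial : ℂ)
    suffices e : z ^ l / (l.factorial : ℂ) =
        ((l + 1 : ℕ) : ℂ) * z ^ (l + 1 - 1) / ((l + 1).factorial : ℂ) by
      rw [e]; exact this
    rw [Nat.factorial_succ]
    have h1 : ((l : ℂ) + 1) ≠ 0 := by exact_mod_cast Nat.succ_ne_zero l
    have h2 : (l.factorial : ℂ) ≠ 0 := by exact_mod_cast l.factorial_ne_zero
    push_cast
    field_simp
  choose L hL hL2 using fun l => psi_deriv (J0 := J0) (hJ := hJ) (hd l) (c (l + 1))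
  refine ⟨∑ l ∈ Finset.range N, L l, ?_, ?_⟩
  · have e : PP J0 hJ (N + 1) c = fun z => (∑ l ∈ Finset.range N,
        psiJ J0 hJ (z ^ (l + 1) / ((l + 1).factorial : ℂ)) (c (l + 1))) + c 0 := by
      ext z
      rw [PP, Finset.sum_range_succ']
      simp [psiJ_one]
    rw [e]
    exact (HasFDerivAt.fun_sum fun l _ => hL l).add_const _
  · intro v
    simp only [PP, map_sum, _root_.sum_apply]
    refine Finset.sum_congr rfl fun l _ => ?_
    rw [hL2, psiJ_mul]

theorem DX_PP (N : ℕ) (c : ℕ → E) : DX (PP J0 hJ (N + 1) c) = PP J0 hJ N (fun l => c (l + 1)) := by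
  ext z
  obtain ⟨L, hL, hL2⟩ := PP_deriv (J0 := J0) (hJ := hJ) N c z
  rw [DX, hL.fderiv, hL2, psiJ_one]

theorem DXit_PP (l : ℕ) : ∀ (N : ℕ) (c : ℕ → E) (_ : l < N), DX^[l] (PP J0 hJ N c) 0 = c l := by
  induction l with
  | zero =>
    intro N c h
    obtain ⟨N, rfl⟩ : ∃ m', N = m' + 1 := ⟨N - 1, by omega⟩
    simp only [Function.iterate_zero, id]
    rw [PP, Finset.sum_range_succ']
    simp [psiJ_one]
  | succ l ih =>
    intro N c h
    obtain ⟨N, rfl⟩ : ∃ m', N = m' + 1 := ⟨N - 1, by omega⟩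
    rw [Function.iterate_succ_apply, DX_PP, ih N _ (by omega)]

theorem QQ_eq {N : ℕ} {c : ℕ → E} {z : ℂ} (hz : ‖z‖ ≤ 1) : QQ J0 hJ N c =ᶠ[𝓝 z] PP J0 hJ N c := by
  have : ball (0 : ℂ) (3 / 2) ∈ 𝓝 z := isOpen_ball.mem_nhds (by simp; linarith)
  filter_upwards [this] with w hw
  have : chiB w = 1 := chiB.one_of_mem_closedBall (ball_subset_closedBall hw)
  simp [QQ, PP, this]

theorem QQ_jet {N : ℕ} {c : ℕ → E} {l : ℕ} (hl : l < N) : DX^[l] (QQ J0 hJ N c) 0 = c l := by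
  rw [(DXit_congr l (QQ_eq (z := 0) (by simp))).eq_of_nhds, DXit_PP l N c hl]

theorem QQ_D0 {N : ℕ} {c : ℕ → E} {z : ℂ} (hz : ‖z‖ ≤ 1) :
    fderiv ℝ (QQ J0 hJ (N + 1) c) z I - J0 (fderiv ℝ (QQ J0 hJ (N + 1) c) z 1) = 0 := by
  obtain ⟨L, hL, hL2⟩ := PP_deriv (J0 := J0) (hJ := hJ) N c z
  rw [(QQ_eq hz).fderiv_eq, hL.fderiv, hL2, hL2, psiJ_one, psiJ_I, sub_self]

theorem QQ_sub {N : ℕ} {c c' : ℕ → E} : QQ J0 hJ N (fun l => c l - c' l) =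
    fun z => QQ J0 hJ N c z - QQ J0 hJ N c' z := by
  ext z
  simp only [QQ, map_sub, Finset.sum_sub_distrib]

theorem QQ_CH (h0 : 0 < α) (h1 : α < 1) (J0 : E →L[ℝ] E) (hJ : J0 * J0 = -1) (N m : ℕ) :
    ∃ K : ℝ, 0 ≤ K ∧ ∀ (c : ℕ → E) (η : ℝ), (∀ l < N, ‖c l‖ ≤ η) → 0 ≤ η →
      CH α m (K * η) (QQ J0 hJ N c) := by
  have hM : ∀ l : ℕ, ∃ M, CH α m M (fun z : ℂ => chiB z • psiJ J0 hJ (z ^ l / (l.factorial : ℂ))) := by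
    intro l
    refine CH_of_smooth h0 h1 m ?_ ?_
    · refine chiB.contDiff.smul ((psiJ J0 hJ).contDiff.comp ?_)
      have : ContDiff ℂ (⊤ : ℕ∞) (fun z : ℂ => z ^ l / (l.factorial : ℂ)) := by fun_prop
      exact this.restrict_scalars ℝ
    · exact chiB.hasCompactSupport.smul_right
  choose M hM using hM
  refine ⟨∑ l ∈ Finset.range N, M l, Finset.sum_nonneg fun l _ => (hM l).nonneg, fun c η hc hη => ?_⟩
  rw [Finset.sum_mul]
  refine CH.sum (Finset.range N) (C := fun l => M l * η)
    (f := fun l z => (chiB z • psiJ J0 hJ (z ^ l / (l.factorial : ℂ))) (c l)) fun l hl => ?_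
  have := (hM l).clm (ContinuousLinearMap.apply ℝ E (c l))
  refine this.mono ?_
  have hn : ‖ContinuousLinearMap.apply ℝ E (c l)‖ ≤ η := by
    refine ContinuousLinearMap.opNorm_le_bound _ hη fun f => ?_
    have := f.le_opNorm (c l)
    have h3 := hc l (Finset.mem_range.1 hl)
    calc _ ≤ ‖f‖ * ‖c l‖ := this
      _ ≤ ‖f‖ * η := by gcongr
      _ = _ := mul_comm _ _
  have := (hM l).nonneg
  rw [mul_comm]
  gcongr

end jets

noncomputable section

variable {E : Type} [NormedAddCommGroup E] [NormedSpace ℝ E]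

/-- the nonlinearity -/
def FF (S : E → E →L[ℝ] E) (u : ℂ → E) (z : ℂ) : E := chiB z • (S (u z)) (DX u z)

/-- the Picard map -/
def PhiM (J0 : E →L[ℝ] E) (hJ : J0 * J0 = -1) (N : ℕ) (S : E → E →L[ℝ] E) (V : ℕ → E) (u : ℂ → E)
    (z : ℂ) : E :=
  QQ J0 hJ N (fun l => V l - DX^[l] (Tpo J0 (FF S u)) 0) z + Tpo J0 (FF S u) z

end

section picard

variable {α : ℝ} {E : Type} [NormedAddCommGroup E] [NormedSpace ℝ E]
variable {J0 : E →L[ℝ] E} {hJ : J0 * J0 = -1} {S : E → E →L[ℝ] E}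

theorem FF_zero (u : ℂ → E) (z : ℂ) (hz : 2 < ‖z‖) : FF S u z = 0 := by
  have : chiB z = 0 := chiB.zero_of_le_dist (by simpa [chiB] using hz.le)
  simp [FF, this]

theorem FF_cs (u : ℂ → E) : HasCompactSupport (FF S u) :=
  chiB.hasCompactSupport.smul_right

theorem FF_one (u : ℂ → E) (z : ℂ) (hz : ‖z‖ ≤ 1) : FF S u z = S (u z) (DX u z) := by
  have : chiB z = 1 := chiB.one_of_mem_closedBall (by simp [chiB]; linarith)
  simp [FF, this]

theorem CH.chi_app (h0 : 0 < α) (h1 : α < 1) (m : ℕ) : ∃ K : ℝ, 0 ≤ K ∧ ∀ {A : ℂ → E →L[ℝ] E}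
    {v : ℂ → E} {a b : ℝ}, CH α m a A → CH α m b v → CH α m (K * a * b) (fun z => chiB z • (A z) (v z)) := by
  obtain ⟨M, hM⟩ := CH_of_smooth h0 h1 m (α := α) (f := fun z : ℂ => chiB z) chiB.contDiff
    chiB.hasCompactSupport
  have hM0 := hM.nonneg
  refine ⟨2 * 4 ^ m * ‖ContinuousLinearMap.lsmul ℝ ℝ (E := E)‖ * M *
    (2 * 4 ^ m * ‖ContinuousLinearMap.id ℝ (E →L[ℝ] E)‖), by positivity, ?_⟩
  intro A v a b hA hv
  have h2 := hA.bilin h0 h1 (ContinuousLinearMap.id ℝ (E →L[ℝ] E)) hv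
  have h3 := hM.bilin h0 h1 (ContinuousLinearMap.lsmul ℝ ℝ (E := E)) h2
  refine CH.mono h3 (le_of_eq ?_)
  ring

theorem FF_small (h0 : 0 < α) (h1 : α < 1) (m : ℕ) {M : ℝ} (hS : CH α (m + 1) M S) (hS0 : S 0 = 0) :
    ∃ K : ℝ, 0 ≤ K ∧ ∀ {u : ℂ → E} {δ : ℝ}, δ ≤ 1 → CH α (m + 2) δ u →
      CH α (m + 1) (K * δ ^ 2) (FF S u) := by
  obtain ⟨K1, hK1, h11⟩ := CH.chi_app (E := E) h0 h1 (m + 1)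
  obtain ⟨K2, hK2, h22⟩ := CH.comp_small h0 h1 m
  have hM := hS.nonneg
  refine ⟨K1 * (K2 * M), by positivity, fun {u δ} hδ hu => ?_⟩
  exact (h11 (h22 hS hS0 hδ hu) hu.DX).mono (le_of_eq (by ring))

theorem FF_lip (h0 : 0 < α) (h1 : α < 1) (m : ℕ) {M : ℝ} (hS : CH α (m + 1) M S) (hS0 : S 0 = 0) :
    ∃ K : ℝ, 0 ≤ K ∧ ∀ {u v : ℂ → E} {δ η : ℝ}, δ ≤ 1 → CH α (m + 2) δ u → CH α (m + 2) δ v →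
      CH α (m + 1) η (fun z => u z - v z) →
      CH α m (K * δ * η) (fun z => FF S u z - FF S v z) := by
  obtain ⟨K1, hK1, h11⟩ := CH.chi_app (E := E) h0 h1 m
  obtain ⟨K2, hK2, h22⟩ := CH.comp_small h0 h1 m
  obtain ⟨K3, hK3, h33⟩ := CH.comp_lip h0 h1 m 2
  have hM := hS.nonneg
  refine ⟨K1 * (2 * (K2 * M)) + K1 * (K3 * M) * 2, by positivity, fun {u v δ η} hδ hu hv hd => ?_⟩
  have e : (fun z => FF S u z - FF S v z) = fun z => chiB z • (S (u z)) (DX (fun z => u z - v z) z) +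
      chiB z • (S (u z) - S (v z)) (DX v z) := by
    ext z
    have : DX (fun z => u z - v z) z = DX u z - DX v z := by
      simp [DX, fderiv_fun_sub (hu.diff z) (hv.diff z)]
    rw [this]
    simp only [FF, map_sub, _root_.sub_apply, smul_sub]
    abel
  rw [e]
  have ha := h11 ((h22 hS hS0 hδ hu).lower h0 h1) hd.DX
  have hb := h11 (h33 hS ((hu.lower h0 h1).mono (by linarith)) ((hv.lower h0 h1).mono (by linarith)) hd)
    (hv.DX.lower h0 h1)
  exact (ha.add hb).mono (le_of_eq (by ring))

theorem PhiM_jet [CompleteSpace E] (h0 : 0 < α) (h1 : α < 1) {m : ℕ} {C : ℝ} {u : ℂ → E} {V : ℕ → E}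
    (hF : CH α (m + 1) C (FF S u)) {l : ℕ} (hl : l ≤ m + 1) :
    DX^[l] (PhiM J0 hJ (m + 2) S V u) 0 = V l := by
  obtain ⟨K, hK, hT⟩ := Tpo_CH h0 h1 J0
  obtain ⟨K', hK', hQ⟩ := QQ_CH h0 h1 J0 hJ (m + 2) (m + 2)
  have hTF := hT _ (FF_cs u) hF
  obtain ⟨η, hη0, hη⟩ : ∃ η : ℝ, 0 ≤ η ∧ ∀ l < m + 2, ‖V l - DX^[l] (Tpo J0 (FF S u)) 0‖ ≤ η := by
    refine ⟨∑ l ∈ Finset.range (m + 2), ‖V l - DX^[l] (Tpo J0 (FF S u)) 0‖, by positivity, fun l hl => ?_⟩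
    exact Finset.single_le_sum (f := fun l => ‖V l - DX^[l] (Tpo J0 (FF S u)) 0‖)
      (fun _ _ => norm_nonneg _) (Finset.mem_range.2 hl)
  have hQ1 := hQ _ η hη hη0
  have := DXit_add l hQ1 hTF (by omega)
  unfold PhiM
  rw [this]
  beta_reduce
  rw [QQ_jet (by omega)]
  simp

theorem PhiM_D0 [CompleteSpace E] (h0 : 0 < α) (h1 : α < 1) {m : ℕ} {C : ℝ} {u : ℂ → E} {V : ℕ → E}
    (hF : CH α (m + 1) C (FF S u)) {z : ℂ} (hz : ‖z‖ ≤ 1) :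
    fderiv ℝ (PhiM J0 hJ (m + 2) S V u) z I - J0 (fderiv ℝ (PhiM J0 hJ (m + 2) S V u) z 1)
      = S (u z) (fderiv ℝ u z 1) := by
  obtain ⟨K, hK, hT⟩ := Tpo_CH h0 h1 J0
  obtain ⟨K', hK', hQ⟩ := QQ_CH h0 h1 J0 hJ (m + 2) (m + 2)
  have hTF := hT _ (FF_cs u) hF
  obtain ⟨η, hη0, hη⟩ : ∃ η : ℝ, 0 ≤ η ∧ ∀ l < m + 2, ‖V l - DX^[l] (Tpo J0 (FF S u)) 0‖ ≤ η := by
    refine ⟨∑ l ∈ Finset.range (m + 2), ‖V l - DX^[l] (Tpo J0 (FF S u)) 0‖, by positivity, fun l hl => ?_⟩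
    exact Finset.single_le_sum (f := fun l => ‖V l - DX^[l] (Tpo J0 (FF S u)) 0‖)
      (fun _ _ => norm_nonneg _) (Finset.mem_range.2 hl)
  have hQ1 := hQ _ η hη hη0
  have hF0 : CH α 0 (2 * C) (FF S u) := by
    rw [CH_zero_iff]
    have := hF.nonneg
    exact ⟨fun z => (hF.bound z).trans (by linarith), fun x y => hF.holder h0 h1 x y⟩
  have hJ' : ∀ x, J0 (J0 x) = - x := fun x => by
    have := congrArg (fun L : E →L[ℝ] E => L x) hJ
    simpa using this
  have e1 := Tpo_D0 h0 h1 hF0 (FF_zero u) hJ' hz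
  have e2 := QQ_D0 (J0 := J0) (hJ := hJ) (N := m + 1)
    (c := fun l => V l - DX^[l] (Tpo J0 (FF S u)) 0) hz
  have e3 : fderiv ℝ (PhiM J0 hJ (m + 2) S V u) z = _ := fderiv_fun_add (hQ1.diff z) (hTF.diff z)
  rw [e3]
  simp only [_root_.add_apply, map_add]
  have e4 := FF_one (S := S) u z hz
  rw [DX] at e4
  rw [← e4, ← e1, add_sub_add_comm, e2, zero_add]

theorem picard [CompleteSpace E] (h0 : 0 < α) (h1 : α < 1) (m : ℕ) {M : ℝ} (hS : CH α (m + 1) M S) (hS0 : S 0 = 0)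
    (hJ : J0 * J0 = -1) (δ1 : ℝ) (hδ1 : 0 < δ1) : ∃ ε : ℝ, 0 < ε ∧ ∀ V : ℕ → E, (∀ l ≤ m + 1, ‖V l‖ ≤ ε) →
    ∃ u : ℂ → E, CH α (m + 2) δ1 u ∧
      (∀ z : ℂ, ‖z‖ ≤ 1 → fderiv ℝ u z I - J0 (fderiv ℝ u z 1) = S (u z) (fderiv ℝ u z 1)) ∧
      ∀ l ≤ m + 1, DX^[l] u 0 = V l := by
  obtain ⟨KT, hKT, hT⟩ := Tpo_CH h0 h1 J0
  obtain ⟨KQ, hKQ, hQ⟩ := QQ_CH h0 h1 J0 hJ (m + 2) (m + 2)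
  obtain ⟨KR, hKR, hR⟩ := QQ_CH h0 h1 J0 hJ (m + 2) (m + 1)
  obtain ⟨KF, hKF, hF⟩ := FF_small h0 h1 m hS hS0
  obtain ⟨KL, hKL, hL⟩ := FF_lip h0 h1 m hS hS0
  obtain ⟨δ, hδ, hδle, hδ2, hδ3, hδ4⟩ : ∃ δ : ℝ, 0 < δ ∧ δ ≤ 1 ∧ δ ≤ δ1 ∧
      (KQ + 1) * KT * KF * δ ≤ 1 / 2 ∧ (KR + 1) * KT * KL * δ ≤ 1 / 2 := by
    set A := (KQ + 1) * KT * KF with hA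
    set B := (KR + 1) * KT * KL with hB
    have hA0 : 0 ≤ A := by positivity
    have hB0 : 0 ≤ B := by positivity
    refine ⟨min (min 1 δ1) (1 / (2 * (A + B + 1))), by positivity, (min_le_left _ _).trans (min_le_left _ _),
      (min_le_left _ _).trans (min_le_right _ _), ?_, ?_⟩
    · calc _ ≤ A * (1 / (2 * (A + B + 1))) := by gcongr; exact min_le_right _ _
        _ ≤ 1 / 2 := by
          rw [mul_one_div, div_le_div_iff₀ (by positivity) (by norm_num)]; linarith
    · calc _ ≤ B * (1 / (2 * (A + B + 1))) := by gcongr; exact min_le_right _ _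
        _ ≤ 1 / 2 := by
          rw [mul_one_div, div_le_div_iff₀ (by positivity) (by norm_num)]; linarith
  refine ⟨δ / (2 * (KQ + 1)), by positivity, fun V hV => ?_⟩
  set Φ := PhiM J0 hJ (m + 2) S V with hΦ
  -- self map
  have hself : ∀ u, CH α (m + 2) δ u → CH α (m + 2) δ (Φ u) := by
    intro u hu
    have hFu := hF hδle hu
    have hTu := hT _ (FF_cs u) hFu
    have hη : ∀ l < m + 2, ‖V l - DX^[l] (Tpo J0 (FF S u)) 0‖ ≤ δ / (2 * (KQ + 1)) + KT * (KF * δ ^ 2) :=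
      fun l hl => (norm_sub_le _ _).trans (add_le_add (hV l (by omega)) (hTu.jet (by omega) 0))
    have := (hQ _ _ hη (by positivity)).add hTu
    refine CH.mono this ?_
    have e : KQ * (δ / (2 * (KQ + 1)) + KT * (KF * δ ^ 2)) + KT * (KF * δ ^ 2) =
      KQ / (KQ + 1) * (δ / 2) + ((KQ + 1) * KT * KF * δ) * δ := by field_simp; ring
    rw [e]
    have h3 : KQ / (KQ + 1) ≤ 1 := by rw [div_le_one (by positivity)]; linarith
    have h4 : KQ / (KQ + 1) * (δ / 2) ≤ 1 * (δ / 2) := by gcongr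
    have h5 : ((KQ + 1) * KT * KF * δ) * δ ≤ 1 / 2 * δ := by gcongr
    linarith
  have hcontr : ∀ u v η, CH α (m + 2) δ u → CH α (m + 2) δ v → CH α (m + 1) η (fun z => u z - v z) →
      CH α (m + 1) (η / 2) (fun z => Φ u z - Φ v z) := by
    intro u v η hu hv hd
    have hη0 := hd.nonneg
    have hFd := hL hδle hu hv hd
    have hTu := hT _ (FF_cs u) (hF hδle hu)
    have hTv := hT _ (FF_cs v) (hF hδle hv)
    have hTs := Tpo_sub h0 h1 (hF hδle hu) (hF hδle hv) J0
    have hTd := hT _ (f := fun z => FF S u z - FF S v z) ((FF_cs u).sub (FF_cs v)) hFd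
    rw [hTs] at hTd
    have hη : ∀ l < m + 2, ‖(V l - DX^[l] (Tpo J0 (FF S u)) 0) - (V l - DX^[l] (Tpo J0 (FF S v)) 0)‖
        ≤ KT * (KL * δ * η) := by
      intro l hl
      have h3 := hTd.jet (l := l) (by omega) 0
      rw [DXit_sub l hTu hTv (by omega)] at h3
      have h6 : ∀ a b c : E, ‖(a - b) - (a - c)‖ = ‖b - c‖ := fun a b c => by
        rw [norm_sub_rev b c]; congr 1; abel
      rw [h6]
      exact h3
    have h5 := (hR _ _ hη (by positivity)).add hTd
    have e : (fun z => Φ u z - Φ v z) = fun z => QQ J0 hJ (m + 2) (fun l =>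
        (V l - DX^[l] (Tpo J0 (FF S u)) 0) - (V l - DX^[l] (Tpo J0 (FF S v)) 0)) z +
        (Tpo J0 (FF S u) z - Tpo J0 (FF S v) z) := by
      rw [QQ_sub]
      ext z
      simp only [hΦ, PhiM]
      abel
    rw [e]
    refine CH.mono h5 ?_
    have e2 : KR * (KT * (KL * δ * η)) + KT * (KL * δ * η) = ((KR + 1) * KT * KL * δ) * η := by ring
    rw [e2]
    calc _ ≤ 1 / 2 * η := by gcongr
      _ = _ := by ring
  set U : ℕ → ℂ → E := fun j => Φ^[j] (fun _ => 0) with hU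
  have hUs : ∀ j, U (j + 1) = Φ (U j) := fun j => Function.iterate_succ_apply' _ _ _
  have hUC : ∀ j, CH α (m + 2) δ (U j) := by
    intro j
    induction j with
    | zero =>
      refine CH.mono (CH.const (α := α) (X := ℂ) (m := m + 2) (0 : E)) ?_
      simpa using hδ.le
    | succ j ih => rw [hUs]; exact hself _ ih
  have hUd : ∀ j, CH α (m + 1) (4 * δ / 2 ^ j) (fun z => U (j + 1) z - U j z) := by
    intro j
    induction j with
    | zero =>
      refine CH.mono (((hUC 1).lower h0 h1).sub ((hUC 0).lower h0 h1)) ?_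
      simp; linarith
    | succ j ih =>
      rw [hUs (j + 1)]
      have := hcontr _ _ _ (hUC (j + 1)) (hUC j) ih
      rw [← hUs j] at this
      refine CH.mono this (le_of_eq ?_)
      rw [pow_succ]; field_simp
  have hdist : ∀ z j, dist (U j z) (U (j + 1) z) ≤ (8 * δ) / 2 / 2 ^ j := by
    intro z j
    rw [dist_comm, dist_eq_norm]
    exact ((hUd j).bound z).trans (le_of_eq (by ring))
  choose u hu using fun z => cauchySeq_tendsto_of_complete (cauchySeq_of_le_geometric_two (hdist z))
  have hunif : TendstoUniformly U u atTop := by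
    rw [Metric.tendstoUniformly_iff]
    intro ε hε
    have ht : Tendsto (fun j : ℕ => 8 * δ / 2 ^ j) atTop (𝓝 0) := by
      have := (tendsto_pow_atTop_nhds_zero_of_lt_one (r := (1 / 2 : ℝ)) (by norm_num) (by norm_num)).const_mul
        (8 * δ)
      simp only [mul_zero] at this
      refine this.congr fun j => ?_
      rw [one_div, inv_pow]; rfl
    filter_upwards [ht.eventually_lt_const hε] with j hj z
    rw [dist_comm]
    exact (dist_le_of_le_geometric_two_of_tendsto (hdist z) (hu z) j).trans_lt hj
  have huC : CH α (m + 2) δ u := CH_limit h0 h1 (m + 2) hUC hunif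
  have hfd := (CH_limit_fderiv h0 h1 hUC hunif).2
  refine ⟨u, huC.mono hδ2, fun z hz => ?_, fun l hl => ?_⟩
  · have hfz := hfd.tendsto_at z
    have hfz' := hfz.comp (tendsto_add_atTop_nat 1)
    have l1 : Tendsto (fun j => fderiv ℝ (U (j + 1)) z I - J0 (fderiv ℝ (U (j + 1)) z 1)) atTop
        (𝓝 (fderiv ℝ u z I - J0 (fderiv ℝ u z 1))) := by
      refine Tendsto.sub ?_ ?_
      · exact ((ContinuousLinearMap.apply ℝ E I).continuous.tendsto _).comp hfz'
      · exact (J0.continuous.tendsto _).comp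
          (((ContinuousLinearMap.apply ℝ E (1 : ℂ)).continuous.tendsto _).comp hfz')
    have hSc : Continuous S := hS.continuous h0 h1
    have l2 : Tendsto (fun j => S (U j z) (fderiv ℝ (U j) z 1)) atTop
        (𝓝 (S (u z) (fderiv ℝ u z 1))) := by
      have ha : Tendsto (fun j => S (U j z)) atTop (𝓝 (S (u z))) := (hSc.tendsto _).comp (hu z)
      have hb : Tendsto (fun j => fderiv ℝ (U j) z 1) atTop (𝓝 (fderiv ℝ u z 1)) :=
        ((ContinuousLinearMap.apply ℝ E (1 : ℂ)).continuous.tendsto _).comp hfz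
      exact (isBoundedBilinearMap_apply (𝕜 := ℝ) (E := E) (F := E)).continuous.tendsto _ |>.comp
        (ha.prodMk_nhds hb)
    refine tendsto_nhds_unique l1 (l2.congr fun j => ?_)
    rw [hUs]
    exact (PhiM_D0 h0 h1 (hF hδle (hUC j)) hz).symm
  · have := ((DXit_lim h0 h1 l hUC hunif (by omega)).tendsto_at 0).comp (tendsto_add_atTop_nat 1)
    refine tendsto_nhds_unique this (tendsto_const_nhds.congr fun j => ?_)
    simp only [Function.comp_apply]
    rw [hUs]
    exact (PhiM_jet h0 h1 (hF hδle (hUC j)) hl).symm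

end picard

theorem DXit_const_add {E : Type} [NormedAddCommGroup E] [NormedSpace ℝ E] (p : E) (u : ℂ → E) (l : ℕ) :
    DX^[l + 1] (fun z => p + u z) = DX^[l + 1] u := by
  rw [Function.iterate_succ_apply, Function.iterate_succ_apply]
  congr 1
  ext z
  simp [DX, fderiv_const_add]

theorem small_jets_discs {n : ℕ} (k : ℕ) (hk : 1 ≤ k) (α : ℝ) (hα0 : 0 < α) (hα1 : α < 1)
    (Ω : Set (Cn n)) (hΩ : IsOpen Ω)
    (J : Cn n → Cn n →L[ℝ] Cn n)
    (hJk : ContDiffOn ℝ k J Ω)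
    (hJholder : ∀ K : Set (Cn n), IsCompact K → K ⊆ Ω → ∃ C : NNReal,
      HolderOnWith C ⟨α, hα0.le⟩ (iteratedFDeriv ℝ k J) K)
    (hJsq : ∀ x ∈ Ω, (J x).comp (J x) = -ContinuousLinearMap.id ℝ (Cn n))
    (p : Cn n) (hp : p ∈ Ω) :
    ∃ ε : ℝ, 0 < ε ∧ ∀ V : Fin k → Cn n, (∀ l, ‖V l‖ ≤ ε) →
      ∃ u : ℂ → Cn n,
        MapsTo u (Metric.closedBall (0 : ℂ) 1) Ω ∧
        JHolOn J u unitDisc ∧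
        ContDiffOn ℝ (k + 1) u (Metric.closedBall (0 : ℂ) 1) ∧
        (∃ C : NNReal, HolderOnWith C ⟨α, hα0.le⟩
          (iteratedFDerivWithin ℝ (k + 1) u (Metric.closedBall (0 : ℂ) 1))
          (Metric.closedBall (0 : ℂ) 1)) ∧
        u 0 = p ∧
        ∀ l : Fin k,
          (((fun (g : ℂ → Cn n) => fun ζ => fderiv ℝ g ζ 1)^[(l : ℕ) + 1]) u) 0 = V l := by
  obtain ⟨m, rfl⟩ : ∃ m, k = m + 1 := ⟨k - 1, by omega⟩
  set a : NNReal := ⟨α, hα0.le⟩ with ha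
  obtain ⟨r, hr, hrΩ⟩ := Metric.isOpen_iff.1 hΩ p hp
  have hKc : IsCompact (closedBall p (r / 2)) := isCompact_closedBall _ _
  have hKΩ : closedBall p (r / 2) ⊆ Ω := (closedBall_subset_ball (by linarith)).trans hrΩ
  obtain ⟨C, hC⟩ := hJholder _ hKc hKΩ
  obtain ⟨M, hM⟩ := CHOn_of_contDiffOn (α := α) hΩ hKc hKΩ (m + 1) (f := J) (C := C) hJk (by
    intro x hx y hy
    have := hC.dist_le hx hy
    rwa [dist_eq_norm, dist_eq_norm] at this)
  let ψ : ContDiffBump (0 : Cn n) := ⟨r / 4, r / 2, by positivity, by linarith⟩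
  set ρ : Cn n → Cn n := fun x => ψ x • x with hρ
  have hρ1 : ∀ x, ‖x‖ ≤ r / 4 → ρ x = x := by
    intro x hx
    have : ψ x = 1 := ψ.one_of_mem_closedBall (by simpa using hx)
    simp [hρ, this]
  have hρ2 : ∀ x, p + ρ x ∈ closedBall p (r / 2) := by
    intro x
    rw [mem_closedBall, dist_eq_norm, add_sub_cancel_left]
    rcases le_total ‖x‖ (r / 2) with h | h
    · rw [hρ]; simp only [norm_smul]
      rw [Real.norm_of_nonneg ψ.nonneg]
      calc _ ≤ 1 * ‖x‖ := by gcongr; exact ψ.le_one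
        _ ≤ _ := by linarith
    · have : ψ x = 0 := ψ.zero_of_le_dist (by simpa using h)
      simp [hρ, this]; positivity
  obtain ⟨R, hR⟩ := CH_of_smooth (α := α) hα0 hα1 (m + 2) (f := ρ)
    (ψ.contDiff.smul contDiff_id) ψ.hasCompactSupport.smul_right
  have hpR := (CH.const (α := α) (X := Cn n) (m := m + 2) p).add hR
  obtain ⟨K, hK, hcomp⟩ := CHOn.comp hα0 hα1 (m + 1) (‖p‖ + R)
  have hS := (hcomp hM hρ2 hpR).sub (CH.const (α := α) (X := Cn n) (m := m + 1) (J p))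
  set S : Cn n → Cn n →L[ℝ] Cn n := fun x => J (p + ρ x) - J p with hSdef
  have hS0 : S 0 = 0 := by simp [hSdef, hρ]
  have hJ : J p * J p = -1 := hJsq p hp
  obtain ⟨ε, hε, hmain⟩ := picard hα0 hα1 m hS hS0 hJ (r / 4) (by positivity)
  refine ⟨ε, hε, fun V hV => ?_⟩
  obtain ⟨w, hw, hweq, hwj⟩ := hmain
    (fun l => if h : 1 ≤ l ∧ l ≤ m + 1 then V ⟨l - 1, by omega⟩ else 0) (by
      intro l hl
      split_ifs
      · exact hV _
      · simpa using hε.le)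
  have hu : CH α (m + 2) (‖p‖ + r / 4) (fun z => p + w z) :=
    (CH.const (α := α) (X := ℂ) (m := m + 2) p).add hw
  have hmem : ∀ z, p + w z ∈ Ω := by
    intro z
    have := hρ2 (w z)
    rw [hρ1 _ (hw.bound z)] at this
    exact hKΩ this
  have hcd : ContDiff ℝ ((m + 1 : ℕ) + 1 : WithTop ℕ∞) (fun z => p + w z) := by
    exact_mod_cast hu.contDiff hα0 hα1
  refine ⟨fun z => p + w z, fun z _ => hmem z, ?_, hcd.contDiffOn, ?_, ?_, ?_⟩
  · intro z hz
    have hz1 : ‖z‖ ≤ 1 := by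
      have : z ∈ ball (0 : ℂ) 1 := hz
      simpa using (mem_ball_zero_iff.1 this).le
    refine ⟨hu.diff z, ?_⟩
    have hfd : fderiv ℝ (fun z => p + w z) z = fderiv ℝ w z := fderiv_const_add p
    rw [hfd]
    have e1 : fderiv ℝ w z I = J (p + w z) (fderiv ℝ w z 1) := by
      have := hweq z hz1
      rw [hSdef] at this
      simp only [hρ1 _ (hw.bound z), _root_.sub_apply] at this
      exact sub_left_injective this
    have e2 : J (p + w z) (fderiv ℝ w z I) = - fderiv ℝ w z 1 := by
      rw [e1]
      have := congrArg (fun L : Cn n →L[ℝ] Cn n => L (fderiv ℝ w z 1)) (hJsq _ (hmem z))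
      simpa using this
    ext1 ζ
    have hζ : ζ = ζ.re • (1 : ℂ) + ζ.im • I := by
      apply Complex.ext <;> simp
    have hJ1 : JstdC ζ = ζ.re • I - ζ.im • (1 : ℂ) := by
      apply Complex.ext <;> simp [JstdC]
    simp only [ContinuousLinearMap.comp_apply]
    rw [hJ1]
    conv_rhs => rw [hζ]
    simp only [map_add, map_sub, map_smul]
    rw [e2, e1, smul_neg, sub_eq_add_neg]
  · have hC0 := hu.nonneg
    obtain ⟨C', hC'⟩ : ∃ C' : NNReal, (C' : ℝ) = ‖p‖ + r / 4 := ⟨⟨_, hC0⟩, rfl⟩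
    refine ⟨C', ?_⟩
    have hud : UniqueDiffOn ℝ (closedBall (0 : ℂ) 1) :=
      uniqueDiffOn_convex (convex_closedBall _ _) (by
        rw [interior_closedBall _ one_ne_zero]; exact ⟨0, by simp⟩)
    have heq : ∀ x ∈ closedBall (0 : ℂ) 1, iteratedFDerivWithin ℝ (m + 1 + 1) (fun z => p + w z)
        (closedBall (0 : ℂ) 1) x = iteratedFDeriv ℝ (m + 1 + 1) (fun z => p + w z) x := by
      intro x hx
      exact iteratedFDerivWithin_eq_iteratedFDeriv hud (by exact_mod_cast hcd.contDiffAt) hx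
    intro x hx y hy
    rw [heq x hx, heq y hy, edist_nndist, edist_nndist, ← ENNReal.coe_rpow_of_nonneg _ (NNReal.coe_nonneg a),
      ← ENNReal.coe_mul, ENNReal.coe_le_coe, ← NNReal.coe_le_coe]
    rw [NNReal.coe_mul, NNReal.coe_rpow, coe_nndist, coe_nndist, hC', dist_eq_norm, dist_eq_norm]
    exact CH.itF hu x y
  · have := hwj 0 (by omega)
    simp only [Function.iterate_zero, id] at this
    simp [this]
  · intro l
    have h1 : DX^[(l : ℕ) + 1] (fun z => p + w z) 0 = V l := by
      rw [DXit_const_add, hwj _ (by omega)]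
      have : 1 ≤ (l : ℕ) + 1 ∧ (l : ℕ) + 1 ≤ m + 1 := by omega
      simp [this]
      try omega
    exact h1
end
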